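/- Let P be a combinatorially two-orbit convex d-polytope of class 2_{{0, 1, …, d−2}} (facet-intransitive). Then d = 3 and the face lattice L(P) is order-isomorphic to the face lattice of the cuboctahedron or of the icosidodecahedron. -/

import Mathlib

/-! Generic definitions about flags, flag orbits, and abstract polytopes. -/

variable {α : Type*} [PartialOrder α]

/-- Two flags (maximal chains) are in the same orbit of the automorphism group
(the group of order automorphisms) if some order automorphism maps one onto the other. -/
def SameFlagOrbit (Φ Ψ : Flag α) : Prop :=
  ∃ γ : α ≃o α, γ '' (Φ : Set α) = (Ψ : Set α)

/-- The automorphism group has exactly two orbits on the flags. -/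
def TwoFlagOrbits (α : Type*) [PartialOrder α] : Prop :=
  ∃ Φ Ψ : Flag α, ¬ SameFlagOrbit Φ Ψ ∧
    ∀ Ω : Flag α, SameFlagOrbit Ω Φ ∨ SameFlagOrbit Ω Ψ

/-- `Ψ` is the flag `Φ^i`: it differs from `Φ` in exactly the rank-`i` element
(with respect to the rank function `rk`). -/
def IsIAdjacent (rk : α → ℤ) (i : ℤ) (Φ Ψ : Flag α) : Prop :=
  Φ ≠ Ψ ∧ ∀ x : α, rk x ≠ i → (x ∈ Φ ↔ x ∈ Ψ)

/-- A two-orbit polytope (with rank function `rk`, adjacency indices `0, …, n-1`)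
is in class `2_I` if, for every flag `Φ` and every `i < n`, the `i`-adjacent flag `Φ^i`
lies in the same orbit as `Φ` exactly when `i ∈ I`. -/
def InClass (rk : α → ℤ) (n : ℕ) (I : Set ℕ) : Prop :=
  TwoFlagOrbits α ∧
    ∀ (Φ Ψ : Flag α) (i : ℕ), i < n → IsIAdjacent rk i Φ Ψ →
      (SameFlagOrbit Φ Ψ ↔ i ∈ I)

/-- An abstract polytope of rank `d`: a bounded poset, graded by a rank function `rk`
taking values `-1, 0, …, d`, in which every flag (maximal chain) has exactly one element
of each rank, satisfying the diamond condition and strong flag-connectivity. -/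
structure IsAbstractPolytope (α : Type*) [PartialOrder α] [BoundedOrder α]
    (rk : α → ℤ) (d : ℕ) : Prop where
  rk_bot : rk ⊥ = -1
  rk_top : rk ⊤ = d
  rk_strictMono : StrictMono rk
  rk_cover : ∀ x y : α, x ⋖ y → rk y = rk x + 1
  flag_ranks : ∀ (Φ : Flag α) (i : ℤ), -1 ≤ i → i ≤ d → ∃! x, x ∈ Φ ∧ rk x = i
  diamond : ∀ x y : α, x < y → rk y = rk x + 2 →
    ∃ a b : α, a ≠ b ∧ ∀ z : α, (x < z ∧ z < y) ↔ (z = a ∨ z = b)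
  connected : ∀ Φ Ψ : Flag α, ∃ (n : ℕ) (c : Fin (n + 1) → Flag α),
    c 0 = Φ ∧ c (Fin.last n) = Ψ ∧
    (∀ k : Fin n, ∃ i : ℤ, IsIAdjacent rk i (c k.castSucc) (c k.succ)) ∧
    (∀ k, (Φ : Set α) ∩ (Ψ : Set α) ⊆ (c k : Set α))
/-! Definitions about convex polytopes and their face lattices. -/

/-- Euclidean `d`-space. -/
abbrev EucSp (d : ℕ) : Type := EuclideanSpace ℝ (Fin d)

/-- A convex `d`-polytope: the convex hull of a finite set of points of `ℝ^d`,
with nonempty interior. -/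
def IsConvexPolytope {d : ℕ} (P : Set (EucSp d)) : Prop :=
  (∃ S : Finset (EucSp d), P = convexHull ℝ (S : Set (EucSp d))) ∧ (interior P).Nonempty

/-- The face lattice of `P`: the exposed faces of `P` (intersections of `P` with supporting
hyperplanes, together with `∅` and `P` itself), ordered by inclusion. -/
def Faces {d : ℕ} (P : Set (EucSp d)) : Type := {F : Set (EucSp d) // IsExposed ℝ P F}

noncomputable instance {d : ℕ} (P : Set (EucSp d)) : PartialOrder (Faces P) :=
  Subtype.partialOrder _

open scoped Classical

/-- The rank of a face: `-1` for the empty face, and otherwise its affine dimension. -/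
noncomputable def faceRank {d : ℕ} {P : Set (EucSp d)} (F : Faces P) : ℤ :=
  if F.1 = ∅ then -1
  else (Module.finrank ℝ (affineSpan ℝ F.1).direction : ℤ)
/-! The four two-orbit polyhedra. -/

open scoped RealInnerProductSpace

/-- The point `(a, b, c)` of Euclidean 3-space. -/
noncomputable def pt3 (a b c : ℝ) : EucSp 3 := (WithLp.equiv 2 (Fin 3 → ℝ)).symm ![a, b, c]

/-- The golden ratio. -/
noncomputable def goldenφ : ℝ := (1 + Real.sqrt 5) / 2

/-- The 12 vertices of the cuboctahedron: all permutations of the coordinates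
of `(±1, ±1, 0)`. -/
def cuboctaVerts : Set (EucSp 3) :=
  {x | ∃ ε δ : ℝ, (ε = 1 ∨ ε = -1) ∧ (δ = 1 ∨ δ = -1) ∧
    (x = pt3 ε δ 0 ∨ x = pt3 ε 0 δ ∨ x = pt3 0 ε δ)}

/-- The cuboctahedron. -/
noncomputable def Cuboctahedron : Set (EucSp 3) := convexHull ℝ cuboctaVerts

/-- The 30 vertices of the icosidodecahedron: all cyclic permutations of the coordinates
of `(0, 0, ±φ)` and of `(±1/2, ±φ/2, ±φ²/2)`. -/
def icosidodecaVerts : Set (EucSp 3) :=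
  {x | (∃ ε : ℝ, (ε = 1 ∨ ε = -1) ∧
        (x = pt3 0 0 (ε * goldenφ) ∨ x = pt3 (ε * goldenφ) 0 0 ∨ x = pt3 0 (ε * goldenφ) 0)) ∨
      (∃ ε₁ ε₂ ε₃ : ℝ, (ε₁ = 1 ∨ ε₁ = -1) ∧ (ε₂ = 1 ∨ ε₂ = -1) ∧ (ε₃ = 1 ∨ ε₃ = -1) ∧
        (x = pt3 (ε₁ / 2) (ε₂ * goldenφ / 2) (ε₃ * goldenφ ^ 2 / 2) ∨
         x = pt3 (ε₃ * goldenφ ^ 2 / 2) (ε₁ / 2) (ε₂ * goldenφ / 2) ∨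
         x = pt3 (ε₂ * goldenφ / 2) (ε₃ * goldenφ ^ 2 / 2) (ε₁ / 2)))}

/-- The icosidodecahedron. -/
noncomputable def Icosidodecahedron : Set (EucSp 3) := convexHull ℝ icosidodecaVerts

/-- The 14 vertices of the rhombic dodecahedron: the points `(±1, ±1, ±1)` together with
`(±2, 0, 0)`, `(0, ±2, 0)`, `(0, 0, ±2)`. -/
def rhombicDodecaVerts : Set (EucSp 3) :=
  {x | (∃ ε₁ ε₂ ε₃ : ℝ, (ε₁ = 1 ∨ ε₁ = -1) ∧ (ε₂ = 1 ∨ ε₂ = -1) ∧ (ε₃ = 1 ∨ ε₃ = -1) ∧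
        x = pt3 ε₁ ε₂ ε₃) ∨
      (∃ ε : ℝ, (ε = 2 ∨ ε = -2) ∧ (x = pt3 ε 0 0 ∨ x = pt3 0 ε 0 ∨ x = pt3 0 0 ε))}

/-- The rhombic dodecahedron. -/
noncomputable def RhombicDodecahedron : Set (EucSp 3) := convexHull ℝ rhombicDodecaVerts

/-- The rhombic triacontahedron: the polar dual of the icosidodecahedron. -/
noncomputable def RhombicTriacontahedron : Set (EucSp 3) :=
  {y | ∀ x ∈ Icosidodecahedron, ⟪x, y⟫ ≤ 1}

/-- A finite graded poset with the properties of face lattices that are used below. -/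
structure GP (α : Type*) [PartialOrder α] (rk : α → ℤ) (d : ℕ) : Prop where
  fin : Finite α
  mono : StrictMono rk
  lo : ∀ x, -1 ≤ rk x
  hi : ∀ x, rk x ≤ d
  bot : ∀ x y, rk x = -1 → x ≤ y
  top : ∀ x y, rk x = d → y ≤ x
  ranks : ∀ (Φ : Flag α) (n : ℕ), n ≤ d + 1 → ∃ x, x ∈ Φ ∧ rk x = (n : ℤ) - 1
  diamond : ∀ x y, x < y → rk y = rk x + 2 →
    ∃ a b, a ≠ b ∧ ∀ z, (x < z ∧ z < y) ↔ (z = a ∨ z = b)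
  meet : ∀ x x' y y', rk x = rk x' → rk y = rk x + 1 → rk y' = rk x + 1 → x ≠ x' →
    x ≤ y → x' ≤ y → x ≤ y' → x' ≤ y' → y = y'

namespace GP

variable {rk : α → ℤ} {d : ℕ}

/-- The face of rank `n - 1` of a flag (for `n ≤ d + 1`; clamped above that). -/
noncomputable def fc (h : GP α rk d) (Φ : Flag α) (n : ℕ) : α :=
  Classical.choose (h.ranks Φ (min n (d + 1)) (min_le_right _ _))

theorem fc_mem (h : GP α rk d) (Φ : Flag α) (n : ℕ) : h.fc Φ n ∈ Φ :=
  (Classical.choose_spec (h.ranks Φ (min n (d + 1)) (min_le_right _ _))).1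

theorem rk_fc (h : GP α rk d) (Φ : Flag α) {n : ℕ} (hn : n ≤ d + 1) : rk (h.fc Φ n) = (n : ℤ) - 1 := by
  have := (Classical.choose_spec (h.ranks Φ (min n (d + 1)) (min_le_right _ _))).2
  exact this.trans (by rw [min_eq_left hn])

theorem eq_of_rk (h : GP α rk d) {Φ : Flag α} {x y : α} (hx : x ∈ Φ) (hy : y ∈ Φ) (e : rk x = rk y) : x = y := by
  rcases Φ.le_or_le hx hy with hl | hl
  · rcases hl.lt_or_eq with h1 | h1
    · exact absurd (h.mono h1) (by omega)
    · exact h1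
  · rcases hl.lt_or_eq with h1 | h1
    · exact absurd (h.mono h1) (by omega)
    · exact h1.symm

theorem le_of_rk (h : GP α rk d) {Φ : Flag α} {x y : α} (hx : x ∈ Φ) (hy : y ∈ Φ) (e : rk x ≤ rk y) : x ≤ y := by
  rcases Φ.le_or_le hx hy with hl | hl
  · exact hl
  · rcases hl.lt_or_eq with h1 | h1
    · exact absurd (h.mono h1) (by omega)
    · exact h1.symm.le

theorem fc_eq (h : GP α rk d) {Φ : Flag α} {x : α} {n : ℕ} (hn : n ≤ d + 1) (hx : x ∈ Φ)
    (e : rk x = (n : ℤ) - 1) : h.fc Φ n = x :=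
  h.eq_of_rk (h.fc_mem Φ n) hx (by rw [h.rk_fc Φ hn, e])

theorem fc_clamp (h : GP α rk d) (Φ : Flag α) {n : ℕ} (hn : d + 1 ≤ n) : h.fc Φ n = h.fc Φ (d + 1) := by
  unfold fc
  congr 1
  simp [min_eq_right hn]

theorem fc_le (h : GP α rk d) (Φ : Flag α) {m n : ℕ} (hmn : m ≤ n) : h.fc Φ m ≤ h.fc Φ n := by
  rcases le_total n (d + 1) with hn | hn
  · exact h.le_of_rk (h.fc_mem _ _) (h.fc_mem _ _)
      (by rw [h.rk_fc Φ hn, h.rk_fc Φ (hmn.trans hn)]; omega)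
  · rw [h.fc_clamp Φ hn]
    rcases le_total m (d + 1) with hm | hm
    · exact h.le_of_rk (h.fc_mem _ _) (h.fc_mem _ _)
        (by rw [h.rk_fc Φ hm, h.rk_fc Φ le_rfl]; omega)
    · rw [h.fc_clamp Φ hm]

theorem fc_lt (h : GP α rk d) (Φ : Flag α) {m n : ℕ} (hmn : m < n) (hn : n ≤ d + 1) : h.fc Φ m < h.fc Φ n := by
  refine lt_of_le_of_ne (h.fc_le Φ hmn.le) fun e => ?_
  have := congrArg rk e
  rw [h.rk_fc Φ hn, h.rk_fc Φ (hmn.le.trans hn)] at this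
  omega

theorem exists_idx (h : GP α rk d) (x : α) : ∃ n : ℕ, n ≤ d + 1 ∧ rk x = (n : ℤ) - 1 :=
  ⟨(rk x + 1).toNat, by have := h.lo x; have := h.hi x; omega, by have := h.lo x; omega⟩

theorem mem_iff (h : GP α rk d) {Φ : Flag α} {x : α} {n : ℕ} (hn : n ≤ d + 1) (e : rk x = (n : ℤ) - 1) :
    x ∈ Φ ↔ h.fc Φ n = x :=
  ⟨fun hx => h.fc_eq hn hx e, fun hx => hx ▸ h.fc_mem Φ n⟩

theorem fc_zero (h : GP α rk d) (Φ Ψ : Flag α) : h.fc Φ 0 = h.fc Ψ 0 :=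
  le_antisymm (h.bot _ _ (by rw [h.rk_fc _ (by omega)]; simp))
    (h.bot _ _ (by rw [h.rk_fc _ (by omega)]; simp))

theorem fc_top (h : GP α rk d) (Φ Ψ : Flag α) : h.fc Φ (d + 1) = h.fc Ψ (d + 1) :=
  le_antisymm (h.top _ _ (by rw [h.rk_fc _ (by omega)]; simp))
    (h.top _ _ (by rw [h.rk_fc _ (by omega)]; simp))

theorem flag_ext (h : GP α rk d) {Φ Ψ : Flag α} (e : ∀ i < d, h.fc Φ (i + 1) = h.fc Ψ (i + 1)) : Φ = Ψ := by
  apply SetLike.ext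
  intro x
  obtain ⟨n, hn, hx⟩ := h.exists_idx x
  rw [h.mem_iff hn hx, h.mem_iff hn hx]
  have : h.fc Φ n = h.fc Ψ n := by
    rcases Nat.eq_zero_or_pos n with rfl | h0
    · exact h.fc_zero _ _
    · rcases hn.lt_or_eq with h1 | rfl
      · have := e (n - 1) (by omega)
        rwa [Nat.sub_add_cancel h0] at this
      · exact h.fc_top _ _
  rw [this]

/-- Build a flag from a chain of faces of all ranks. -/
def mkFlag (h : GP α rk d) (f : ℕ → α) (hf : ∀ n ≤ d + 1, rk (f n) = (n : ℤ) - 1)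
    (hm : ∀ n ≤ d, f n ≤ f (n + 1)) : Flag α where
  carrier := {x | ∃ n ≤ d + 1, f n = x}
  Chain' := by
    have key : ∀ m n, m ≤ n → n ≤ d + 1 → f m ≤ f n := by
      intro m n hmn
      induction n, hmn using Nat.le_induction with
      | base => intro _; exact le_rfl
      | succ n hn ih => intro h1; exact (ih (by omega)).trans (hm n (by omega))
    rintro _ ⟨m, hm1, rfl⟩ _ ⟨n, hn1, rfl⟩ _
    rcases le_total m n with hl | hl
    · exact Or.inl (key _ _ hl hn1)
    · exact Or.inr (key _ _ hl hm1)
  max_chain' := by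
    intro s hs hsub
    refine Set.Subset.antisymm hsub fun x hx => ?_
    obtain ⟨n, hn, e⟩ := h.exists_idx x
    refine ⟨n, hn, ?_⟩
    by_contra hne
    have hfn : f n ∈ s := hsub ⟨n, hn, rfl⟩
    have hr := hf n hn
    rcases hs hfn hx hne with h1 | h1
    · have := h.mono (lt_of_le_of_ne h1 hne); omega
    · have := h.mono (lt_of_le_of_ne h1 (Ne.symm hne)); omega

theorem fc_mkFlag (h : GP α rk d) (f : ℕ → α) (hf : ∀ n ≤ d + 1, rk (f n) = (n : ℤ) - 1)
    (hm : ∀ n ≤ d, f n ≤ f (n + 1)) {n : ℕ} (hn : n ≤ d + 1) :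
    h.fc (h.mkFlag f hf hm) n = f n :=
  h.fc_eq hn ⟨n, hn, rfl⟩ (hf n hn)

theorem adj_iff (h : GP α rk d) {Φ Ψ : Flag α} {i : ℕ} (hi : i < d) :
    IsIAdjacent rk i Φ Ψ ↔
      (h.fc Φ (i + 1) ≠ h.fc Ψ (i + 1) ∧ ∀ n ≠ i + 1, h.fc Φ n = h.fc Ψ n) := by
  constructor
  · rintro ⟨hne, hag⟩
    have key : ∀ n ≤ d + 1, n ≠ i + 1 → h.fc Φ n = h.fc Ψ n := by
      intro n hn hni
      have := (hag (h.fc Φ n) (by rw [h.rk_fc _ hn]; omega)).1 (h.fc_mem _ _)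
      exact (h.fc_eq hn this (h.rk_fc _ hn)).symm
    refine ⟨fun e => hne (h.flag_ext fun j hj => ?_), fun n hni => ?_⟩
    · by_cases hji : j = i
      · rw [hji]; exact e
      · exact key _ (by omega) (by omega)
    · rcases le_total n (d + 1) with hn | hn
      · exact key n hn hni
      · rw [h.fc_clamp _ hn, h.fc_clamp _ hn, h.fc_top]
  · rintro ⟨hne, hag⟩
    refine ⟨fun e => hne (by rw [e]), fun x hx => ?_⟩
    obtain ⟨n, hn, e⟩ := h.exists_idx x
    rw [h.mem_iff hn e, h.mem_iff hn e, hag n (by omega)]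

theorem exists_adj (h : GP α rk d) (Φ : Flag α) {i : ℕ} (hi : i < d) : ∃ Ψ, IsIAdjacent rk i Φ Ψ := by
  obtain ⟨a, b, hab, hz⟩ := h.diamond (h.fc Φ i) (h.fc Φ (i + 2)) (h.fc_lt Φ (by omega) (by omega))
    (by rw [h.rk_fc _ (by omega), h.rk_fc _ (by omega)]; push_cast; ring)
  have h1 := (hz (h.fc Φ (i + 1))).1 ⟨h.fc_lt Φ (by omega) (by omega), h.fc_lt Φ (by omega) (by omega)⟩
  obtain ⟨c, hc, hc1, hc2⟩ : ∃ c, c ≠ h.fc Φ (i + 1) ∧ h.fc Φ i < c ∧ c < h.fc Φ (i + 2) := by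
    rcases h1 with h1 | h1
    · exact ⟨b, by rw [h1]; exact hab.symm, (hz b).2 (Or.inr rfl)⟩
    · exact ⟨a, by rw [h1]; exact hab, (hz a).2 (Or.inl rfl)⟩
  have hrc : rk c = i := by
    have e1 := h.mono hc1
    have e2 := h.mono hc2
    rw [h.rk_fc _ (by omega)] at e1 e2
    push_cast at e1 e2
    omega
  have hf : ∀ n ≤ d + 1, rk (Function.update (h.fc Φ) (i + 1) c n) = (n : ℤ) - 1 := by
    intro n hn
    by_cases e : n = i + 1
    · subst e; simp [hrc]
    · rw [Function.update_of_ne e, h.rk_fc _ hn]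
  have hm : ∀ n ≤ d, Function.update (h.fc Φ) (i + 1) c n ≤ Function.update (h.fc Φ) (i + 1) c (n + 1) := by
    intro n hn
    by_cases e : n = i + 1
    · subst e; rw [Function.update_self, Function.update_of_ne (by omega)]; exact hc2.le
    · by_cases e' : n = i
      · subst e'; rw [Function.update_self, Function.update_of_ne (by omega)]; exact hc1.le
      · rw [Function.update_of_ne e, Function.update_of_ne (by omega)]; exact h.fc_le _ (by omega)
  refine ⟨h.mkFlag _ hf hm, (h.adj_iff hi).2 ⟨?_, fun n hn => ?_⟩⟩
  · rw [h.fc_mkFlag _ hf hm (by omega), Function.update_self]; exact hc.symm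
  · rcases le_total n (d + 1) with hn' | hn'
    · rw [h.fc_mkFlag _ hf hm hn', Function.update_of_ne hn]
    · rw [h.fc_clamp _ hn', h.fc_clamp _ hn', h.fc_top]

/-- The `i`-adjacent flag (for `i < d`; identity otherwise). -/
noncomputable def r (h : GP α rk d) (i : ℕ) (Φ : Flag α) : Flag α :=
  if hi : i < d then Classical.choose (h.exists_adj Φ hi) else Φ

theorem adj_r (h : GP α rk d) (Φ : Flag α) {i : ℕ} (hi : i < d) : IsIAdjacent rk i Φ (h.r i Φ) := by
  unfold r
  rw [dif_pos hi]
  exact Classical.choose_spec (h.exists_adj Φ hi)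

theorem fc_r_ne (h : GP α rk d) (Φ : Flag α) {i n : ℕ} (hn : n ≠ i + 1) : h.fc (h.r i Φ) n = h.fc Φ n := by
  by_cases hi : i < d
  · exact (((h.adj_iff hi).1 (h.adj_r Φ hi)).2 n hn).symm
  · unfold r; rw [dif_neg hi]

theorem fc_r_self (h : GP α rk d) (Φ : Flag α) {i : ℕ} (hi : i < d) : h.fc (h.r i Φ) (i + 1) ≠ h.fc Φ (i + 1) :=
  (((h.adj_iff hi).1 (h.adj_r Φ hi)).1).symm

/-- Three faces between consecutive faces cannot be distinct. -/
theorem two_of_diamond (h : GP α rk d) {x y a b c : α} (hr : rk y = rk x + 2) (ha : x < a ∧ a < y)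
    (hb : x < b ∧ b < y) (hc : x < c ∧ c < y) (hab : a ≠ b) (hac : a ≠ c) : b = c := by
  obtain ⟨p, q, hpq, hz⟩ := h.diamond x y (ha.1.trans ha.2) hr
  rcases (hz a).1 ha with h1 | h1 <;> rcases (hz b).1 hb with h2 | h2 <;>
    rcases (hz c).1 hc with h3 | h3 <;> subst_vars <;> simp_all

theorem fc_between (h : GP α rk d) (Φ Ψ : Flag α) {i : ℕ} (hi : i < d) (h0 : h.fc Ψ i = h.fc Φ i)
    (h2 : h.fc Ψ (i + 2) = h.fc Φ (i + 2)) :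
    h.fc Φ i < h.fc Ψ (i + 1) ∧ h.fc Ψ (i + 1) < h.fc Φ (i + 2) := by
  rw [← h0, ← h2]
  exact ⟨h.fc_lt _ (by omega) (by omega), h.fc_lt _ (by omega) (by omega)⟩

/-- If `Ψ` agrees with `Φ` at ranks `i-1, i+1` but not at `i`, its `i`-face is that of `Φ^i`. -/
theorem fc_r_eq (h : GP α rk d) (Φ Ψ : Flag α) {i : ℕ} (hi : i < d) (h0 : h.fc Ψ i = h.fc Φ i)
    (h2 : h.fc Ψ (i + 2) = h.fc Φ (i + 2)) (hne : h.fc Ψ (i + 1) ≠ h.fc Φ (i + 1)) :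
    h.fc (h.r i Φ) (i + 1) = h.fc Ψ (i + 1) := by
  refine h.two_of_diamond (x := h.fc Φ i) (y := h.fc Φ (i + 2)) (a := h.fc Φ (i + 1)) ?_
    (h.fc_between Φ Φ hi rfl rfl) (h.fc_between Φ _ hi ?_ ?_) (h.fc_between Φ _ hi h0 h2)
    (h.fc_r_self Φ hi).symm hne.symm
  · rw [h.rk_fc _ (by omega), h.rk_fc _ (by omega)]; push_cast; ring
  · exact h.fc_r_ne _ (by omega)
  · exact h.fc_r_ne _ (by omega)

theorem eq_r_of_adj (h : GP α rk d) {Φ Ψ : Flag α} {i : ℕ} (hi : i < d) (ha : IsIAdjacent rk i Φ Ψ) :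
    Ψ = h.r i Φ := by
  have ha := (h.adj_iff hi).1 ha
  refine h.flag_ext fun j hj => ?_
  by_cases e : j = i
  · subst e
    exact (h.fc_r_eq Φ Ψ hi (ha.2 _ (by omega)).symm (ha.2 _ (by omega)).symm ha.1.symm).symm
  · rw [h.fc_r_ne _ (by omega), ha.2 _ (by omega)]

theorem r_r (h : GP α rk d) (i : ℕ) (Φ : Flag α) : h.r i (h.r i Φ) = Φ := by
  by_cases hi : i < d
  · have := h.adj_r Φ hi
    symm
    apply h.eq_r_of_adj hi
    exact ⟨this.1.symm, fun x hx => (this.2 x hx).symm⟩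
  · unfold r; simp [dif_neg hi]

theorem r_ne (h : GP α rk d) {i : ℕ} (hi : i < d) (Φ : Flag α) : h.r i Φ ≠ Φ := fun e =>
  h.fc_r_self Φ hi (by rw [e])

theorem r_comm (h : GP α rk d) {i j : ℕ} (hij : i + 2 ≤ j) (Φ : Flag α) :
    h.r i (h.r j Φ) = h.r j (h.r i Φ) := by
  by_cases hj : j < d
  · have hi : i < d := by omega
    refine h.flag_ext fun k hk => ?_
    by_cases e : k = i
    · subst e
      rw [h.fc_r_ne (i := j) _ (by omega)]
      symm
      apply h.fc_r_eq _ _ hi (by rw [h.fc_r_ne _ (by omega), h.fc_r_ne _ (by omega)])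
          (by rw [h.fc_r_ne _ (by omega), h.fc_r_ne _ (by omega)]) ?_ |>.symm
      rw [h.fc_r_ne (i := j) _ (by omega)]
      exact h.fc_r_self _ hi
    · by_cases e' : k = j
      · subst e'
        rw [h.fc_r_ne (i := i) _ (by omega)]
        symm
        apply h.fc_r_eq _ _ hj (by rw [h.fc_r_ne _ (by omega), h.fc_r_ne _ (by omega)])
          (by rw [h.fc_r_ne _ (by omega), h.fc_r_ne _ (by omega)]) ?_
        rw [h.fc_r_ne (i := i) _ (by omega)]
        exact h.fc_r_self _ hj
      · rw [h.fc_r_ne _ (by omega), h.fc_r_ne _ (by omega), h.fc_r_ne _ (by omega),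
          h.fc_r_ne _ (by omega)]
  · unfold r; simp [dif_neg hj]

theorem finite_flag (h : GP α rk d) : Finite (Flag α) := by
  have := h.fin
  exact Finite.of_injective (fun Φ : Flag α => (Φ : Set α)) SetLike.coe_injective

end GP

namespace GP

variable {rk : α → ℤ} {d : ℕ}

/-- A generic height function on flags. -/
structure Height (h : GP α rk d) {Λ : Type*} [LinearOrder Λ] (ψ : Flag α → Λ) : Prop where
  ne : ∀ i < d, ∀ Φ, ψ (h.r i Φ) ≠ ψ Φ
  minuniq : ∀ (k : ℕ) (Φ Ψ : Flag α), h.fc Φ k = h.fc Ψ k →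
    (∀ i < d, i + 1 ≠ k → ψ Φ < ψ (h.r i Φ)) → (∀ i < d, i + 1 ≠ k → ψ Ψ < ψ (h.r i Ψ)) → Φ = Ψ
  maxuniq : ∀ (i j : ℕ) (Φ Ψ : Flag α), i < j → j < d →
    (∀ n, n ≠ i + 1 → n ≠ j + 1 → h.fc Φ n = h.fc Ψ n) →
    ψ (h.r i Φ) < ψ Φ → ψ (h.r j Φ) < ψ Φ → ψ (h.r i Ψ) < ψ Ψ → ψ (h.r j Ψ) < ψ Ψ → Φ = Ψ

section
variable {Λ : Type*} [LinearOrder Λ] {ψ : Flag α → Λ}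

theorem wf (h : GP α rk d) (ψ : Flag α → Λ) : WellFounded (fun Φ Ψ : Flag α => ψ Φ < ψ Ψ) := by
  have := h.finite_flag
  have : IsTrans (Flag α) (fun Φ Ψ : Flag α => ψ Φ < ψ Ψ) := ⟨fun _ _ _ a b => lt_trans a b⟩
  have : Std.Irrefl (fun Φ Ψ : Flag α => ψ Φ < ψ Ψ) := ⟨fun _ => lt_irrefl _⟩
  exact Finite.wellFounded_of_trans_of_irrefl _

theorem Height.exists_min {h : GP α rk d} (H : h.Height ψ) (k : ℕ) (p : Flag α → Prop)
    (hp : ∀ Φ, ∀ i < d, i + 1 ≠ k → p Φ → p (h.r i Φ)) (Φ : Flag α) :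
    ∃ m, h.fc m k = h.fc Φ k ∧ (∀ i < d, i + 1 ≠ k → ψ m < ψ (h.r i m)) ∧ (p Φ ↔ p m) := by
  induction Φ using (h.wf ψ).induction with
  | _ Φ ih =>
    by_cases hm : ∀ i < d, i + 1 ≠ k → ψ Φ < ψ (h.r i Φ)
    · exact ⟨Φ, rfl, hm, Iff.rfl⟩
    · push Not at hm
      obtain ⟨i, hi, hik, hle⟩ := hm
      obtain ⟨m, e1, e2, e3⟩ := ih (h.r i Φ) (lt_of_le_of_ne hle (H.ne i hi Φ))
      refine ⟨m, e1.trans (h.fc_r_ne _ (Ne.symm hik)), e2, Iff.trans ⟨hp _ i hi hik, fun q => ?_⟩ e3⟩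
      have := hp _ i hi hik q
      rwa [h.r_r] at this

/-- Connectivity of flags through a fixed face. -/
theorem Height.conn {h : GP α rk d} (H : h.Height ψ) (k : ℕ) (p : Flag α → Prop)
    (hp : ∀ Φ, ∀ i < d, i + 1 ≠ k → p Φ → p (h.r i Φ)) (Φ Ψ : Flag α)
    (e : h.fc Φ k = h.fc Ψ k) (q : p Φ) : p Ψ := by
  obtain ⟨m, a1, a2, a3⟩ := H.exists_min k p hp Φ
  obtain ⟨m', b1, b2, b3⟩ := H.exists_min k p hp Ψ
  have : m = m' := H.minuniq k m m' (by rw [a1, b1, e]) a2 b2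
  subst this
  exact b3.2 (a3.1 q)

theorem Height.conn0 {h : GP α rk d} (H : h.Height ψ) (p : Flag α → Prop)
    (hp : ∀ Φ, ∀ i < d, p Φ → p (h.r i Φ)) (Φ Ψ : Flag α) (q : p Φ) : p Ψ :=
  H.conn 0 p (fun Φ i hi _ => hp Φ i hi) Φ Ψ (h.fc_zero _ _) q

theorem iterate_ne (h : GP α rk d) {i j : ℕ} (hi : i < d) (hj : j < d) (k : ℕ) :
    ∀ Φ, (h.r i ∘ h.r j)^[k] Φ ≠ h.r j Φ := by
  induction k using Nat.twoStepInduction with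
  | zero => intro Φ; exact (h.r_ne hj Φ).symm
  | one => intro Φ; exact h.r_ne hi _
  | more k ih _ =>
    intro Φ e
    rw [Function.iterate_succ_apply', Function.iterate_succ_apply] at e
    apply ih ((h.r i ∘ h.r j) Φ)
    have e2 := congrArg (h.r i) e
    rw [Function.comp_apply, h.r_r] at e2
    have e3 := congrArg (h.r j) e2
    rw [h.r_r] at e3
    exact e3

theorem fc_iterate (h : GP α rk d) {i j n : ℕ} (hi : n ≠ i + 1) (hj : n ≠ j + 1) (k : ℕ) :
    ∀ Φ, h.fc ((h.r i ∘ h.r j)^[k] Φ) n = h.fc Φ n := by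
  induction k with
  | zero => intro Φ; rfl
  | succ k ih =>
    intro Φ
    rw [Function.iterate_succ_apply, ih, Function.comp_apply, h.fc_r_ne _ hi, h.fc_r_ne _ hj]

theorem Height.res_lt {h : GP α rk d} (H : h.Height ψ) {i j : ℕ} (hij : i < j) (hj : j < d)
    {Φ : Flag α} (hi1 : ψ (h.r i Φ) < ψ Φ) (hj1 : ψ (h.r j Φ) < ψ Φ) (Ω : Flag α)
    (hΩ : ∀ n, n ≠ i + 1 → n ≠ j + 1 → h.fc Ω n = h.fc Φ n) (hne : Ω ≠ Φ) : ψ Ω < ψ Φ := by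
  have := h.finite_flag
  let S : Set (Flag α) := {Ω | ∀ n, n ≠ i + 1 → n ≠ j + 1 → h.fc Ω n = h.fc Φ n}
  have hS : S.Finite := Set.toFinite _
  have key : ∀ M ∈ S, (∀ Ω ∈ S, ψ Ω ≤ ψ M) → M = Φ := by
    intro M hM hmax
    have hl : ∀ l, (l = i ∨ l = j) → l < d → ψ (h.r l M) < ψ M := by
      intro l hl hld
      refine lt_of_le_of_ne (hmax _ fun n h1 h2 => ?_) (H.ne l hld M)
      rw [h.fc_r_ne _ (by rcases hl with rfl | rfl <;> assumption)]
      exact hM n h1 h2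
    exact H.maxuniq i j M Φ hij hj hM (hl i (Or.inl rfl) (by omega)) (hl j (Or.inr rfl) hj) hi1 hj1
  obtain ⟨M, hM, hmax⟩ := hS.exists_maximalFor ψ S ⟨Φ, fun _ _ _ => rfl⟩
  have hmax' : ∀ Ω ∈ S, ψ Ω ≤ ψ M := fun Ω hΩ => by
    rcases le_total (ψ Ω) (ψ M) with h1 | h1
    · exact h1
    · exact hmax hΩ h1
  have := key M hM hmax'
  subst this
  refine lt_of_le_of_ne (hmax' _ hΩ) fun e => hne (key Ω hΩ fun Ω' h' => ?_)
  rw [e]; exact hmax' _ h'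

/-- The development relation. -/
inductive Dev (h : GP α rk d) (ψ : Flag α → Λ) {Y : Type*} (ρ : ℕ → Y → Y) (m : Flag α) (y0 : Y) :
    Flag α → Y → Prop
  | base : Dev h ψ ρ m y0 m y0
  | step (Φ y i) (hi : i < d) (hlt : ψ Φ < ψ (h.r i Φ)) (hd : Dev h ψ ρ m y0 Φ y) :
      Dev h ψ ρ m y0 (h.r i Φ) (ρ i y)

theorem Dev.inv {h : GP α rk d} {Y : Type*} {ρ : ℕ → Y → Y} {m : Flag α} {y0 : Y} {Φ y}
    (hD : Dev h ψ ρ m y0 Φ y) : (Φ = m ∧ y = y0) ∨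
      ∃ i z, i < d ∧ ψ (h.r i Φ) < ψ Φ ∧ Dev h ψ ρ m y0 (h.r i Φ) z ∧ y = ρ i z := by
  cases hD with
  | base => exact Or.inl ⟨rfl, rfl⟩
  | step Φ z i hi hlt hd => exact Or.inr ⟨i, z, hi, by rwa [h.r_r], by rwa [h.r_r], rfl⟩

theorem Height.dev_aux {h : GP α rk d} (H : h.Height ψ) {Y : Type*} (ρ : ℕ → Y → Y)
    (ok : Flag α → Y → Prop) (hok : ∀ i < d, ∀ Φ y, ok Φ y → ok (h.r i Φ) (ρ i y))
    (hρ : ∀ i y, ρ i (ρ i y) = y)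
    (hper : ∀ i j, i < j → j < d → ∀ Φ y, ok Φ y →
      (ρ i ∘ ρ j)^[Function.minimalPeriod (h.r i ∘ h.r j) Φ] y = y)
    (m : Flag α) (hm : ∀ i < d, ψ m < ψ (h.r i m)) (y0 : Y) (hy0 : ok m y0) :
    ∃ D : Flag α → Y, D m = y0 ∧ (∀ Φ, ok Φ (D Φ)) ∧ ∀ i < d, ∀ Φ, D (h.r i Φ) = ρ i (D Φ) := by
  have hfin := h.finite_flag
  have hokD : ∀ Φ y, Dev h ψ ρ m y0 Φ y → ok Φ y := by
    intro Φ y hD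
    induction hD with
    | base => exact hy0
    | step Φ y i hi hlt _ ih => exact hok i hi _ _ ih
  have hex : ∀ Φ, ∃ y, Dev h ψ ρ m y0 Φ y := by
    intro Φ
    induction Φ using (h.wf ψ).induction with
    | _ Φ ih =>
      by_cases hmin : ∀ i < d, i + 1 ≠ 0 → ψ Φ < ψ (h.r i Φ)
      · have := H.minuniq 0 Φ m (h.fc_zero _ _) hmin (fun i hi _ => hm i hi)
        subst this
        exact ⟨_, Dev.base⟩
      · push Not at hmin
        obtain ⟨i, hi, _, hle⟩ := hmin
        have hlt := lt_of_le_of_ne hle (H.ne i hi Φ)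
        obtain ⟨y, hy⟩ := ih _ hlt
        have := Dev.step _ _ i hi (by rwa [h.r_r]) hy
        rw [h.r_r] at this
        exact ⟨_, this⟩
  have huniq : ∀ Φ y y', Dev h ψ ρ m y0 Φ y → Dev h ψ ρ m y0 Φ y' → y = y' := by
    intro Φ
    induction Φ using (h.wf ψ).induction with
    | _ Φ ih =>
      have walk : ∀ Ω w k, k < d → ψ Ω < ψ Φ → ψ (h.r k Ω) < ψ Φ → Dev h ψ ρ m y0 Ω w →
          Dev h ψ ρ m y0 (h.r k Ω) (ρ k w) := by
        intro Ω w k hk h1 h2 hw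
        rcases lt_or_gt_of_ne (H.ne k hk Ω) with h3 | h3
        · obtain ⟨u, hu⟩ := hex (h.r k Ω)
          have := Dev.step _ _ k hk (by rwa [h.r_r]) hu
          rw [h.r_r] at this
          rw [ih Ω h1 _ _ hw this, hρ]
          exact hu
        · exact Dev.step _ _ k hk h3 hw
      have main : ∀ i j, i < j → j < d → ∀ y y' z z', ψ (h.r i Φ) < ψ Φ →
          Dev h ψ ρ m y0 (h.r i Φ) z → y = ρ i z → ψ (h.r j Φ) < ψ Φ →
          Dev h ψ ρ m y0 (h.r j Φ) z' → y' = ρ j z' → ok Φ y' → y = y' := by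
        intro i j hij hj y y' z z' hli hz ey hlj hz' ey' hoky
        have hi : i < d := by omega
        set N := Function.minimalPeriod (h.r i ∘ h.r j) Φ with hN
        have hNpos : 0 < N := by
          apply Function.minimalPeriod_pos_of_mem_periodicPts
          have hinj : Function.Injective (h.r i ∘ h.r j) :=
            (Function.LeftInverse.injective (h.r_r i)).comp (Function.LeftInverse.injective (h.r_r j))
          exact hinj.mem_periodicPts Φ
        have hit : Function.IsPeriodicPt (h.r i ∘ h.r j) N Φ := Function.isPeriodicPt_minimalPeriod _ _
        have claim : ∀ k, k < N →
            Dev h ψ ρ m y0 (h.r j ((h.r i ∘ h.r j)^[k] Φ)) (ρ j ((ρ i ∘ ρ j)^[k] y')) := by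
          intro k
          have low : ∀ k, ψ (h.r j ((h.r i ∘ h.r j)^[k] Φ)) < ψ Φ := by
            intro k
            apply H.res_lt hij hj hli hlj
            · intro n h1 h2
              rw [h.fc_r_ne _ h2, h.fc_iterate h1 h2]
            · intro e
              have := congrArg (h.r j) e
              rw [h.r_r] at this
              exact h.iterate_ne hi hj k Φ this
          induction k with
          | zero =>
            intro _
            simp only [Function.iterate_zero, id]
            rw [ey', hρ]; exact hz'
          | succ k ihk =>
            intro hk
            have h1 := ihk (by omega)
            have low2 : ψ (h.r i (h.r j ((h.r i ∘ h.r j)^[k] Φ))) < ψ Φ := by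
              apply H.res_lt hij hj hli hlj
              · intro n h1 h2
                rw [h.fc_r_ne _ h1, h.fc_r_ne _ h2, h.fc_iterate h1 h2]
              · intro e
                have e2 : (h.r i ∘ h.r j)^[k + 1] Φ = Φ := by
                  rw [Function.iterate_succ_apply']; exact e
                have := Function.IsPeriodicPt.minimalPeriod_le (Nat.succ_pos k) e2
                omega
            have h2 := walk _ _ i hi (low k) low2 h1
            have h3 := walk _ _ j hj low2 (by
              have := low (k + 1)
              rwa [Function.iterate_succ_apply'] at this) h2
            rw [Function.iterate_succ_apply', Function.iterate_succ_apply']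
            exact h3
        have h1 := claim (N - 1) (by omega)
        have hb : h.r j ((h.r i ∘ h.r j)^[N - 1] Φ) = h.r i Φ := by
          have e : (h.r i ∘ h.r j)^[N - 1 + 1] Φ = Φ := by
            rw [Nat.sub_add_cancel hNpos]; exact hit
          rw [Function.iterate_succ_apply'] at e
          have := congrArg (h.r i) e
          simpa only [Function.comp_apply, h.r_r] using this
        rw [hb] at h1
        have hzz := ih _ hli _ _ hz h1
        have hp := hper i j hij hj Φ y' hoky
        rw [← hN, ← Nat.sub_add_cancel hNpos, Function.iterate_succ_apply'] at hp
        rw [ey, hzz]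
        exact hp
      intro y y' hy hy'
      rcases hy.inv with ⟨rfl, rfl⟩ | ⟨i, z, hi, hli, hz, ey⟩
      · rcases hy'.inv with ⟨_, rfl⟩ | ⟨j, z', hj, hlj, hz', ey'⟩
        · rfl
        · exact absurd hlj (hm j hj).not_gt
      · rcases hy'.inv with ⟨rfl, rfl⟩ | ⟨j, z', hj, hlj, hz', ey'⟩
        · exact absurd hli (hm i hi).not_gt
        · rcases lt_trichotomy i j with hij | rfl | hij
          · exact main i j hij hj y y' z z' hli hz ey hlj hz' ey' (hokD _ _ hy')
          · rw [ey, ey', ih _ hli _ _ hz hz']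
          · exact (main j i hij hi y' y z' z hlj hz' ey' hli hz ey (hokD _ _ hy)).symm
  choose D hD using hex
  refine ⟨D, huniq _ _ _ (hD m) Dev.base, fun Φ => hokD _ _ (hD Φ), fun i hi Φ => ?_⟩
  rcases lt_or_gt_of_ne (H.ne i hi Φ) with h1 | h1
  · have := Dev.step _ _ i hi (by rwa [h.r_r]) (hD (h.r i Φ))
    rw [h.r_r] at this
    rw [huniq _ _ _ (hD Φ) this, hρ]
  · exact huniq _ _ _ (hD _) (Dev.step _ _ i hi h1 (hD Φ))

theorem Height.dev {h : GP α rk d} (H : h.Height ψ) {Y : Type*} (ρ : ℕ → Y → Y)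
    (ok : Flag α → Y → Prop) (hok : ∀ i < d, ∀ Φ y, ok Φ y → ok (h.r i Φ) (ρ i y))
    (hρ : ∀ i y, ρ i (ρ i y) = y)
    (hper : ∀ i j, i < j → j < d → ∀ Φ y, ok Φ y →
      (ρ i ∘ ρ j)^[Function.minimalPeriod (h.r i ∘ h.r j) Φ] y = y)
    (Φ0 : Flag α) (y0 : Y) (hy0 : ok Φ0 y0) :
    ∃ D : Flag α → Y, D Φ0 = y0 ∧ (∀ Φ, ok Φ (D Φ)) ∧ ∀ i < d, ∀ Φ, D (h.r i Φ) = ρ i (D Φ) := by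
  obtain ⟨m, -, hm, -⟩ := H.exists_min 0 (fun _ => True) (fun _ _ _ _ _ => trivial) Φ0
  have := H.conn0 (fun Φ => ∀ y, ok Φ y → ∃ D : Flag α → Y, D Φ = y ∧ (∀ Φ, ok Φ (D Φ)) ∧
    ∀ i < d, ∀ Φ, D (h.r i Φ) = ρ i (D Φ)) ?_ m Φ0 ?_
  · exact this y0 hy0
  · intro Φ i hi ih y hy
    have h1 := hok i hi _ _ hy
    rw [h.r_r] at h1
    obtain ⟨D, e1, e2, e3⟩ := ih _ h1
    refine ⟨D, ?_, e2, e3⟩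
    rw [e3 i hi, e1, hρ]
  · intro y hy
    exact H.dev_aux ρ ok hok hρ hper m (fun i hi => hm i hi (by omega)) y hy

end

end GP

namespace GP

section
variable {rk : α → ℤ} {d : ℕ}

theorem rk_le_map {β : Type*} [PartialOrder β] {rk' : β → ℤ} {d' : ℕ} (h : GP α rk d)
    (h' : GP β rk' d') (e : α ≃o β) (x : α) : rk x ≤ rk' (e x) := by
  obtain ⟨Φ, hx⟩ := Flag.exists_mem x
  obtain ⟨n, hn, hr⟩ := h.exists_idx x
  have key : ∀ n : ℕ, n ≤ d + 1 → (n : ℤ) - 1 ≤ rk' (e (h.fc Φ n)) := by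
    intro n
    induction n with
    | zero => intro _; have := h'.lo (e (h.fc Φ 0)); simpa using this
    | succ n ih =>
      intro hn
      have h1 := ih (by omega)
      have h2 := h'.mono (e.strictMono (h.fc_lt Φ (Nat.lt_add_one n) hn))
      push_cast
      omega
  have := key n hn
  rw [h.fc_eq hn hx hr] at this
  omega

theorem rk_map {β : Type*} [PartialOrder β] {rk' : β → ℤ} {d' : ℕ} (h : GP α rk d)
    (h' : GP β rk' d') (e : α ≃o β) (x : α) : rk' (e x) = rk x := by
  apply le_antisymm
  · have := rk_le_map h' h e.symm (e x)
    simpa using this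
  · exact rk_le_map h h' e x

theorem fc_map (h : GP α rk d) (e : α ≃o α) (Φ : Flag α) {n : ℕ} (hn : n ≤ d + 1) :
    h.fc (Flag.map e Φ) n = e (h.fc Φ n) := by
  apply h.fc_eq hn
  · exact ⟨_, h.fc_mem Φ n, rfl⟩
  · rw [rk_map h h, h.rk_fc _ hn]

theorem map_r (h : GP α rk d) (e : α ≃o α) (i : ℕ) (Φ : Flag α) :
    Flag.map e (h.r i Φ) = h.r i (Flag.map e Φ) := by
  by_cases hi : i < d
  · apply h.eq_r_of_adj hi
    rw [h.adj_iff hi]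
    constructor
    · rw [h.fc_map e _ (by omega), h.fc_map e _ (by omega)]
      exact fun h1 => h.fc_r_self Φ hi (e.injective h1).symm
    · intro n hn
      rcases le_total n (d + 1) with h1 | h1
      · rw [h.fc_map e _ h1, h.fc_map e _ h1, h.fc_r_ne _ hn]
      · rw [h.fc_clamp _ h1, h.fc_clamp _ h1, h.fc_top]
  · unfold r; simp [dif_neg hi]

theorem orbit_iff {Φ Ψ : Flag α} : SameFlagOrbit Φ Ψ ↔ ∃ γ : α ≃o α, Flag.map γ Φ = Ψ := by
  constructor
  · rintro ⟨γ, hγ⟩; exact ⟨γ, SetLike.coe_injective hγ⟩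
  · rintro ⟨γ, rfl⟩; exact ⟨γ, rfl⟩

theorem orbit_refl (Φ : Flag α) : SameFlagOrbit Φ Φ := ⟨OrderIso.refl α, by simp⟩

theorem orbit_symm {Φ Ψ : Flag α} (h : SameFlagOrbit Φ Ψ) : SameFlagOrbit Ψ Φ := by
  obtain ⟨γ, hγ⟩ := h
  exact ⟨γ.symm, by rw [← hγ]; exact γ.symm_image_image _⟩

theorem orbit_trans {Φ Ψ Ω : Flag α} (h : SameFlagOrbit Φ Ψ) (h' : SameFlagOrbit Ψ Ω) :
    SameFlagOrbit Φ Ω := by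
  obtain ⟨γ, hγ⟩ := h
  obtain ⟨δ, hδ⟩ := h'
  exact ⟨γ.trans δ, by rw [← hδ, ← hγ, Set.image_image]; rfl⟩

theorem orbit_r (h : GP α rk d) (i : ℕ) {Φ Ψ : Flag α} (hs : SameFlagOrbit Φ Ψ) :
    SameFlagOrbit (h.r i Φ) (h.r i Ψ) := by
  rw [orbit_iff] at hs ⊢
  obtain ⟨γ, rfl⟩ := hs
  exact ⟨γ, h.map_r γ i Φ⟩

/-- The period of the `i,j`-residue at a flag. -/
noncomputable def per (h : GP α rk d) (i j : ℕ) (Φ : Flag α) : ℕ :=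
  Function.minimalPeriod (h.r i ∘ h.r j) Φ

theorem per_map (h : GP α rk d) (i j : ℕ) (e : α ≃o α) (Φ : Flag α) :
    h.per i j (Flag.map e Φ) = h.per i j Φ := by
  unfold per
  rw [Function.minimalPeriod_eq_minimalPeriod_iff]
  have key : ∀ n, (h.r i ∘ h.r j)^[n] (Flag.map e Φ) = Flag.map e ((h.r i ∘ h.r j)^[n] Φ) := by
    intro n
    induction n with
    | zero => rfl
    | succ n ih =>
      rw [Function.iterate_succ_apply', ih, Function.iterate_succ_apply', Function.comp_apply,
        Function.comp_apply, h.map_r, h.map_r]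
  intro n
  unfold Function.IsPeriodicPt Function.IsFixedPt
  rw [key n]
  exact (Flag.map e).injective.eq_iff

theorem per_orbit (h : GP α rk d) (i j : ℕ) {Φ Ψ : Flag α} (hs : SameFlagOrbit Φ Ψ) :
    h.per i j Φ = h.per i j Ψ := by
  rw [orbit_iff] at hs
  obtain ⟨γ, rfl⟩ := hs
  rw [per_map]

theorem r_inj (h : GP α rk d) (i : ℕ) : Function.Injective (h.r i) :=
  Function.LeftInverse.injective (h.r_r i)

theorem per_pos (h : GP α rk d) (i j : ℕ) (Φ : Flag α) : 0 < h.per i j Φ := by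
  have := h.finite_flag
  apply Function.minimalPeriod_pos_of_mem_periodicPts
  exact ((h.r_inj i).comp (h.r_inj j)).mem_periodicPts Φ

theorem per_spec (h : GP α rk d) (i j : ℕ) (Φ : Flag α) :
    (h.r i ∘ h.r j)^[h.per i j Φ] Φ = Φ := Function.isPeriodicPt_minimalPeriod _ _

theorem per_dvd (h : GP α rk d) {i j n : ℕ} {Φ : Flag α} (hn : (h.r i ∘ h.r j)^[n] Φ = Φ) :
    h.per i j Φ ∣ n := Function.IsPeriodicPt.minimalPeriod_dvd hn

theorem per_ne_one (h : GP α rk d) {i j : ℕ} (hij : i < j) (hj : j < d) (Φ : Flag α) :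
    h.per i j Φ ≠ 1 := by
  intro e
  have := h.per_spec i j Φ
  rw [e] at this
  have h1 : h.r i (h.r j Φ) = Φ := this
  have h2 : h.fc (h.r i (h.r j Φ)) (j + 1) = h.fc Φ (j + 1) := by rw [h1]
  rw [h.fc_r_ne _ (by omega)] at h2
  exact h.fc_r_self Φ hj h2

theorem per_far (h : GP α rk d) {i j : ℕ} (hij : i + 2 ≤ j) (hj : j < d) (Φ : Flag α) :
    h.per i j Φ = 2 := by
  have h1 : h.per i j Φ ∣ 2 := by
    apply h.per_dvd
    change h.r i (h.r j (h.r i (h.r j Φ))) = Φ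
    rw [h.r_comm hij (h.r i (h.r j Φ)), h.r_r, h.r_r]
  rcases (Nat.dvd_prime Nat.prime_two).1 h1 with h2 | h2
  · exact absurd h2 (h.per_ne_one (by omega) hj Φ)
  · exact h2

theorem per_adj (h : GP α rk d) {i : ℕ} (hj : i + 1 < d) (Φ : Flag α) :
    3 ≤ h.per i (i + 1) Φ := by
  have h0 := h.per_pos i (i + 1) Φ
  have h1 := h.per_ne_one (Nat.lt_add_one i) hj Φ
  have h2 : h.per i (i + 1) Φ ≠ 2 := by
    intro e
    have := h.per_spec i (i + 1) Φ
    rw [e] at this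
    have e1 : h.r i (h.r (i + 1) (h.r i (h.r (i + 1) Φ))) = Φ := this
    have e2 : h.r i (h.r (i + 1) Φ) = h.r (i + 1) (h.r i Φ) := by
      have := congrArg (fun Ω => h.r (i + 1) (h.r i Ω)) e1
      simpa only [h.r_r] using this
    have hx' : h.fc (h.r i (h.r (i + 1) Φ)) (i + 1) = h.fc (h.r i Φ) (i + 1) := by
      rw [e2, h.fc_r_ne _ (by omega)]
    have hy' : h.fc (h.r i (h.r (i + 1) Φ)) (i + 1 + 1) = h.fc (h.r (i + 1) Φ) (i + 1 + 1) := by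
      rw [h.fc_r_ne _ (by omega)]
    have k1 : h.fc (h.r i Φ) (i + 1) ≤ h.fc (h.r (i + 1) Φ) (i + 1 + 1) := by
      rw [← hx', ← hy']; exact h.fc_le _ (by omega)
    have k2 : h.fc (h.r i Φ) (i + 1) ≤ h.fc Φ (i + 1 + 1) := by
      rw [← h.fc_r_ne Φ (i := i) (n := i + 1 + 1) (by omega)]; exact h.fc_le _ (by omega)
    have k3 : h.fc Φ (i + 1) ≤ h.fc (h.r (i + 1) Φ) (i + 1 + 1) := by
      rw [← h.fc_r_ne Φ (i := i + 1) (n := i + 1) (by omega)]; exact h.fc_le _ (by omega)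
    refine h.fc_r_self Φ hj (h.meet (h.fc Φ (i + 1)) (h.fc (h.r i Φ) (i + 1)) _ _ ?_ ?_ ?_
      (h.fc_r_self Φ (by omega)).symm k3 k1 (h.fc_le _ (by omega)) k2)
    all_goals
      rw [h.rk_fc _ (by omega), h.rk_fc _ (by omega)]
      try (push_cast; ring)
  omega

end

section iso
variable {β : Type*} [PartialOrder β] {rk : α → ℤ} {rk' : β → ℤ} {d : ℕ}

/-- The face map attached to a map of flags. -/
noncomputable def faceMap (h : GP α rk d) (h' : GP β rk' d) (D : Flag α → Flag β) (x : α) : β :=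
  h'.fc (D (Classical.choose (Flag.exists_mem x))) (Classical.choose (h.exists_idx x))

theorem faceMap_eq {Λ : Type*} [LinearOrder Λ] {ψ : Flag α → Λ} {h : GP α rk d} (H : h.Height ψ)
    (h' : GP β rk' d) {D : Flag α → Flag β} (hD : ∀ i < d, ∀ Φ, D (h.r i Φ) = h'.r i (D Φ))
    {x : α} {Φ : Flag α} (hx : x ∈ Φ) {n : ℕ} (hn : n ≤ d + 1) (hr : rk x = (n : ℤ) - 1) :
    faceMap h h' D x = h'.fc (D Φ) n := by
  have h1 := Classical.choose_spec (Flag.exists_mem x)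
  have h2 := Classical.choose_spec (h.exists_idx x)
  unfold faceMap
  generalize Classical.choose (Flag.exists_mem x) = Ψ at *
  generalize Classical.choose (h.exists_idx x) = m at *
  obtain rfl : m = n := by omega
  refine (H.conn m (fun Ω => h'.fc (D Ψ) m = h'.fc (D Ω) m) ?_ Ψ Φ ?_ rfl)
  · intro Ω i hi hik hp
    rw [hD i hi, h'.fc_r_ne _ (by omega), hp]
  · rw [h.fc_eq hn h1 hr, h.fc_eq hn hx hr]

theorem exists_iso {Λ Λ' : Type*} [LinearOrder Λ] [LinearOrder Λ'] {ψ : Flag α → Λ}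
    {ψ' : Flag β → Λ'} {h : GP α rk d} (H : h.Height ψ) {h' : GP β rk' d} (H' : h'.Height ψ')
    (D : Flag α → Flag β) (D' : Flag β → Flag α)
    (hD : ∀ i < d, ∀ Φ, D (h.r i Φ) = h'.r i (D Φ))
    (hD' : ∀ i < d, ∀ Φ, D' (h'.r i Φ) = h.r i (D' Φ))
    (h1 : ∀ Φ, D' (D Φ) = Φ) (h2 : ∀ Φ, D (D' Φ) = Φ) :
    ∃ γ : α ≃o β, ∀ Φ : Flag α, γ '' (Φ : Set α) = (D Φ : Set β) := by
  have inv1 : ∀ x, faceMap h' h D' (faceMap h h' D x) = x := by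
    intro x
    obtain ⟨Φ, hx⟩ := Flag.exists_mem x
    obtain ⟨n, hn, hr⟩ := h.exists_idx x
    rw [faceMap_eq H h' hD hx hn hr, faceMap_eq H' h hD' (h'.fc_mem (D Φ) n) hn (h'.rk_fc _ hn), h1,
      h.fc_eq hn hx hr]
  have inv2 : ∀ x, faceMap h h' D (faceMap h' h D' x) = x := by
    intro x
    obtain ⟨Φ, hx⟩ := Flag.exists_mem x
    obtain ⟨n, hn, hr⟩ := h'.exists_idx x
    rw [faceMap_eq H' h hD' hx hn hr, faceMap_eq H h' hD (h.fc_mem (D' Φ) n) hn (h.rk_fc _ hn), h2,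
      h'.fc_eq hn hx hr]
  have mono1 : Monotone (faceMap h h' D) := by
    intro x y hxy
    obtain ⟨Φ, hx, hy⟩ := Flag.exists_mem_mem hxy
    obtain ⟨n, hn, hr⟩ := h.exists_idx x
    obtain ⟨m, hm, hr'⟩ := h.exists_idx y
    rw [faceMap_eq H h' hD hx hn hr, faceMap_eq H h' hD hy hm hr']
    exact h'.fc_le _ (by have := h.mono.monotone hxy; omega)
  have mono2 : Monotone (faceMap h' h D') := by
    intro x y hxy
    obtain ⟨Φ, hx, hy⟩ := Flag.exists_mem_mem hxy
    obtain ⟨n, hn, hr⟩ := h'.exists_idx x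
    obtain ⟨m, hm, hr'⟩ := h'.exists_idx y
    rw [faceMap_eq H' h hD' hx hn hr, faceMap_eq H' h hD' hy hm hr']
    exact h.fc_le _ (by have := h'.mono.monotone hxy; omega)
  let e : α ≃ β := ⟨faceMap h h' D, faceMap h' h D', inv1, inv2⟩
  refine ⟨e.toOrderIso mono1 mono2, fun Φ => ?_⟩
  apply Set.Subset.antisymm
  · rintro _ ⟨x, hx, rfl⟩
    obtain ⟨n, hn, hr⟩ := h.exists_idx x
    change faceMap h h' D x ∈ _
    rw [faceMap_eq H h' hD hx hn hr]
    exact h'.fc_mem _ _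
  · intro y hy
    obtain ⟨n, hn, hr⟩ := h'.exists_idx y
    refine ⟨h.fc Φ n, h.fc_mem _ _, ?_⟩
    change faceMap h h' D _ = _
    rw [faceMap_eq H h' hD (h.fc_mem Φ n) hn (h.rk_fc _ hn)]
    exact h'.fc_eq hn hy hr

end iso

end GP

section model
variable {ι : Type*}

/-- Functions of `A` vanishing on `T`. -/
def annih (A : Submodule ℝ (ι → ℝ)) (T : Set ι) : Submodule ℝ (ι → ℝ) where
  carrier := {φ | φ ∈ A ∧ ∀ s ∈ T, φ s = 0}
  add_mem' := fun ha hb => ⟨A.add_mem ha.1 hb.1, fun s hs => by simp [ha.2 s hs, hb.2 s hs]⟩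
  zero_mem' := ⟨A.zero_mem, fun _ _ => rfl⟩
  smul_mem' := fun c x hx => ⟨A.smul_mem c hx.1, fun s hs => by simp [hx.2 s hs]⟩

theorem mem_annih {A : Submodule ℝ (ι → ℝ)} {T : Set ι} {φ : ι → ℝ} :
    φ ∈ annih A T ↔ φ ∈ A ∧ ∀ s ∈ T, φ s = 0 := Iff.rfl

/-- A poset of zero sets of nonnegative functions from a space of functions on a finite set. -/
structure Model (A : Submodule ℝ (ι → ℝ)) (Z : α → Set ι) (d : ℕ) : Prop where
  fin : Finite ι
  le_iff : ∀ x y, x ≤ y ↔ Z x ⊆ Z y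
  one_mem : (1 : ι → ℝ) ∈ A
  rank : Module.finrank ℝ A = d + 1
  wit : ∀ x, ∃ φ ∈ A, (∀ s, 0 ≤ φ s) ∧ ∀ s, φ s = 0 ↔ s ∈ Z x
  surj : ∀ φ ∈ A, (∀ s, 0 ≤ φ s) → ∃ x, ∀ s, φ s = 0 ↔ s ∈ Z x

namespace Model
variable {A : Submodule ℝ (ι → ℝ)} {Z : α → Set ι} {d : ℕ}

/-- The rank in a model. -/
noncomputable def mrk (A : Submodule ℝ (ι → ℝ)) (Z : α → Set ι) (d : ℕ) (x : α) : ℤ :=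
  d - (Module.finrank ℝ (annih A (Z x)) : ℤ)

/-- A chosen witness. -/
noncomputable def w (M : Model A Z d) (x : α) : ι → ℝ := Classical.choose (M.wit x)

theorem w_mem (M : Model A Z d) (x : α) : M.w x ∈ A := (Classical.choose_spec (M.wit x)).1
theorem w_nonneg (M : Model A Z d) (x : α) (s : ι) : 0 ≤ M.w x s :=
  (Classical.choose_spec (M.wit x)).2.1 s
theorem w_zero (M : Model A Z d) (x : α) (s : ι) : M.w x s = 0 ↔ s ∈ Z x :=
  (Classical.choose_spec (M.wit x)).2.2 s
theorem w_pos (M : Model A Z d) {x : α} {s : ι} (hs : s ∉ Z x) : 0 < M.w x s :=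
  lt_of_le_of_ne (M.w_nonneg x s) fun e => hs ((M.w_zero x s).1 e.symm)
theorem w_annih (M : Model A Z d) (x : α) : M.w x ∈ annih A (Z x) :=
  ⟨M.w_mem x, fun s hs => (M.w_zero x s).2 hs⟩

theorem Z_inj (M : Model A Z d) {x y : α} (e : Z x = Z y) : x = y :=
  le_antisymm ((M.le_iff _ _).2 e.le) ((M.le_iff _ _).2 e.ge)

theorem lt_pt (M : Model A Z d) {x y : α} (h : x < y) : ∃ s, s ∈ Z y ∧ s ∉ Z x := by
  by_contra hc
  push Not at hc
  exact h.not_ge ((M.le_iff _ _).2 hc)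

theorem sub_facial (M : Model A Z d) (y : α) {φ : ι → ℝ} (hφ : φ ∈ A) (h0 : ∀ s ∈ Z y, 0 ≤ φ s) :
    ∃ x, ∀ s, s ∈ Z x ↔ s ∈ Z y ∧ φ s = 0 := by
  have := M.fin
  have := Fintype.ofFinite ι
  set N : ℝ := 1 + ∑ s, |φ s| / M.w y s with hN
  have hpos : ∀ s, s ∉ Z y → 0 < φ s + N * M.w y s := by
    intro s hs
    have hw := M.w_pos hs
    have h1 : |φ s| / M.w y s ≤ ∑ s, |φ s| / M.w y s :=
      Finset.single_le_sum (f := fun s => |φ s| / M.w y s)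
        (fun t _ => div_nonneg (abs_nonneg _) (M.w_nonneg y t)) (Finset.mem_univ s)
    have h2 : |φ s| = |φ s| / M.w y s * M.w y s := by field_simp
    have h3 := neg_abs_le (φ s)
    have h4 : (1 + |φ s| / M.w y s) * M.w y s ≤ N * M.w y s := by
      apply mul_le_mul_of_nonneg_right _ hw.le
      rw [hN]; linarith
    nlinarith
  obtain ⟨x, hx⟩ := M.surj (φ + N • M.w y) (A.add_mem hφ (A.smul_mem _ (M.w_mem y))) (by
    intro s
    by_cases hs : s ∈ Z y
    · simp [(M.w_zero y s).2 hs, h0 s hs]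
    · exact (hpos s hs).le)
  refine ⟨x, fun s => ?_⟩
  rw [← hx s]
  by_cases hs : s ∈ Z y
  · simp [(M.w_zero y s).2 hs, hs]
  · constructor
    · intro e; exact absurd e (hpos s hs).ne'
    · intro e; exact absurd e.1 hs

theorem annih_lt (M : Model A Z d) {x y : α} (h : x < y) : annih A (Z y) < annih A (Z x) := by
  refine lt_of_le_of_ne ?_ ?_
  · intro φ hφ
    exact ⟨hφ.1, fun s hs => hφ.2 s ((M.le_iff _ _).1 h.le hs)⟩
  · intro e
    obtain ⟨s, h1, h2⟩ := M.lt_pt h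
    have := M.w_annih x
    rw [← e] at this
    exact h2 ((M.w_zero x s).1 (this.2 s h1))

theorem mrk_mono (M : Model A Z d) : StrictMono (mrk A Z d) := by
  intro x y h
  have := M.fin
  have := Submodule.finrank_lt_finrank_of_lt (M.annih_lt h)
  unfold mrk
  omega

theorem w_not_annih (M : Model A Z d) {x y : α} (h : x < y) : M.w x ∉ annih A (Z y) := by
  obtain ⟨s, h1, h2⟩ := M.lt_pt h
  intro hc
  exact h2 ((M.w_zero x s).1 (hc.2 s h1))

theorem ratio (M : Model A Z d) {x y : α} (h : x < y) {β : ι → ℝ} (hβ : β ∈ annih A (Z x)) :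
    ∃ z c, x < z ∧ z ≤ y ∧ (∀ s ∈ Z y, β s ≤ c * M.w x s) ∧
      ∀ s, s ∈ Z z ↔ s ∈ Z y ∧ c * M.w x s = β s := by
  have := M.fin
  obtain ⟨s0, hs0, hs0'⟩ := M.lt_pt h
  obtain ⟨m, hm, hmax⟩ := (Set.toFinite {s | s ∈ Z y ∧ s ∉ Z x}).exists_maximalFor
    (fun s => β s / M.w x s) _ ⟨s0, hs0, hs0'⟩
  set c := β m / M.w x m with hc
  have hle : ∀ s ∈ Z y, β s ≤ c * M.w x s := by
    intro s hs
    by_cases hx : s ∈ Z x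
    · rw [hβ.2 s hx, (M.w_zero x s).2 hx]; simp
    · rw [← div_le_iff₀ (M.w_pos hx)]
      rcases le_total (β s / M.w x s) c with h1 | h1
      · exact h1
      · exact hmax ⟨hs, hx⟩ h1
  obtain ⟨z, hz⟩ := M.sub_facial y (φ := c • M.w x - β)
    (A.sub_mem (A.smul_mem _ (M.w_mem x)) hβ.1) (fun s hs => by
      have := hle s hs
      simpa using this)
  have hz' : ∀ s, s ∈ Z z ↔ s ∈ Z y ∧ c * M.w x s = β s := by
    intro s; rw [hz s]; simp [sub_eq_zero]
  refine ⟨z, c, ?_, ?_, hle, hz'⟩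
  · refine lt_of_le_of_ne ((M.le_iff _ _).2 fun s hs => ?_) fun e => ?_
    · rw [hz']
      exact ⟨(M.le_iff _ _).1 h.le hs, by rw [hβ.2 s hs, (M.w_zero x s).2 hs]; simp⟩
    · apply hm.2
      rw [e, hz']
      refine ⟨hm.1, ?_⟩
      have := M.w_pos hm.2
      rw [hc]; field_simp
  · exact (M.le_iff _ _).2 fun s hs => ((hz' s).1 hs).1

theorem exists_indep (M : Model A Z d) {x y : α} (h : x < y)
    (hr : mrk A Z d x + 2 ≤ mrk A Z d y) :
    ∃ β ∈ annih A (Z x), β ∉ annih A (Z y) ⊔ Submodule.span ℝ {M.w x} := by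
  have := M.fin
  by_contra hc
  push Not at hc
  have hle : annih A (Z x) ≤ annih A (Z y) ⊔ Submodule.span ℝ {M.w x} := hc
  have h1 := Submodule.finrank_mono hle
  rw [Submodule.finrank_sup_span_singleton (M.w_not_annih h)] at h1
  unfold mrk at hr
  omega

theorem ratio_lt (M : Model A Z d) {x y z : α} {β : ι → ℝ} {c : ℝ} (hβ : β ∈ A)
    (hn : β ∉ annih A (Z y) ⊔ Submodule.span ℝ {M.w x}) (hz : z ≤ y)
    (h : ∀ s, s ∈ Z z ↔ s ∈ Z y ∧ c * M.w x s = β s) : z < y := by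
  refine lt_of_le_of_ne hz fun e => hn ?_
  subst e
  rw [Submodule.mem_sup]
  refine ⟨β - c • M.w x, ⟨A.sub_mem hβ (A.smul_mem _ (M.w_mem x)), fun s hs => ?_⟩, c • M.w x,
    Submodule.smul_mem _ _ (Submodule.mem_span_singleton_self _), by simp⟩
  have := ((h s).1 hs).2
  simp [← this]

theorem exists_between (M : Model A Z d) {x y : α} (h : x < y)
    (hr : mrk A Z d x + 2 ≤ mrk A Z d y) : ∃ z, x < z ∧ z < y := by
  obtain ⟨β, hβ, hn⟩ := M.exists_indep h hr
  obtain ⟨z, c, h1, h2, _, h4⟩ := M.ratio h hβ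
  exact ⟨z, h1, M.ratio_lt hβ.1 hn h2 h4⟩

theorem diamond (M : Model A Z d) {x y : α} (h : x < y)
    (hr : mrk A Z d y = mrk A Z d x + 2) :
    ∃ a b, a ≠ b ∧ ∀ z, (x < z ∧ z < y) ↔ (z = a ∨ z = b) := by
  have := M.fin
  obtain ⟨β, hβ, hn⟩ := M.exists_indep h hr.ge
  obtain ⟨a, c, h1, h2, h3, h4⟩ := M.ratio h hβ
  obtain ⟨b, c', h1', h2', h3', h4'⟩ := M.ratio h (Submodule.neg_mem _ hβ)
  have ha := M.ratio_lt hβ.1 hn h2 h4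
  have hb := M.ratio_lt (A.neg_mem hβ.1) (by simpa using hn) h2' h4'
  have hspan : annih A (Z x) ≤ (annih A (Z y) ⊔ Submodule.span ℝ {M.w x}) ⊔ Submodule.span ℝ {β} := by
    apply le_of_eq
    symm
    apply Submodule.eq_of_le_of_finrank_le
    · refine sup_le (sup_le (M.annih_lt h).le ?_) ?_
      · rw [Submodule.span_singleton_le_iff_mem]; exact M.w_annih x
      · rw [Submodule.span_singleton_le_iff_mem]; exact hβ
    · rw [Submodule.finrank_sup_span_singleton hn,
        Submodule.finrank_sup_span_singleton (M.w_not_annih h)]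
      unfold mrk at hr
      omega
  refine ⟨a, b, ?_, fun z => ⟨?_, ?_⟩⟩
  · rintro rfl
    obtain ⟨s, hs, hs'⟩ := M.lt_pt h1
    have e1 := ((h4 s).1 hs).2
    have e2 := ((h4' s).1 hs).2
    have hw := M.w_pos hs'
    have e3 : c' = -c := by
      simp only [Pi.neg_apply] at e2
      have : (c' + c) * M.w x s = 0 := by linarith
      rcases mul_eq_zero.1 this with h | h
      · linarith
      · exact absurd h hw.ne'
    subst e3
    refine ha.not_ge ((M.le_iff _ _).2 fun t ht => ?_)
    rw [h4]
    refine ⟨ht, ?_⟩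
    have q1 := h3 t ht
    have q2 := h3' t ht
    simp only [Pi.neg_apply] at q2
    linarith
  · rintro ⟨hxz, hzy⟩
    have hγ : M.w z ∈ annih A (Z x) :=
      ⟨M.w_mem z, fun s hs => (M.w_zero z s).2 ((M.le_iff _ _).1 hxz.le hs)⟩
    obtain ⟨u, hu, v, hv, huv⟩ := Submodule.mem_sup.1 (hspan hγ)
    obtain ⟨t, ht, u', hu', htu⟩ := Submodule.mem_sup.1 hu
    obtain ⟨p, rfl⟩ := Submodule.mem_span_singleton.1 hu'
    obtain ⟨q, rfl⟩ := Submodule.mem_span_singleton.1 hv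
    have hval : ∀ s ∈ Z y, M.w z s = p * M.w x s + q * β s := by
      intro s hs
      have := ht.2 s hs
      rw [← huv, ← htu]
      simp [this]
    obtain ⟨s, hs, hs'⟩ := M.lt_pt hxz
    have hsy : s ∈ Z y := (M.le_iff _ _).1 hzy.le hs
    have hw := M.w_pos hs'
    have e0 : p * M.w x s + q * β s = 0 := by rw [← hval s hsy]; exact (M.w_zero z s).2 hs
    have hzz : ∀ r, r ∈ Z z ↔ r ∈ Z y ∧ p * M.w x r + q * β r = 0 := by
      intro r
      constructor
      · intro hr
        have hry := (M.le_iff _ _).1 hzy.le hr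
        exact ⟨hry, by rw [← hval r hry]; exact (M.w_zero z r).2 hr⟩
      · rintro ⟨hr, e⟩
        rw [← M.w_zero z, hval r hr, e]
    have hnn : ∀ r ∈ Z y, 0 ≤ p * M.w x r + q * β r := fun r hr => by
      rw [← hval r hr]; exact M.w_nonneg z r
    rcases lt_trichotomy q 0 with hq | hq | hq
    · left
      obtain ⟨m, hm, hm'⟩ := M.lt_pt h1
      have hmw := M.w_pos hm'
      have e1 := ((h4 m).1 hm)
      have i1 := hnn m e1.1
      have i2 := h3 s hsy
      -- p + q c = 0
      have k : p + q * c = 0 := by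
        apply le_antisymm
        · have : (p + q * c) * M.w x s ≤ 0 := by nlinarith
          by_contra hc
          push Not at hc
          have := mul_pos hc hw
          linarith
        · have : 0 ≤ (p + q * c) * M.w x m := by rw [← e1.2] at i1; linarith
          by_contra hc
          push Not at hc
          have := mul_neg_of_neg_of_pos hc hmw
          linarith
      apply M.Z_inj
      ext r
      rw [hzz, h4]
      have hp : p = -q * c := by linarith
      have : p * M.w x r + q * β r = -q * (c * M.w x r - β r) := by rw [hp]; ring
      rw [this, mul_eq_zero, sub_eq_zero]
      simp [hq.ne]
    · exfalso
      subst hq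
      have hp : p = 0 := by
        have : p * M.w x s = 0 := by linarith
        exact (mul_eq_zero.1 this).resolve_right hw.ne'
      subst hp
      exact hzy.not_ge ((M.le_iff _ _).2 fun r hr => (hzz r).2 ⟨hr, by ring⟩)
    · right
      obtain ⟨m, hm, hm'⟩ := M.lt_pt h1'
      have hmw := M.w_pos hm'
      have e1 := ((h4' m).1 hm)
      have i1 := hnn m e1.1
      have i2 := h3' s hsy
      have e2 := e1.2
      simp only [Pi.neg_apply] at i2 e2
      have k : p - q * c' = 0 := by
        apply le_antisymm
        · have : (p - q * c') * M.w x s ≤ 0 := by nlinarith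
          by_contra hc
          push Not at hc
          have := mul_pos hc hw
          linarith
        · have : 0 ≤ (p - q * c') * M.w x m := by
            have : β m = - (c' * M.w x m) := by linarith
            rw [this] at i1; linarith
          by_contra hc
          push Not at hc
          have := mul_neg_of_neg_of_pos hc hmw
          linarith
      apply M.Z_inj
      ext r
      rw [hzz, h4']
      have hp : p = q * c' := by linarith
      have : p * M.w x r + q * β r = q * (c' * M.w x r - (-β) r) := by
        rw [hp, Pi.neg_apply]; ring
      rw [this, mul_eq_zero, sub_eq_zero]
      simp [hq.ne']
  · rintro (rfl | rfl)
    · exact ⟨h1, ha⟩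
    · exact ⟨h1', hb⟩

theorem inter (M : Model A Z d) (x y : α) : ∃ z, Z z = Z x ∩ Z y := by
  obtain ⟨z, hz⟩ := M.surj (M.w x + M.w y) (A.add_mem (M.w_mem x) (M.w_mem y))
    (fun s => add_nonneg (M.w_nonneg x s) (M.w_nonneg y s))
  refine ⟨z, ?_⟩
  ext s
  rw [← hz s, Set.mem_inter_iff, ← M.w_zero, ← M.w_zero, Pi.add_apply]
  exact add_eq_zero_iff_of_nonneg (M.w_nonneg x s) (M.w_nonneg y s)

theorem exists_bot (M : Model A Z d) : ∃ b, Z b = ∅ := by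
  obtain ⟨z, hz⟩ := M.surj 1 M.one_mem (fun s => by simp)
  refine ⟨z, ?_⟩
  ext s
  rw [← hz s]; simp

theorem exists_top (M : Model A Z d) : ∃ b, Z b = Set.univ := by
  obtain ⟨z, hz⟩ := M.surj 0 A.zero_mem (fun s => le_rfl)
  refine ⟨z, ?_⟩
  ext s
  rw [← hz s]; simp

theorem mrk_bot (M : Model A Z d) {b : α} (hb : Z b = ∅) : mrk A Z d b = -1 := by
  have : annih A (Z b) = A := by
    ext φ
    rw [mem_annih, hb]; simp
  unfold mrk
  rw [this, M.rank]
  push_cast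
  ring

theorem mrk_top (_M : Model A Z d) {b : α} (hb : Z b = Set.univ) : mrk A Z d b = d := by
  have : annih A (Z b) = ⊥ := by
    rw [eq_bot_iff]
    intro φ hφ
    rw [Submodule.mem_bot]
    ext s
    exact hφ.2 s (by rw [hb]; trivial)
  unfold mrk
  rw [this]
  simp

theorem gp (M : Model A Z d) : GP α (mrk A Z d) d := by
  have := M.fin
  obtain ⟨b, hb⟩ := M.exists_bot
  obtain ⟨t, ht⟩ := M.exists_top
  have hbot : ∀ y, b ≤ y := fun y => (M.le_iff _ _).2 (by rw [hb]; exact Set.empty_subset _)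
  have htop : ∀ y, y ≤ t := fun y => (M.le_iff _ _).2 (by rw [ht]; exact Set.subset_univ _)
  have hfin : Finite α := Finite.of_injective Z fun x y e => M.Z_inj e
  refine ⟨hfin, M.mrk_mono, ?_, ?_, ?_, ?_, ?_, fun x y => M.diamond, ?_⟩
  · intro x
    rw [← M.mrk_bot hb]; exact M.mrk_mono.monotone (hbot x)
  · intro x
    rw [← M.mrk_top ht]; exact M.mrk_mono.monotone (htop x)
  · intro x y hx
    rcases (hbot x).lt_or_eq with h | h
    · have := M.mrk_mono h
      rw [hx, M.mrk_bot hb] at this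
      omega
    · rw [← h]; exact hbot y
  · intro x y hx
    rcases (htop x).lt_or_eq with h | h
    · have := M.mrk_mono h
      rw [hx, M.mrk_top ht] at this
      omega
    · rw [h]; exact htop y
  · intro Φ n hn
    by_contra hc
    push Not at hc
    have hbΦ : b ∈ Φ := Flag.mem_iff_forall_le_or_ge.2 fun y _ => Or.inl (hbot y)
    have htΦ : t ∈ Φ := Flag.mem_iff_forall_le_or_ge.2 fun y _ => Or.inr (htop y)
    have hb1 : mrk A Z d b < (n : ℤ) - 1 := by
      have := hc b hbΦ
      rw [M.mrk_bot hb] at this ⊢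
      omega
    have ht1 : (n : ℤ) - 1 < mrk A Z d t := by
      have := hc t htΦ
      rw [M.mrk_top ht] at this ⊢
      omega
    obtain ⟨x, hx, hxm⟩ := (Set.toFinite {x | x ∈ Φ ∧ mrk A Z d x < (n : ℤ) - 1}).exists_maximalFor
      (mrk A Z d) _ ⟨b, hbΦ, hb1⟩
    obtain ⟨y, hy, hym⟩ := (Set.toFinite {x | x ∈ Φ ∧ (n : ℤ) - 1 < mrk A Z d x}).exists_minimalFor
      (mrk A Z d) _ ⟨t, htΦ, ht1⟩
    have hxy : x < y := by
      rcases Φ.le_or_le hx.1 hy.1 with h | h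
      · exact lt_of_le_of_ne h (by rintro rfl; have := hx.2; have := hy.2; omega)
      · have := M.mrk_mono.monotone h; have := hx.2; have := hy.2; omega
    obtain ⟨z, hz1, hz2⟩ := M.exists_between hxy (by have := hx.2; have := hy.2; omega)
    have hzΦ : z ∈ Φ := by
      rw [Flag.mem_iff_forall_le_or_ge]
      intro u hu
      rcases lt_or_gt_of_ne (hc u hu) with h | h
      · right
        refine le_trans ?_ hz1.le
        rcases Φ.le_or_le hu hx.1 with h1 | h1
        · exact h1
        · rcases h1.lt_or_eq with h2 | h2
          · have := hxm (j := u) ⟨hu, h⟩ (M.mrk_mono h2).le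
            exact absurd this (M.mrk_mono h2).not_ge
          · exact h2.ge
      · left
        refine le_trans hz2.le ?_
        rcases Φ.le_or_le hy.1 hu with h1 | h1
        · exact h1
        · rcases h1.lt_or_eq with h2 | h2
          · have := hym (j := u) ⟨hu, h⟩ (M.mrk_mono h2).le
            exact absurd this (M.mrk_mono h2).not_ge
          · exact h2.ge
    rcases lt_or_gt_of_ne (hc z hzΦ) with h | h
    · exact absurd (hxm (j := z) ⟨hzΦ, h⟩ (M.mrk_mono hz1).le) (M.mrk_mono hz1).not_ge
    · exact absurd (hym (j := z) ⟨hzΦ, h⟩ (M.mrk_mono hz2).le) (M.mrk_mono hz2).not_ge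
  · intro x x' y y' e1 e2 e3 hne h1 h2 h3 h4
    by_contra hyy
    obtain ⟨z, hz⟩ := M.inter y y'
    have hzy : z ≤ y := (M.le_iff _ _).2 (by rw [hz]; exact Set.inter_subset_left)
    have hzy' : z ≤ y' := (M.le_iff _ _).2 (by rw [hz]; exact Set.inter_subset_right)
    have hxz : x ≤ z := (M.le_iff _ _).2 (by
      rw [hz]; exact Set.subset_inter ((M.le_iff _ _).1 h1) ((M.le_iff _ _).1 h3))
    have hxz' : x' ≤ z := (M.le_iff _ _).2 (by
      rw [hz]; exact Set.subset_inter ((M.le_iff _ _).1 h2) ((M.le_iff _ _).1 h4))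
    have hlt : z < y := by
      refine lt_of_le_of_ne hzy fun e => ?_
      subst e
      have := M.mrk_mono (lt_of_le_of_ne hzy' hyy)
      omega
    have hr := M.mrk_mono hlt
    have k1 : x = z := by
      by_contra hc
      have := M.mrk_mono (lt_of_le_of_ne hxz hc)
      omega
    have k2 : x' = z := by
      by_contra hc
      have := M.mrk_mono (lt_of_le_of_ne hxz' hc)
      omega
    exact hne (k1.trans k2.symm)

end Model
end model

namespace Model
section height
variable {ι : Type*} {A : Submodule ℝ (ι → ℝ)} {Z : α → Set ι} {d : ℕ}

theorem ext_pt (M : Model A Z d) {x y : α} (h : x < y)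
    (hr : mrk A Z d y = mrk A Z d x + 1) {φ : ι → ℝ} (hφ : φ ∈ annih A (Z x)) {p : ι}
    (hp : p ∈ Z y) (hp' : p ∉ Z x) (h0 : φ p = 0) : φ ∈ annih A (Z y) := by
  have := M.fin
  have hspan : annih A (Z x) ≤ annih A (Z y) ⊔ Submodule.span ℝ {M.w x} := by
    apply le_of_eq
    symm
    apply Submodule.eq_of_le_of_finrank_le
    · refine sup_le (M.annih_lt h).le ?_
      rw [Submodule.span_singleton_le_iff_mem]; exact M.w_annih x
    · rw [Submodule.finrank_sup_span_singleton (M.w_not_annih h)]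
      unfold mrk at hr
      omega
  obtain ⟨t, ht, u, hu, rfl⟩ := Submodule.mem_sup.1 (hspan hφ)
  obtain ⟨c, rfl⟩ := Submodule.mem_span_singleton.1 hu
  have : c = 0 := by
    have h1 := ht.2 p hp
    simp only [Pi.add_apply, h1, Pi.smul_apply, smul_eq_mul, zero_add] at h0
    exact (mul_eq_zero.1 h0).resolve_right (M.w_pos hp').ne'
  subst this
  simpa using ht

/-- A point of `y` outside `x`. -/
noncomputable def pt [Nonempty ι] (Z : α → Set ι) (x y : α) : ι :=
  if h : ∃ s, s ∈ Z y ∧ s ∉ Z x then Classical.choose h else Classical.arbitrary ι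

theorem pt_mem [Nonempty ι] (M : Model A Z d) {x y : α} (h : x < y) :
    pt Z x y ∈ Z y ∧ pt Z x y ∉ Z x := by
  unfold pt
  rw [dif_pos (M.lt_pt h)]
  exact Classical.choose_spec (M.lt_pt h)

/-- Successive remainders of a function along a flag. -/
noncomputable def Hl [Nonempty ι] (M : Model A Z d) (Φ : Flag α) : ℕ → (ι → ℝ) →ₗ[ℝ] (ι → ℝ)
  | 0 => LinearMap.id
  | n + 1 => Hl M Φ n - ((LinearMap.proj (pt Z (M.gp.fc Φ n) (M.gp.fc Φ (n + 1)))).comp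
      (Hl M Φ n)).smulRight
      ((M.w (M.gp.fc Φ n) (pt Z (M.gp.fc Φ n) (M.gp.fc Φ (n + 1))))⁻¹ • M.w (M.gp.fc Φ n))

/-- Successive coefficients of a function along a flag. -/
noncomputable def sg [Nonempty ι] (M : Model A Z d) (Φ : Flag α) (n : ℕ) : (ι → ℝ) →ₗ[ℝ] ℝ :=
  (M.w (M.gp.fc Φ n) (pt Z (M.gp.fc Φ n) (M.gp.fc Φ (n + 1))))⁻¹ •
    (LinearMap.proj (pt Z (M.gp.fc Φ n) (M.gp.fc Φ (n + 1)))).comp (Hl M Φ n)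

variable [Nonempty ι]

theorem Hl_succ (M : Model A Z d) (Φ : Flag α) (n : ℕ) (f : ι → ℝ) :
    M.Hl Φ (n + 1) f = M.Hl Φ n f - M.sg Φ n f • M.w (M.gp.fc Φ n) := by
  simp [Hl, sg, smul_smul, mul_comm]

theorem Hl_annih (M : Model A Z d) (Φ : Flag α) {f : ι → ℝ} (hf : f ∈ A) {n : ℕ} (hn : n ≤ d + 1) :
    M.Hl Φ n f ∈ annih A (Z (M.gp.fc Φ n)) := by
  induction n with
  | zero =>
    refine ⟨hf, fun s hs => ?_⟩
    obtain ⟨b, hb⟩ := M.exists_bot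
    have h1 : M.gp.fc Φ 0 ≤ b := M.gp.bot _ _ (by rw [M.gp.rk_fc _ hn]; simp)
    have := (M.le_iff _ _).1 h1 hs
    rw [hb] at this
    exact this.elim
  | succ n ih =>
    have h1 := ih (by omega)
    have hlt := M.gp.fc_lt Φ (Nat.lt_add_one n) hn
    obtain ⟨hp, hp'⟩ := M.pt_mem hlt
    apply M.ext_pt hlt _ _ hp hp'
    · rw [M.Hl_succ, Pi.sub_apply, Pi.smul_apply]
      have := (M.w_pos hp').ne'
      simp only [sg, LinearMap.smul_apply, LinearMap.comp_apply, LinearMap.proj_apply, smul_eq_mul]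
      field_simp
      ring
    · rw [M.gp.rk_fc _ hn, M.gp.rk_fc _ (by omega)]; push_cast; ring
    · rw [M.Hl_succ]
      exact Submodule.sub_mem _ h1 (Submodule.smul_mem _ _ (M.w_annih _))

theorem Hl_congr (M : Model A Z d) {Φ Ψ : Flag α} {n : ℕ}
    (h : ∀ m ≤ n, M.gp.fc Φ m = M.gp.fc Ψ m) : M.Hl Φ n = M.Hl Ψ n := by
  induction n with
  | zero => rfl
  | succ n ih =>
    simp only [Hl]
    rw [ih fun m hm => h m (by omega), h n (by omega), h (n + 1) le_rfl]

theorem sg_congr (M : Model A Z d) {Φ Ψ : Flag α} {n : ℕ}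
    (h : ∀ m ≤ n + 1, M.gp.fc Φ m = M.gp.fc Ψ m) : M.sg Φ n = M.sg Ψ n := by
  unfold sg
  rw [M.Hl_congr fun m hm => h m (by omega), h n (by omega), h (n + 1) le_rfl]

theorem sg_w (M : Model A Z d) (Φ : Flag α) {n : ℕ} (hn : n ≤ d) :
    M.sg Φ n (M.w (M.gp.fc Φ n)) = 1 := by
  have key : ∀ m ≤ n, M.Hl Φ m (M.w (M.gp.fc Φ n)) = M.w (M.gp.fc Φ n) := by
    intro m
    induction m with
    | zero => intro _; rfl
    | succ m ih =>
      intro hm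
      have h1 := ih (by omega)
      obtain ⟨hp, hp'⟩ := M.pt_mem (M.gp.fc_lt Φ (Nat.lt_add_one m) (by omega))
      rw [M.Hl_succ, h1]
      have : M.sg Φ m (M.w (M.gp.fc Φ n)) = 0 := by
        simp only [sg, LinearMap.smul_apply, LinearMap.comp_apply, LinearMap.proj_apply, h1]
        rw [(M.w_zero _ _).2 ((M.le_iff _ _).1 (M.gp.fc_le Φ hm) hp)]
        simp
      rw [this]; simp
  obtain ⟨hp, hp'⟩ := M.pt_mem (M.gp.fc_lt Φ (Nat.lt_add_one n) (by omega))
  simp only [sg, LinearMap.smul_apply, LinearMap.comp_apply, LinearMap.proj_apply, key n le_rfl]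
  rw [smul_eq_mul, inv_mul_cancel₀ (M.w_pos hp').ne']

theorem exists_generic (M : Model A Z d) : ∃ f ∈ A, ∀ (Φ : Flag α), ∀ n ≤ d, M.sg Φ n f ≠ 0 := by
  have := M.gp.finite_flag
  obtain ⟨f, hf⟩ := Module.Dual.exists_forall_ne_zero_of_forall_exists (K := ℝ) (M := A)
    (ι := Flag α × Fin (d + 1)) (fun q => (M.sg q.1 q.2).comp A.subtype) (by
      rintro ⟨Φ, n⟩
      refine ⟨⟨_, M.w_mem (M.gp.fc Φ n)⟩, ?_⟩
      have := M.sg_w Φ (n := n) (by omega)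
      simp [this])
  exact ⟨f, f.2, fun Φ n hn => hf (Φ, ⟨n, by omega⟩)⟩

theorem Hl_val (M : Model A Z d) (Φ : Flag α) {f : ι → ℝ} (hf : f ∈ A) {n : ℕ} (hn : n ≤ d)
    {s : ι} (hs : s ∈ Z (M.gp.fc Φ (n + 1))) :
    M.Hl Φ n f s = M.sg Φ n f * M.w (M.gp.fc Φ n) s := by
  have := (M.Hl_annih Φ hf (n := n + 1) (by omega)).2 s hs
  rw [M.Hl_succ] at this
  simp only [Pi.sub_apply, Pi.smul_apply, smul_eq_mul] at this
  linarith

/-- Sign of the remainder on a later face. -/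
theorem Hl_sign (M : Model A Z d) (Φ : Flag α) {f : ι → ℝ} (hf : f ∈ A) (ε : ℝ) {j : ℕ}
    (hj : j ≤ d + 1) : ∀ n ≤ j, (∀ m, n ≤ m → m < j → 0 < ε * M.sg Φ m f) →
    ∀ s ∈ Z (M.gp.fc Φ j), 0 ≤ ε * M.Hl Φ n f s ∧
      (n < j → (ε * M.Hl Φ n f s = 0 ↔ s ∈ Z (M.gp.fc Φ n))) := by
  intro n hn
  induction hn using Nat.decreasingInduction with
  | self =>
    intro _ s hs
    rw [(M.Hl_annih Φ hf hj).2 s hs]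
    simp
  | of_succ n hn ih =>
    intro hm s hs
    have h1 := ih (fun m h1 h2 => hm m (by omega) h2) s hs
    have h2 : M.Hl Φ n f s = M.Hl Φ (n + 1) f s + M.sg Φ n f * M.w (M.gp.fc Φ n) s := by
      rw [M.Hl_succ]; simp
    have hσ := hm n le_rfl hn
    have hw := M.w_nonneg (M.gp.fc Φ n) s
    have h3 : ε * M.Hl Φ n f s = ε * M.Hl Φ (n + 1) f s + (ε * M.sg Φ n f) * M.w (M.gp.fc Φ n) s := by
      rw [h2]; ring
    refine ⟨by rw [h3]; exact add_nonneg h1.1 (mul_nonneg hσ.le hw), fun _ => ⟨fun e => ?_, fun e => ?_⟩⟩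
    · rw [h3, add_eq_zero_iff_of_nonneg h1.1 (mul_nonneg hσ.le hw)] at e
      exact (M.w_zero _ _).1 ((mul_eq_zero.1 e.2).resolve_left hσ.ne')
    · rw [(M.Hl_annih Φ hf (by omega)).2 s e, mul_zero]

theorem fc_uniq (M : Model A Z d) {f : ι → ℝ} (hf : f ∈ A) (ε : ℝ) (Φ Ψ : Flag α) {n j : ℕ}
    (hj : j ≤ d + 1) (hn : n < j) (hag : ∀ m ≤ n, M.gp.fc Φ m = M.gp.fc Ψ m)
    (hagj : M.gp.fc Φ j = M.gp.fc Ψ j)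
    (h1 : ∀ m, n < m → m < j → 0 < ε * M.sg Φ m f) (h2 : ∀ m, n < m → m < j → 0 < ε * M.sg Ψ m f) :
    M.gp.fc Φ (n + 1) = M.gp.fc Ψ (n + 1) := by
  rcases Nat.lt_or_ge (n + 1) j with hnj | hnj
  swap
  · obtain rfl : j = n + 1 := by omega
    exact hagj
  have a1 := M.Hl_sign Φ hf ε hj (n + 1) hn (fun m h3 h4 => h1 m (by omega) h4)
  have a2 := M.Hl_sign Ψ hf ε hj (n + 1) hn (fun m h3 h4 => h2 m (by omega) h4)
  have hH : M.Hl Φ n = M.Hl Ψ n := M.Hl_congr hag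
  have key : ∀ Φ Ψ : Flag α, M.gp.fc Φ j = M.gp.fc Ψ j → M.Hl Φ n = M.Hl Ψ n →
      M.gp.fc Φ n = M.gp.fc Ψ n →
      (∀ s ∈ Z (M.gp.fc Ψ j), 0 ≤ ε * M.Hl Ψ (n + 1) f s) → ε * M.sg Ψ n f ≤ ε * M.sg Φ n f := by
    intro Φ Ψ e1 e2 e3 a
    obtain ⟨hp, hp'⟩ := M.pt_mem (M.gp.fc_lt Φ (Nat.lt_add_one n) (by omega))
    set p := pt Z (M.gp.fc Φ n) (M.gp.fc Φ (n + 1))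
    have hpj : p ∈ Z (M.gp.fc Ψ j) := by
      rw [← e1]; exact (M.le_iff _ _).1 (M.gp.fc_le Φ hnj.le) hp
    have b1 := a p hpj
    have b2 := M.Hl_val Φ hf (n := n) (by omega) hp
    rw [M.Hl_succ, ← e2, ← e3] at b1
    simp only [Pi.sub_apply, Pi.smul_apply, smul_eq_mul] at b1
    rw [b2] at b1
    have hw := M.w_pos hp'
    by_contra hc
    push Not at hc
    nlinarith
  have hfn := hag n le_rfl
  have heq : ε * M.sg Φ n f = ε * M.sg Ψ n f :=
    le_antisymm (key Ψ Φ hagj.symm hH.symm hfn.symm fun s hs => (a1 s hs).1)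
      (key Φ Ψ hagj hH hfn fun s hs => (a2 s hs).1)
  have hHe : ∀ s, ε * M.Hl Φ (n + 1) f s = ε * M.Hl Ψ (n + 1) f s := by
    intro s
    rw [M.Hl_succ, M.Hl_succ, hH, hfn]
    simp only [Pi.sub_apply, Pi.smul_apply, smul_eq_mul]
    rw [mul_sub, mul_sub, ← mul_assoc, ← mul_assoc, heq]
  apply M.Z_inj
  ext s
  constructor
  · intro hs
    have hsj := (M.le_iff _ _).1 (M.gp.fc_le Φ hnj.le) hs
    have := ((a1 s hsj).2 hnj).2 hs
    rw [hagj] at hsj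
    rw [hHe] at this
    exact ((a2 s hsj).2 hnj).1 this
  · intro hs
    have hsj := (M.le_iff _ _).1 (M.gp.fc_le Ψ hnj.le) hs
    have := ((a2 s hsj).2 hnj).2 hs
    rw [← hagj] at hsj
    rw [← hHe] at this
    exact ((a1 s hsj).2 hnj).1 this

theorem sg_diff (M : Model A Z d) {f : ι → ℝ} (hf : f ∈ A) (Φ : Flag α) {i : ℕ} (hi : i < d) :
    ∃ c > 0, M.sg (M.gp.r i Φ) i f - M.sg Φ i f = c * M.sg Φ (i + 1) f := by
  set Ψ := M.gp.r i Φ with hΨ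
  have hnle : ¬ M.gp.fc Ψ (i + 1) ≤ M.gp.fc Φ (i + 1) := by
    intro hle
    have := M.mrk_mono (lt_of_le_of_ne hle (M.gp.fc_r_self Φ hi))
    rw [M.gp.rk_fc _ (by omega), M.gp.rk_fc _ (by omega)] at this
    omega
  obtain ⟨p, hp, hp'⟩ : ∃ p, p ∈ Z (M.gp.fc Ψ (i + 1)) ∧ p ∉ Z (M.gp.fc Φ (i + 1)) := by
    by_contra hc
    push Not at hc
    exact hnle ((M.le_iff _ _).2 hc)
  have hpi : p ∉ Z (M.gp.fc Φ i) := fun h => hp' ((M.le_iff _ _).1 (M.gp.fc_le Φ (by omega)) h)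
  have hp2 : p ∈ Z (M.gp.fc Φ (i + 1 + 1)) := by
    rw [← M.gp.fc_r_ne Φ (i := i) (by omega)]
    exact (M.le_iff _ _).1 (M.gp.fc_le Ψ (by omega)) hp
  have hag : ∀ m ≤ i, M.gp.fc Ψ m = M.gp.fc Φ m := fun m hm => M.gp.fc_r_ne Φ (by omega)
  have e1 := M.Hl_val Ψ hf (n := i) (by omega) hp
  have e2 := M.Hl_val Φ hf (n := i + 1) (by omega) hp2
  rw [M.Hl_congr hag, hag i le_rfl] at e1
  rw [M.Hl_succ] at e2
  simp only [Pi.sub_apply, Pi.smul_apply, smul_eq_mul] at e2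
  have w1 := M.w_pos hpi
  have w2 := M.w_pos hp'
  refine ⟨M.w (M.gp.fc Φ (i + 1)) p / M.w (M.gp.fc Φ i) p, div_pos w2 w1, ?_⟩
  field_simp
  rw [e1] at e2
  linarith

/-- The height of a flag. -/
noncomputable def ht (M : Model A Z d) (f : ι → ℝ) (Φ : Flag α) : Lex (Fin d → ℝ) :=
  toLex fun i => M.sg Φ i f

theorem ht_lt (M : Model A Z d) {f : ι → ℝ} {Φ Ψ : Flag α} {i : ℕ} (hi : i < d)
    (hag : ∀ m ≤ i, M.gp.fc Φ m = M.gp.fc Ψ m) (h : M.sg Φ i f < M.sg Ψ i f) :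
    M.ht f Φ < M.ht f Ψ := by
  refine ⟨⟨i, hi⟩, fun j hj => ?_, h⟩
  change M.sg Φ j f = M.sg Ψ j f
  rw [M.sg_congr fun m hm => hag m ?_]
  have : (j : ℕ) < i := hj
  omega

theorem height (M : Model A Z d) : ∃ f : ι → ℝ, M.gp.Height (M.ht f) := by
  obtain ⟨f, hf, hgen⟩ := M.exists_generic
  have hag : ∀ (Φ : Flag α) i, ∀ m ≤ i, M.gp.fc (M.gp.r i Φ) m = M.gp.fc Φ m :=
    fun Φ i m hm => M.gp.fc_r_ne Φ (by omega)
  have up : ∀ Φ : Flag α, ∀ i < d, 0 < M.sg Φ (i + 1) f → M.ht f Φ < M.ht f (M.gp.r i Φ) := by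
    intro Φ i hi h
    obtain ⟨c, hc, e⟩ := M.sg_diff hf Φ hi
    have := mul_pos hc h
    exact M.ht_lt hi (fun m hm => (hag Φ i m hm).symm) (by linarith)
  have down : ∀ Φ : Flag α, ∀ i < d, M.sg Φ (i + 1) f < 0 → M.ht f (M.gp.r i Φ) < M.ht f Φ := by
    intro Φ i hi h
    obtain ⟨c, hc, e⟩ := M.sg_diff hf Φ hi
    have := mul_neg_of_pos_of_neg hc h
    exact M.ht_lt hi (hag Φ i) (by linarith)
  have up' : ∀ Φ : Flag α, ∀ i < d, M.ht f Φ < M.ht f (M.gp.r i Φ) → 0 < 1 * M.sg Φ (i + 1) f := by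
    intro Φ i hi h
    rw [one_mul]
    rcases lt_or_gt_of_ne (hgen Φ (i + 1) hi) with h1 | h1
    · exact absurd h (down Φ i hi h1).not_gt
    · exact h1
  have down' : ∀ Φ : Flag α, ∀ i < d, M.ht f (M.gp.r i Φ) < M.ht f Φ →
      0 < (-1) * M.sg Φ (i + 1) f := by
    intro Φ i hi h
    rcases lt_or_gt_of_ne (hgen Φ (i + 1) hi) with h1 | h1
    · linarith
    · exact absurd h (up Φ i hi h1).not_gt
  refine ⟨f, ?_, ?_, ?_⟩
  · intro i hi Φ
    rcases lt_or_gt_of_ne (hgen Φ (i + 1) hi) with h1 | h1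
    · exact (down Φ i hi h1).ne
    · exact (up Φ i hi h1).ne'
  · intro k Φ Ψ hk h1 h2
    have p1 : ∀ m, 1 ≤ m → m ≤ d → m ≠ k → 0 < 1 * M.sg Φ m f := by
      intro m a b c
      have := up' Φ (m - 1) (by omega) (h1 _ (by omega) (by omega))
      rwa [Nat.sub_add_cancel a] at this
    have p2 : ∀ m, 1 ≤ m → m ≤ d → m ≠ k → 0 < 1 * M.sg Ψ m f := by
      intro m a b c
      have := up' Ψ (m - 1) (by omega) (h2 _ (by omega) (by omega))
      rwa [Nat.sub_add_cancel a] at this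
    have key : ∀ n ≤ d, ∀ m ≤ n, M.gp.fc Φ m = M.gp.fc Ψ m := by
      intro n
      induction n with
      | zero =>
        intro _ m hm
        obtain rfl : m = 0 := by omega
        exact M.gp.fc_zero _ _
      | succ n ih =>
        intro hn m hm
        rcases Nat.lt_or_ge m (n + 1) with hm' | hm'
        · exact ih (by omega) m (by omega)
        obtain rfl : m = n + 1 := by omega
        by_cases hnk : n < k ∧ k ≤ d + 1
        · exact M.fc_uniq hf 1 Φ Ψ (j := k) hnk.2 hnk.1 (ih (by omega)) hk
            (fun m a b => p1 m (by omega) (by omega) (by omega))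
            (fun m a b => p2 m (by omega) (by omega) (by omega))
        · exact M.fc_uniq hf 1 Φ Ψ (j := d + 1) le_rfl (by omega) (ih (by omega)) (M.gp.fc_top _ _)
            (fun m a b => p1 m (by omega) (by omega) (by omega))
            (fun m a b => p2 m (by omega) (by omega) (by omega))
    exact M.gp.flag_ext fun i hi => key d le_rfl (i + 1) (by omega)
  · intro i j Φ Ψ hij hj hag h1 h2 h3 h4
    have a1 := down' Φ i (by omega) h1
    have a2 := down' Φ j hj h2
    have b1 := down' Ψ i (by omega) h3
    have b2 := down' Ψ j hj h4
    have hi : M.gp.fc Φ (i + 1) = M.gp.fc Ψ (i + 1) := by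
      rcases Nat.lt_or_ge (i + 1) j with hlt | hge
      · refine M.fc_uniq hf (-1) Φ Ψ (n := i) (j := i + 2) (by omega) (by omega)
          (fun m hm => hag m (by omega) (by omega)) (hag _ (by omega) (by omega)) ?_ ?_
        · intro m c1 c2; obtain rfl : m = i + 1 := by omega
          exact a1
        · intro m c1 c2; obtain rfl : m = i + 1 := by omega
          exact b1
      · obtain rfl : j = i + 1 := by omega
        refine M.fc_uniq hf (-1) Φ Ψ (n := i) (j := i + 3) (by omega) (by omega)
          (fun m hm => hag m (by omega) (by omega)) (hag _ (by omega) (by omega)) ?_ ?_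
        · intro m c1 c2
          rcases (show m = i + 1 ∨ m = i + 1 + 1 by omega) with rfl | rfl
          · exact a1
          · exact a2
        · intro m c1 c2
          rcases (show m = i + 1 ∨ m = i + 1 + 1 by omega) with rfl | rfl
          · exact b1
          · exact b2
    have hj' : M.gp.fc Φ (j + 1) = M.gp.fc Ψ (j + 1) := by
      refine M.fc_uniq hf (-1) Φ Ψ (n := j) (j := j + 2) (by omega) (by omega)
          (fun m hm => ?_) (hag _ (by omega) (by omega)) ?_ ?_
      · by_cases e : m = i + 1
        · rw [e]; exact hi
        · exact hag m e (by omega)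
      · intro m c1 c2; obtain rfl : m = j + 1 := by omega
        exact a2
      · intro m c1 c2; obtain rfl : m = j + 1 := by omega
        exact b2
    refine M.gp.flag_ext fun k hk => ?_
    by_cases e : k = i
    · rw [e]; exact hi
    · by_cases e' : k = j
      · rw [e']; exact hj'
      · exact hag _ (by omega) (by omega)

end height
end Model

theorem GP.rk_unique {rk rk2 : α → ℤ} {d : ℕ} (h : GP α rk d) (hm : StrictMono rk2)
    (hlo : ∀ x, -1 ≤ rk2 x) (hhi : ∀ x, rk2 x ≤ d) : rk = rk2 := by
  funext x
  obtain ⟨Φ, hΦ⟩ : ∃ Φ : Flag α, x ∈ Φ := Flag.exists_mem x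
  have up : ∀ n : ℕ, n ≤ d + 1 → (n : ℤ) - 1 ≤ rk2 (h.fc Φ n) := by
    intro n
    induction n with
    | zero => intro _; simpa using hlo _
    | succ n ih =>
      intro hn
      have := hm (h.fc_lt Φ (m := n) (n := n + 1) (by omega) hn)
      have := ih (by omega)
      push_cast
      omega
  have dn : ∀ m : ℕ, m ≤ d + 1 → rk2 (h.fc Φ (d + 1 - m)) ≤ (d : ℤ) - m := by
    intro m
    induction m with
    | zero => intro _; simpa using hhi _
    | succ n ih =>
      intro hn
      have := hm (h.fc_lt Φ (m := d + 1 - (n + 1)) (n := d + 1 - n) (by omega) (by omega))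
      have := ih (by omega)
      have e1 : ((n + 1 : ℕ) : ℤ) = n + 1 := by push_cast; ring
      rw [e1]
      linarith [Int.add_one_le_iff.2 ‹rk2 (h.fc Φ (d + 1 - (n + 1))) < _›]
  obtain ⟨n, hn, e⟩ := h.exists_idx x
  have hx := h.fc_eq hn hΦ e
  have h1 := up n hn
  have h2 := dn (d + 1 - n) (by omega)
  rw [show d + 1 - (d + 1 - n) = n by omega, hx] at h2
  rw [hx] at h1
  have : ((d + 1 - n : ℕ) : ℤ) = d + 1 - n := by push_cast [hn]; ring
  omega

section faces
variable {d : ℕ}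

theorem faceRank_mono {P : Set (EucSp d)} : StrictMono (faceRank (P := P)) := by
  intro F G hFG
  have hsub : F.1 ⊆ G.1 := hFG.le
  obtain ⟨g, hg, hgF⟩ : ∃ g, g ∈ G.1 ∧ g ∉ F.1 := by
    by_contra hc
    push Not at hc
    exact hFG.not_ge hc
  have hG : G.1 ≠ ∅ := Set.nonempty_iff_ne_empty.1 ⟨g, hg⟩
  unfold faceRank
  rw [if_neg hG]
  split_ifs with hF
  · omega
  · obtain ⟨f, hf⟩ := Set.nonempty_iff_ne_empty.2 hF
    obtain ⟨l, hl⟩ := F.2 ⟨f, hf⟩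
    have hgP : g ∈ P := G.2.subset hg
    have hcst : ∀ x ∈ F.1, ∀ y ∈ F.1, l x = l y := by
      intro x hx y hy
      rw [hl] at hx hy
      exact le_antisymm (hy.2 x hx.1) (hx.2 y hy.1)
    have hlt : l g ≠ l f := by
      intro e
      apply hgF
      rw [hl]
      rw [hl] at hf
      exact ⟨hgP, fun y hy => (hf.2 y hy).trans e.ge⟩
    have : (affineSpan ℝ F.1).direction < (affineSpan ℝ G.1).direction := by
      refine lt_of_le_of_ne (AffineSubspace.direction_le (affineSpan_mono ℝ hsub)) ?_
      intro e
      have h1 : g -ᵥ f ∈ (affineSpan ℝ G.1).direction :=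
        AffineSubspace.vsub_mem_direction (subset_affineSpan ℝ _ hg) (subset_affineSpan ℝ _ (hsub hf))
      rw [← e, direction_affineSpan] at h1
      have h2 : vectorSpan ℝ F.1 ≤ LinearMap.ker l.toLinearMap := by
        rw [vectorSpan_def, Submodule.span_le]
        rintro _ ⟨x, hx, y, hy, rfl⟩
        simp [hcst x hx y hy]
      have := h2 h1
      simp [sub_eq_zero] at this
      exact hlt this
    exact_mod_cast Submodule.finrank_lt_finrank_of_lt this

theorem faceRank_lo {P : Set (EucSp d)} (F : Faces P) : -1 ≤ faceRank F := by
  unfold faceRank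
  split_ifs <;> omega

theorem faceRank_hi {P : Set (EucSp d)} (F : Faces P) : faceRank F ≤ d := by
  unfold faceRank
  split_ifs
  · omega
  · have := Submodule.finrank_le (affineSpan ℝ F.1).direction
    simp only [finrank_euclideanSpace, Fintype.card_fin] at this
    exact_mod_cast this

/-- Affine functions on the vertex set. -/
noncomputable def affMap (S : Finset (EucSp d)) : (ℝ × EucSp d) →ₗ[ℝ] (S → ℝ) where
  toFun p := fun s => p.1 + ⟪p.2, (s : EucSp d)⟫
  map_add' p q := by ext s; simp [inner_add_left]; ring
  map_smul' c p := by ext s; simp [inner_smul_left]; ring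

theorem affMap_apply (S : Finset (EucSp d)) (p : ℝ × EucSp d) (s : S) :
    affMap S p s = p.1 + ⟪p.2, (s : EucSp d)⟫ := rfl

theorem hull_nonneg (S : Finset (EucSp d)) (a : ℝ) (w : EucSp d)
    (h : ∀ s ∈ S, 0 ≤ a + ⟪w, s⟫) : ∀ x ∈ convexHull ℝ (S : Set (EucSp d)), 0 ≤ a + ⟪w, x⟫ := by
  have hc : Convex ℝ {x : EucSp d | 0 ≤ a + ⟪w, x⟫} := by
    intro x hx y hy p q hp hq hpq
    simp only [Set.mem_ofPred_eq, inner_add_right, inner_smul_right] at *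
    have : a = p * a + q * a := by rw [← add_mul, hpq, one_mul]
    nlinarith [mul_nonneg hp hx, mul_nonneg hq hy]
  exact fun x hx => convexHull_min (fun s hs => h s hs) hc hx

theorem affMap_inj (S : Finset (EucSp d))
    (hi : (interior (convexHull ℝ (S : Set (EucSp d)))).Nonempty) : Function.Injective (affMap S) := by
  rw [injective_iff_map_eq_zero]
  rintro ⟨a, w⟩ h0
  have hz : ∀ x ∈ convexHull ℝ (S : Set (EucSp d)), a + ⟪w, x⟫ = 0 := by
    intro x hx
    apply le_antisymm
    · have := hull_nonneg S (-a) (-w) (fun s hs => by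
        have := congrFun h0 ⟨s, hs⟩
        simp [affMap_apply] at this
        simp; linarith) x hx
      simp at this
      linarith
    · exact hull_nonneg S a w (fun s hs => by
        have := congrFun h0 ⟨s, hs⟩
        simp [affMap_apply] at this
        linarith) x hx
  obtain ⟨x, hx⟩ := hi
  rw [mem_interior_iff_mem_nhds, Metric.mem_nhds_iff] at hx
  obtain ⟨ε, hε, hb⟩ := hx
  have hw : w = 0 := by
    by_contra hw
    have hn : 0 < ‖w‖ := norm_pos_iff.2 hw
    have h1 := hz x (hb (Metric.mem_ball_self hε))
    have h2 := hz (x + (ε / 2 / ‖w‖) • w) (hb (by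
      simp [norm_smul, abs_of_pos hε]
      field_simp
      linarith))
    rw [inner_add_right, inner_smul_right, real_inner_self_eq_norm_sq] at h2
    have : ε / 2 / ‖w‖ * ‖w‖ ^ 2 > 0 := by positivity
    linarith
  have h1 := hz x (hb (Metric.mem_ball_self hε))
  simp [hw] at h1
  simp [hw, h1]

theorem exposed_sub (S : Finset (EucSp d)) {F : Set (EucSp d)}
    (hF : IsExposed ℝ (convexHull ℝ (S : Set (EucSp d))) F) :
    F ⊆ convexHull ℝ {x | x ∈ S ∧ x ∈ F} := by
  have hc : IsCompact (convexHull ℝ (S : Set (EucSp d))) := S.finite_toSet.isCompact_convexHull (𝕜 := ℝ)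
  have hFc := hF.isCompact hc
  have hFv := hF.convex (convex_convexHull ℝ _)
  have hfin : Set.Finite {x | x ∈ S ∧ x ∈ F} := S.finite_toSet.subset fun x hx => hx.1
  have hsub : F.extremePoints ℝ ⊆ {x | x ∈ S ∧ x ∈ F} := by
    intro x hx
    exact ⟨extremePoints_convexHull_subset (hF.isExtreme.extremePoints_subset_extremePoints hx), hx.1⟩
  refine (closure_convexHull_extremePoints hFc hFv).symm.subset.trans ?_
  exact closure_minimal (convexHull_mono hsub) (hfin.isClosed_convexHull (𝕜 := ℝ))

theorem faces_model (S : Finset (EucSp d))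
    (hi : (interior (convexHull ℝ (S : Set (EucSp d)))).Nonempty) :
    Model (α := Faces (convexHull ℝ (S : Set (EucSp d)))) (LinearMap.range (affMap S))
      (fun F => {s : S | (s : EucSp d) ∈ F.1}) d := by
  constructor
  · infer_instance
  · intro F G
    constructor
    · intro h s hs
      exact h hs
    · intro h x hx
      have := exposed_sub S F.2 hx
      have hsub : {x | x ∈ S ∧ x ∈ F.1} ⊆ G.1 := fun x hx => h (a := ⟨x, hx.1⟩) hx.2
      exact convexHull_min hsub (G.2.convex (convex_convexHull ℝ _)) this
  · exact ⟨(1, 0), by ext s; simp [affMap_apply]⟩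
  · rw [LinearMap.finrank_range_of_inj (affMap_inj S hi)]
    simp; ring
  · intro F
    by_cases hF : F.1 = ∅
    · refine ⟨1, ⟨(1, 0), by ext s; simp [affMap_apply]⟩, by simp, by simp [hF]⟩
    · obtain ⟨f, hf⟩ := Set.nonempty_iff_ne_empty.2 hF
      obtain ⟨l, hl⟩ := F.2 ⟨f, hf⟩
      have hi : ∀ x, ⟪(InnerProductSpace.toDual ℝ (EucSp d)).symm l, x⟫ = l x := fun x =>
        InnerProductSpace.toDual_symm_apply
      have hfP := hf
      rw [hl] at hfP
      refine ⟨_, ⟨(l f, -(InnerProductSpace.toDual ℝ (EucSp d)).symm l), rfl⟩, ?_, ?_⟩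
      · intro s
        rw [affMap_apply, inner_neg_left, hi]
        have := hfP.2 s (subset_convexHull ℝ _ s.2)
        linarith
      · intro s
        rw [affMap_apply, inner_neg_left, hi]
        constructor
        · intro e
          show (s : EucSp d) ∈ F.1
          rw [hl]
          exact ⟨subset_convexHull ℝ _ s.2, fun y hy => (hfP.2 y hy).trans (by linarith)⟩
        · intro hs
          have hs' : (s : EucSp d) ∈ F.1 := hs
          rw [hl] at hs'
          have := hs'.2 f hfP.1
          have := hfP.2 s hs'.1
          linarith
  · rintro _ ⟨⟨a, w⟩, rfl⟩ h0
    have hn := hull_nonneg S a w (fun s hs => h0 ⟨s, hs⟩)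
    refine ⟨⟨{x | x ∈ convexHull ℝ (S : Set (EucSp d)) ∧ a + ⟪w, x⟫ = 0}, ?_⟩, ?_⟩
    · rintro ⟨y, hy, hy0⟩
      refine ⟨-(innerSL ℝ w), ?_⟩
      ext x
      simp only [Set.mem_ofPred_eq, neg_apply, innerSL_apply_apply]
      refine and_congr_right fun hx => ⟨fun e z hz => ?_, fun h => ?_⟩
      · have := hn z hz
        linarith
      · have := h y hy
        have := hn x hx
        linarith
    · intro s
      exact ⟨fun e => ⟨subset_convexHull ℝ _ s.2, e⟩, fun h => h.2⟩

theorem polytope_gp {P : Set (EucSp d)} (hP : IsConvexPolytope P) :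
    ∃ (h : GP (Faces P) faceRank d) (ψ : Flag (Faces P) → Lex (Fin d → ℝ)), h.Height ψ := by
  obtain ⟨⟨S, rfl⟩, hi⟩ := hP
  have M := faces_model S hi
  have : Nonempty S := by
    obtain ⟨x, hx⟩ := hi
    have h1 : (convexHull ℝ (S : Set (EucSp d))).Nonempty := ⟨x, interior_subset hx⟩
    rw [convexHull_nonempty_iff] at h1
    exact h1.to_subtype
  obtain ⟨f, hf⟩ := M.height
  have key : ∀ (rk : Faces (convexHull ℝ (S : Set (EucSp d))) → ℤ) (h : GP _ rk d)
      (ψ : Flag (Faces (convexHull ℝ (S : Set (EucSp d)))) → Lex (Fin d → ℝ)), h.Height ψ →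
      ∃ (h : GP (Faces (convexHull ℝ (S : Set (EucSp d)))) faceRank d)
        (ψ : Flag (Faces (convexHull ℝ (S : Set (EucSp d)))) → Lex (Fin d → ℝ)), h.Height ψ := by
    intro rk h ψ hh
    obtain rfl := h.rk_unique faceRank_mono faceRank_lo faceRank_hi
    exact ⟨h, ψ, hh⟩
  exact key _ _ _ hf

end faces

section coxeter
variable {ι : Type*} [Fintype ι] [DecidableEq ι]

/-- The linear form attached to a row of a matrix. -/
noncomputable def rowF (B : ι → ι → ℝ) (a : ι) : Module.Dual ℝ (ι → ℝ) :=
  ∑ b, B a b • LinearMap.proj b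

theorem rowF_apply (B : ι → ι → ℝ) (a : ι) (v : ι → ℝ) : rowF B a v = ∑ b, B a b * v b := by
  simp [rowF]

theorem rowF_single (B : ι → ι → ℝ) (a b : ι) : rowF B a (Pi.single b 1) = B a b := by
  rw [rowF_apply]
  simp [Pi.single_apply]

/-- The reflections of the geometric representation. -/
noncomputable def srefl (B : ι → ι → ℝ) (h2 : ∀ a, B a a = 2) (a : ι) : (ι → ℝ) ≃ₗ[ℝ] (ι → ℝ) :=
  Module.reflection (x := Pi.single a 1) (f := rowF B a) (by rw [rowF_single, h2])

theorem srefl_apply (B : ι → ι → ℝ) (h2 : ∀ a, B a a = 2) (a : ι) (v : ι → ℝ) :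
    srefl B h2 a v = v - rowF B a v • Pi.single a 1 := Module.reflection_apply _ _

theorem srefl_sq (B : ι → ι → ℝ) (h2 : ∀ a, B a a = 2) (a : ι) :
    srefl B h2 a * srefl B h2 a = 1 := by
  ext1 v
  exact Module.involutive_reflection _ v

theorem srefl_pow (B : ι → ι → ℝ) (h2 : ∀ a, B a a = 2) (a b : ι) (m : ℕ) (hm : 2 ≤ m)
    (hab : B a b = -(2 * Real.cos (Real.pi / m))) (hba : B b a = -(2 * Real.cos (Real.pi / m))) :
    (srefl B h2 a * srefl B h2 b) ^ m = 1 := by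
  ext1 z
  unfold srefl
  rw [Module.reflection_mul_reflection_pow_apply _ _ m z (2 * Real.cos (2 * (Real.pi / m)))
    (by rw [rowF_single, rowF_single, hab, hba, Real.cos_two_mul]; ring)]
  rw [rowF_single, rowF_single, hab, hba]
  simp only [LinearEquiv.coe_one, id_eq]
  rcases hm.lt_or_eq with hm3 | rfl
  · have hmR : (3 : ℝ) ≤ m := by exact_mod_cast hm3
    have hs : Real.sin (2 * (Real.pi / m)) ≠ 0 := by
      apply ne_of_gt
      apply Real.sin_pos_of_pos_of_lt_pi
      · have := Real.pi_pos
        positivity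
      · have := Real.pi_pos
        rw [← mul_div_assoc, div_lt_iff₀ (by linarith)]
        nlinarith
    have hS : ∀ n : ℤ, (Polynomial.Chebyshev.S ℝ n).eval (2 * Real.cos (2 * (Real.pi / m))) =
        Real.sin ((n + 1) * (2 * (Real.pi / m))) / Real.sin (2 * (Real.pi / m)) := by
      intro n
      rw [eq_div_iff hs]
      exact Polynomial.Chebyshev.S_two_mul_real_cos _ _
    rcases Nat.even_or_odd' m with ⟨k, hk | hk⟩
    · have e1 : ((m : ℤ) - 2) / 2 = k - 1 := by omega
      have e2 : ((m : ℤ) - 1) / 2 = k - 1 := by omega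
      have h0 : (Polynomial.Chebyshev.S ℝ ((k : ℤ) - 1)).eval (2 * Real.cos (2 * (Real.pi / m))) = 0 := by
        rw [hS]
        have : (((k : ℤ) - 1 : ℤ) + 1 : ℝ) * (2 * (Real.pi / m)) = Real.pi := by
          rw [hk]
          have : (k : ℝ) ≠ 0 := by
            have : k ≠ 0 := by omega
            exact_mod_cast this
          push_cast
          field_simp
          ring
        rw [this]
        simp
      rw [e1, e2, h0]
      simp
    · have e1 : ((m : ℤ) - 2) / 2 = k - 1 := by omega
      have e2 : ((m : ℤ) - 1) / 2 = k := by omega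
      have e3 : ((m : ℤ) - 3) / 2 = k - 1 := by omega
      have e4 : (m : ℤ) / 2 = k := by omega
      have h0 : (Polynomial.Chebyshev.S ℝ (k : ℤ)).eval (2 * Real.cos (2 * (Real.pi / m))) +
         (Polynomial.Chebyshev.S ℝ ((k : ℤ) - 1)).eval (2 * Real.cos (2 * (Real.pi / m))) = 0 := by
        rw [hS, hS, ← add_div]
        have : (((k : ℤ) : ℝ) + 1) * (2 * (Real.pi / m)) =
            2 * Real.pi - (((k : ℤ) - 1 : ℤ) + 1 : ℝ) * (2 * (Real.pi / m)) := by
          have : (m : ℝ) ≠ 0 := by linarith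
          have hk' : (m : ℝ) = 2 * k + 1 := by exact_mod_cast hk
          push_cast
          field_simp
          rw [hk']
          ring
        rw [this, Real.sin_two_pi_sub]
        simp
      rw [e1, e2, e3, e4, h0]
      simp
  · have hpi : Real.cos (2 * (Real.pi / (2 : ℕ))) = -1 := by
      rw [show 2 * (Real.pi / ((2 : ℕ) : ℝ)) = Real.pi by push_cast; ring, Real.cos_pi]
    rw [hpi]
    norm_num
    module

theorem rowF_le (B : ι → ι → ℝ) (hoff : ∀ a b, a ≠ b → B a b ≤ 0) (x : ι → ℝ) (hx : ∀ a, 0 ≤ x a)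
    (a : ι) (T : Finset ι) (ha : a ∈ T) : rowF B a x ≤ ∑ b ∈ T, B a b * x b := by
  rw [rowF_apply, ← Finset.sum_add_sum_compl T]
  have : ∑ b ∈ Tᶜ, B a b * x b ≤ 0 := by
    apply Finset.sum_nonpos
    intro b hb
    rw [Finset.mem_compl] at hb
    exact mul_nonpos_of_nonpos_of_nonneg (hoff a b fun e => hb (e ▸ ha)) (hx b)
  linarith

theorem cox_finite (B : ι → ι → ℝ) (h2 : ∀ a, B a a = 2) (hs : ∀ a b, B a b = B b a)
    (hoff : ∀ a b, a ≠ b → B a b ≤ 0) (W : Set ((ι → ℝ) ≃ₗ[ℝ] (ι → ℝ))) (hW : W.Finite)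
    (h1 : 1 ∈ W) (hcl : ∀ a, ∀ w ∈ W, srefl B h2 a * w ∈ W)
    (x : ι → ℝ) (hx : ∀ a, 0 ≤ x a) (hne : x ≠ 0) (hneg : ∀ a, x a ≠ 0 → rowF B a x ≤ 0) : False := by
  set J : Set ι := {a | x a ≠ 0} with hJ
  set G := Submonoid.closure (srefl B h2 '' J) with hG
  have hgen : ∀ a ∈ J, srefl B h2 a ∈ G := fun a ha => Submonoid.subset_closure ⟨a, ha, rfl⟩
  have hGW : (G : Set ((ι → ℝ) ≃ₗ[ℝ] (ι → ℝ))) ⊆ W := by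
    intro g hg
    induction hg using Submonoid.closure_induction_left with
    | one => exact h1
    | mul_left s hs g _ ih =>
      obtain ⟨a, -, rfl⟩ := hs
      exact hcl a g ih
  have hGf : (G : Set ((ι → ℝ) ≃ₗ[ℝ] (ι → ℝ))).Finite := hW.subset hGW
  have hsupp : ∀ g ∈ G, ∀ a ∉ J, g x a = 0 := by
    intro g hg
    induction hg using Submonoid.closure_induction_left with
    | one => intro a ha; simpa [hJ] using ha
    | mul_left s hs g _ ih =>
      obtain ⟨c, hc, rfl⟩ := hs
      intro a ha
      rw [LinearEquiv.mul_apply, srefl_apply]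
      have : a ≠ c := fun e => ha (e ▸ hc)
      simp [ih a ha, this]
  -- a maximal element of the orbit above `x`
  set O : Set (ι → ℝ) := {u | (∃ g ∈ G, g x = u) ∧ ∀ a, x a ≤ u a} with hO
  have hOf : O.Finite := (hGf.image (fun g => g x)).subset fun u hu => by
    obtain ⟨⟨g, hg, e⟩, -⟩ := hu
    exact ⟨g, hg, e⟩
  obtain ⟨u, ⟨⟨g, hg, rfl⟩, hux⟩, hmax⟩ := Set.exists_max_image O (fun u => ∑ a, u a) hOf
    ⟨x, ⟨1, G.one_mem, rfl⟩, fun a => le_rfl⟩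
  set u := g x with hu
  have hpos : ∀ a ∈ J, 0 ≤ rowF B a u := by
    intro a ha
    by_contra hc
    push Not at hc
    have hap := srefl_apply B h2 a u
    have hge : ∀ b, u b ≤ srefl B h2 a u b := by
      intro b
      rw [hap]
      by_cases hb : b = a
      · subst hb
        simp; linarith
      · simp [hb]
    have hmem : srefl B h2 a u ∈ O :=
      ⟨⟨srefl B h2 a * g, G.mul_mem (hgen a ha) hg, rfl⟩, fun b => (hux b).trans (hge b)⟩
    have := hmax _ hmem
    have hlt : ∑ b, u b < ∑ b, srefl B h2 a u b := by
      apply Finset.sum_lt_sum (fun b _ => hge b)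
      refine ⟨a, Finset.mem_univ _, ?_⟩
      rw [hap]
      simp; linarith
    exact absurd this (not_le.2 hlt)
  have hus : ∀ a ∉ J, u a = 0 := hsupp g hg
  have hu0 : ∀ a, 0 ≤ u a := fun a => (hx a).trans (hux a)
  have hsum : ∑ a, x a * rowF B a u ≤ 0 := by
    have : ∑ a, x a * rowF B a u = ∑ a, u a * rowF B a x := by
      simp only [rowF_apply, Finset.mul_sum]
      rw [Finset.sum_comm]
      refine Finset.sum_congr rfl fun a _ => Finset.sum_congr rfl fun b _ => ?_
      rw [hs b a]; ring
    rw [this]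
    apply Finset.sum_nonpos
    intro a _
    by_cases ha : a ∈ J
    · exact mul_nonpos_of_nonneg_of_nonpos (hu0 a) (hneg a ha)
    · rw [hus a ha, zero_mul]
  have hzero : ∀ a ∈ J, rowF B a u = 0 := by
    intro a ha
    have hterm : ∀ a ∈ Finset.univ, 0 ≤ x a * rowF B a u := by
      intro a _
      by_cases ha : a ∈ J
      · exact mul_nonneg (hx a) (hpos a ha)
      · have : x a = 0 := by simpa [hJ] using ha
        simp [this]
    have h0 : ∑ a, x a * rowF B a u = 0 := le_antisymm hsum (Finset.sum_nonneg hterm)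
    have := (Finset.sum_eq_zero_iff_of_nonneg hterm).1 h0 a (Finset.mem_univ _)
    exact (mul_eq_zero.1 this).resolve_left ha
  have hfix : ∀ g ∈ G, g u = u := by
    intro g hg
    induction hg using Submonoid.closure_induction_left with
    | one => rfl
    | mul_left s hs g _ ih =>
      obtain ⟨c, hc, rfl⟩ := hs
      rw [LinearEquiv.mul_apply, ih, srefl_apply, hzero c hc]
      simp
  set T : (ι → ℝ) → (ι → ℝ) := fun v => ∑ g ∈ hGf.toFinset, g v with hT
  have hTs : ∀ a ∈ J, T (Pi.single a 1) = 0 := by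
    intro a ha
    have e1 : T (srefl B h2 a (Pi.single a 1)) = T (Pi.single a 1) := by
      refine Finset.sum_bij (fun g _ => g * srefl B h2 a) ?_ ?_ ?_ ?_
      · intro g hg
        rw [Set.Finite.mem_toFinset] at *
        exact G.mul_mem hg (hgen a ha)
      · intro g _ g' _ e
        exact mul_right_cancel e
      · intro g hg
        rw [Set.Finite.mem_toFinset] at hg
        refine ⟨g * srefl B h2 a, ?_, ?_⟩
        · rw [Set.Finite.mem_toFinset]
          exact G.mul_mem hg (hgen a ha)
        · rw [mul_assoc, srefl_sq, mul_one]
      · intro g _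
        rfl
    have e2 : srefl B h2 a (Pi.single a 1) = -Pi.single a 1 := by
      rw [srefl_apply, rowF_single, h2]
      module
    rw [e2] at e1
    have e3 : T (-Pi.single a 1) = -T (Pi.single a 1) := by
      simp [hT]
    rw [e3] at e1
    exact self_eq_neg.1 e1.symm
  have hTu : T u = 0 := by
    have e : u = ∑ a, u a • Pi.single a (1 : ℝ) := by
      ext b
      simp [Pi.single_apply]
    rw [e]
    have : T (∑ a, u a • Pi.single a (1 : ℝ)) = ∑ a, u a • T (Pi.single a 1) := by
      simp only [hT, map_sum, map_smul, Finset.smul_sum]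
      exact Finset.sum_comm
    rw [this]
    apply Finset.sum_eq_zero
    intro a _
    by_cases ha : a ∈ J
    · rw [hTs a ha, smul_zero]
    · rw [hus a ha, zero_smul]
  have hTu' : T u = (hGf.toFinset.card : ℝ) • u := by
    have : T u = ∑ g ∈ hGf.toFinset, u := Finset.sum_congr rfl fun g hg =>
      hfix g ((Set.Finite.mem_toFinset _).1 hg)
    rw [this, Finset.sum_const, Nat.cast_smul_eq_nsmul]
  have hcard : (hGf.toFinset.card : ℝ) ≠ 0 := by
    have : hGf.toFinset.card ≠ 0 := Finset.card_ne_zero.2 ⟨1, (Set.Finite.mem_toFinset _).2 G.one_mem⟩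
    exact_mod_cast this
  rw [hTu'] at hTu
  have hu00 := (smul_eq_zero.1 hTu).resolve_left hcard
  apply hne
  ext a
  have := hux a
  rw [hu00] at this
  exact le_antisymm this (hx a)

end coxeter

namespace GP
section typed
variable {β : Type*} [PartialOrder β] {rk : α → ℤ} {rk' : β → ℤ} {d : ℕ}

theorem exists_iso_of_ok {Λ Λ' : Type*} [LinearOrder Λ] [LinearOrder Λ'] {ψ : Flag α → Λ}
    {ψ' : Flag β → Λ'} {h : GP α rk d} (H : h.Height ψ) {h' : GP β rk' d} (H' : h'.Height ψ')
    (ok : Flag α → Flag β → Prop)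
    (hok : ∀ i < d, ∀ Φ Ψ, ok Φ Ψ → ok (h.r i Φ) (h'.r i Ψ))
    (hper : ∀ i j, i < j → j < d → ∀ Φ Ψ, ok Φ Ψ → h.per i j Φ = h'.per i j Ψ)
    (Φ0 : Flag α) (Ψ0 : Flag β) (h0 : ok Φ0 Ψ0) :
    ∃ γ : α ≃o β, γ '' (Φ0 : Set α) = (Ψ0 : Set β) := by
  obtain ⟨D, e0, -, hD⟩ := H.dev h'.r ok hok h'.r_r (fun i j hij hj Φ y hy => by
    have := h'.per_spec i j y
    rw [← hper i j hij hj Φ y hy] at this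
    exact this) Φ0 Ψ0 h0
  obtain ⟨D', e0', -, hD'⟩ := H'.dev h.r (fun Ψ Φ => ok Φ Ψ) (fun i hi Ψ Φ => hok i hi Φ Ψ) h.r_r
    (fun i j hij hj Ψ y hy => by
      have := h.per_spec i j y
      rw [hper i j hij hj y Ψ hy] at this
      exact this) Ψ0 Φ0 h0
  have h1 : ∀ Φ, D' (D Φ) = Φ := fun Φ => H.conn0 (fun Φ => D' (D Φ) = Φ)
    (fun Φ i hi e => by simp only [hD i hi, hD' i hi, e]) Φ0 Φ (by rw [e0, e0'])
  have h2 : ∀ Φ, D (D' Φ) = Φ := fun Φ => H'.conn0 (fun Φ => D (D' Φ) = Φ)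
    (fun Φ i hi e => by simp only [hD i hi, hD' i hi, e]) Ψ0 Φ (by rw [e0', e0])
  obtain ⟨γ, hγ⟩ := exists_iso H H' D D' hD hD' h1 h2
  exact ⟨γ, by rw [hγ, e0]⟩

/-- A two-colouring of the flags whose colour determines the local type. -/
structure Typed (h : GP α rk d) (col : Flag α → Bool) : Prop where
  keep : ∀ i, i + 1 < d → ∀ Φ, col (h.r i Φ) = col Φ
  flip : ∀ i, i + 1 = d → ∀ Φ, col (h.r i Φ) = !col Φ
  same : ∀ Φ Ψ, col Φ = col Ψ → ∀ i j, h.per i j Φ = h.per i j Ψ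

theorem per_r_self (h : GP α rk d) (i j : ℕ) (Φ : Flag α) : h.per i j (h.r j Φ) = h.per i j Φ := by
  unfold per
  rw [Function.minimalPeriod_eq_minimalPeriod_iff]
  intro n
  have e1 : ∀ n, ∀ Φ, (h.r i ∘ h.r j)^[n] (h.r j Φ) = h.r j ((h.r j ∘ h.r i)^[n] Φ) := by
    intro n
    have hsc : Function.Semiconj (h.r j) (h.r j ∘ h.r i) (h.r i ∘ h.r j) := by
      intro x
      simp [h.r_r]
    intro Φ
    exact ((hsc.iterate_right n) Φ).symm
  have hinv : Function.LeftInverse (h.r i ∘ h.r j)^[n] (h.r j ∘ h.r i)^[n] := by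
    apply Function.LeftInverse.iterate
    intro x
    simp [h.r_r]
  have hinv' : Function.LeftInverse (h.r j ∘ h.r i)^[n] (h.r i ∘ h.r j)^[n] := by
    apply Function.LeftInverse.iterate
    intro x
    simp [h.r_r]
  unfold Function.IsPeriodicPt Function.IsFixedPt
  rw [e1, (h.r_inj j).eq_iff]
  constructor
  · intro e
    have := hinv Φ
    rwa [e] at this
  · intro e
    have := hinv' Φ
    rwa [e] at this

theorem per_r_far (h : GP α rk d) (i j l : ℕ) (hi : i + 2 ≤ l) (hj : j + 2 ≤ l) (Φ : Flag α) :
    h.per i j (h.r l Φ) = h.per i j Φ := by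
  unfold per
  rw [Function.minimalPeriod_eq_minimalPeriod_iff]
  intro n
  have hsc : Function.Semiconj (h.r l) (h.r i ∘ h.r j) (h.r i ∘ h.r j) := by
    intro x
    simp only [Function.comp_apply]
    rw [h.r_comm hj, h.r_comm hi]
  have e1 : (h.r i ∘ h.r j)^[n] (h.r l Φ) = h.r l ((h.r i ∘ h.r j)^[n] Φ) :=
    ((hsc.iterate_right n) Φ).symm
  unfold Function.IsPeriodicPt Function.IsFixedPt
  rw [e1, (h.r_inj l).eq_iff]

theorem Typed.not {h : GP α rk d} {col : Flag α → Bool} (T : h.Typed col) :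
    h.Typed (fun Φ => !col Φ) where
  keep i hi Φ := by rw [T.keep i hi]
  flip i hi Φ := by rw [T.flip i hi]
  same Φ Ψ e := T.same Φ Ψ (by simpa using e)

theorem Typed.even {h : GP α rk d} {col : Flag α → Bool} (T : h.Typed col) {i : ℕ} (hi : i + 2 = d)
    (Φ : Flag α) : Even (h.per i (i + 1) Φ) := by
  have key : ∀ n, ∀ Φ, col ((h.r i ∘ h.r (i + 1))^[n] Φ) = if Even n then col Φ else !col Φ := by
    intro n
    induction n with
    | zero => intro Φ; simp
    | succ n ih =>
      intro Φ
      rw [Function.iterate_succ_apply, ih]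
      simp only [Function.comp_apply]
      rw [T.keep i (by omega), T.flip (i + 1) (by omega)]
      by_cases hn : Even n
      · simp [hn, Nat.even_add_one]
      · simp [hn, Nat.even_add_one]
  have := key (h.per i (i + 1) Φ) Φ
  rw [h.per_spec] at this
  by_contra hc
  rw [if_neg hc] at this
  simp at this

theorem Typed.indep {h : GP α rk d} {col : Flag α → Bool} (T : h.Typed col) {i j : ℕ} (hij : i < j)
    (hj : j < d) (hne : i + 3 ≠ d ∨ j + 2 ≠ d) (Φ Ψ : Flag α) : h.per i j Φ = h.per i j Ψ := by
  by_cases hfar : i + 2 ≤ j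
  · rw [h.per_far hfar hj, h.per_far hfar hj]
  have hs : h.per i j (h.r (d - 1) Φ) = h.per i j Φ := by
    by_cases hd : j + 1 = d
    · rw [show d - 1 = j by omega, per_r_self]
    · exact h.per_r_far i j _ (by omega) (by omega) Φ
  by_cases hc : col Φ = col Ψ
  · exact T.same Φ Ψ hc i j
  · rw [← hs]
    apply T.same
    rw [T.flip (d - 1) (by omega)]
    revert hc
    cases col Φ <;> cases col Ψ <;> simp

theorem class_typed {Λ : Type*} [LinearOrder Λ] {ψ : Flag α → Λ} {h : GP α rk d} (H : h.Height ψ)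
    (h2 : InClass rk d (Set.Iio (d - 1))) :
    ∃ n, d = n + 3 ∧ ∃ col, h.Typed col ∧ ∃ Φ Ψ, col Φ = true ∧ col Ψ = false ∧
      h.per n (n + 1) Φ < h.per n (n + 1) Ψ := by
  obtain ⟨⟨Φ0, Ψ0, hno, hall⟩, hcl⟩ := h2
  have hadj : ∀ i < d, ∀ Φ, SameFlagOrbit Φ (h.r i Φ) ↔ i < d - 1 := fun i hi Φ =>
    hcl Φ (h.r i Φ) i hi (h.adj_r Φ hi)
  set col : Flag α → Bool := fun Φ => decide (SameFlagOrbit Φ Φ0) with hcol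
  have hct : ∀ Φ, col Φ = true ↔ SameFlagOrbit Φ Φ0 := fun Φ => by simp [hcol]
  have hcf : ∀ Φ, col Φ = false ↔ SameFlagOrbit Φ Ψ0 := by
    intro Φ
    rw [← Bool.not_eq_true, hct]
    constructor
    · intro hn
      exact (hall Φ).resolve_left hn
    · intro hs hs'
      exact hno (orbit_trans (orbit_symm hs') hs)
  have T : h.Typed col := by
    refine ⟨?_, ?_, ?_⟩
    · intro i hi Φ
      have h1 := (hadj i (by omega) Φ).2 (by omega)
      rw [Bool.eq_iff_iff, hct, hct]
      exact ⟨fun h' => orbit_trans h1 h', fun h' => orbit_trans (orbit_symm h1) h'⟩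
    · intro i hi Φ
      have h1 : ¬ SameFlagOrbit Φ (h.r i Φ) := fun h' => by
        have := (hadj i (by omega) Φ).1 h'
        omega
      cases hc : col Φ
      · rw [hcf] at hc
        change col (h.r i Φ) = true
        rw [hct]
        exact (hall _).resolve_right fun h' => h1 (orbit_trans hc (orbit_symm h'))
      · rw [hct] at hc
        change col (h.r i Φ) = false
        rw [hcf]
        exact (hall _).resolve_left fun h' => h1 (orbit_trans hc (orbit_symm h'))
    · intro Φ Ψ e i j
      apply h.per_orbit
      cases hc : col Φ
      · have hc' := hc
        rw [e] at hc'
        rw [hcf] at hc hc'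
        exact orbit_trans hc (orbit_symm hc')
      · have hc' := hc
        rw [e] at hc'
        rw [hct] at hc hc'
        exact orbit_trans hc (orbit_symm hc')
  have hreg : ∃ i j, i < j ∧ j < d ∧ ∃ Φ Ψ, h.per i j Φ ≠ h.per i j Ψ := by
    by_contra hc
    push Not at hc
    obtain ⟨γ, hγ⟩ := exists_iso_of_ok H H (fun _ _ => True) (fun _ _ _ _ _ => trivial)
      (fun i j hij hj Φ Ψ _ => hc i j hij hj Φ Ψ) Φ0 Ψ0 trivial
    exact hno ⟨γ, hγ⟩
  obtain ⟨i, j, hij, hj, Φ, Ψ, hne⟩ := hreg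
  have hijd : i + 3 = d ∧ j + 2 = d := by
    by_contra hc
    exact hne (T.indep hij hj (by omega) Φ Ψ)
  obtain ⟨rfl⟩ : j = i + 1 := by omega
  refine ⟨i, hijd.1.symm, ?_⟩
  have hcne : col Φ ≠ col Ψ := fun e => hne (T.same _ _ e _ _)
  have main : ∀ Φ Ψ, col Φ ≠ col Ψ → h.per i (i + 1) Φ < h.per i (i + 1) Ψ →
      ∃ col, h.Typed col ∧ ∃ Φ Ψ, col Φ = true ∧ col Ψ = false ∧
      h.per i (i + 1) Φ < h.per i (i + 1) Ψ := by
    intro Φ Ψ hc hlt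
    cases hc1 : col Φ
    · refine ⟨_, T.not, Φ, Ψ, by simp [hc1], ?_, hlt⟩
      revert hc
      rw [hc1]
      cases col Ψ <;> simp
    · refine ⟨_, T, Φ, Ψ, hc1, ?_, hlt⟩
      revert hc
      rw [hc1]
      cases col Ψ <;> simp
  rcases Nat.lt_or_gt_of_ne hne with hlt | hlt
  · exact main Φ Ψ hcne hlt
  · exact main Ψ Φ (Ne.symm hcne) hlt

end typed
end GP

namespace GP
section cox
variable {rk : α → ℤ} {n : ℕ}

/-- The Coxeter labels. -/
noncomputable def lab (h : GP α rk (n + 3)) (Φt Φf : Flag α) (a b : ℕ) : ℕ :=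
  if b = n + 2 then (if a = n + 1 then h.per (n + 1) (n + 2) Φt / 2 else h.per a (n + 1) Φf)
  else h.per a b Φt

/-- The Coxeter matrix. -/
noncomputable def cmat (h : GP α rk (n + 3)) (Φt Φf : Flag α) (a b : Fin (n + 3)) : ℝ :=
  if a = b then 2 else -(2 * Real.cos (Real.pi / h.lab Φt Φf (min a b : Fin (n + 3)) (max a b : Fin (n + 3))))

theorem cmat_self (h : GP α rk (n + 3)) (Φt Φf : Flag α) (a : Fin (n + 3)) :
    h.cmat Φt Φf a a = 2 := by simp [cmat]

theorem cmat_symm (h : GP α rk (n + 3)) (Φt Φf : Flag α) (a b : Fin (n + 3)) :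
    h.cmat Φt Φf a b = h.cmat Φt Φf b a := by
  simp [cmat, min_comm, max_comm, eq_comm]

theorem cmat_lt (h : GP α rk (n + 3)) (Φt Φf : Flag α) {a b : Fin (n + 3)} (hab : a < b) :
    h.cmat Φt Φf a b = -(2 * Real.cos (Real.pi / h.lab Φt Φf a b)) := by
  rw [cmat, if_neg hab.ne, min_eq_left hab.le, max_eq_right hab.le]

theorem cmat_gt (h : GP α rk (n + 3)) (Φt Φf : Flag α) {a b : Fin (n + 3)} (hab : a < b) :
    h.cmat Φt Φf b a = -(2 * Real.cos (Real.pi / h.lab Φt Φf a b)) := by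
  rw [cmat_symm, cmat_lt h Φt Φf hab]

theorem per_two (h : GP α rk (n + 3)) {i j : ℕ} (hij : i < j) (hj : j < n + 3) (Φ : Flag α) :
    2 ≤ h.per i j Φ := by
  have := h.per_pos i j Φ
  have := h.per_ne_one hij hj Φ
  omega

theorem lab_two {h : GP α rk (n + 3)} {col : Flag α → Bool} (T : h.Typed col) (Φt Φf : Flag α)
    {a b : Fin (n + 3)} (hab : a < b) : 2 ≤ h.lab Φt Φf a b := by
  have h1 : (a : ℕ) < b := hab
  have h2 := b.2
  unfold lab
  split_ifs with hb ha
  · have e := T.even (i := n + 1) (by omega) Φt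
    have h3 := h.per_adj (i := n + 1) (by omega) Φt
    change Even (h.per (n + 1) (n + 2) Φt) at e
    change 3 ≤ h.per (n + 1) (n + 2) Φt at h3
    obtain ⟨k, hk⟩ := e
    omega
  · exact h.per_two (by omega) (by omega) _
  · exact h.per_two h1 h2 _

theorem cmat_off {h : GP α rk (n + 3)} {col : Flag α → Bool} (T : h.Typed col) (Φt Φf : Flag α)
    {a b : Fin (n + 3)} (hab : a ≠ b) : h.cmat Φt Φf a b ≤ 0 := by
  have key : ∀ a b : Fin (n + 3), a < b → h.cmat Φt Φf a b ≤ 0 := by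
    intro a b hab
    rw [cmat_lt h Φt Φf hab]
    have h2 : (2 : ℝ) ≤ h.lab Φt Φf a b := by exact_mod_cast lab_two T Φt Φf hab
    have : 0 ≤ Real.cos (Real.pi / h.lab Φt Φf a b) := by
      apply Real.cos_nonneg_of_neg_pi_div_two_le_of_le
      · have := Real.pi_pos
        have : 0 ≤ Real.pi / h.lab Φt Φf a b := by positivity
        linarith
      · exact div_le_div_of_nonneg_left Real.pi_pos.le (by norm_num) h2
    linarith
  rcases lt_or_gt_of_ne hab with h1 | h1
  · exact key a b h1
  · rw [cmat_symm]; exact key b a h1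

theorem srefl_pow_lab {h : GP α rk (n + 3)} {col : Flag α → Bool} (T : h.Typed col) (Φt Φf : Flag α)
    {a b : Fin (n + 3)} (hab : a < b) :
    (srefl (h.cmat Φt Φf) (h.cmat_self Φt Φf) a * srefl (h.cmat Φt Φf) (h.cmat_self Φt Φf) b) ^
      h.lab Φt Φf a b = 1 ∧
    (srefl (h.cmat Φt Φf) (h.cmat_self Φt Φf) b * srefl (h.cmat Φt Φf) (h.cmat_self Φt Φf) a) ^
      h.lab Φt Φf a b = 1 :=
  ⟨srefl_pow _ _ a b _ (lab_two T Φt Φf hab) (cmat_lt h Φt Φf hab) (cmat_gt h Φt Φf hab),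
    srefl_pow _ _ b a _ (lab_two T Φt Φf hab) (cmat_gt h Φt Φf hab) (cmat_lt h Φt Φf hab)⟩

/-- The node attached to a flag index and a colour. -/
def node (n i : ℕ) (c : Bool) : Fin (n + 3) :=
  if i = n + 1 ∧ c = false then Fin.last (n + 2) else Fin.ofNat (n + 3) i

theorem node_val (n : ℕ) {i : ℕ} (hi : i < n + 2) (c : Bool) :
    ((node n i c : Fin (n + 3)) : ℕ) = if i = n + 1 ∧ c = false then n + 2 else i := by
  unfold node
  split_ifs
  · simp
  · simp [Fin.ofNat]
    omega

/-- The action on pairs. -/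
def pairAct {G : Type*} [Mul G] (s : Fin (n + 3) → G) (i : ℕ) (y : G × Bool) : G × Bool :=
  if i = n + 2 then (y.1, !y.2) else (s (node n i y.2) * y.1, y.2)

theorem pairAct_top {G : Type*} [Mul G] (s : Fin (n + 3) → G) (y : G × Bool) :
    pairAct s (n + 2) y = (y.1, !y.2) := by simp [pairAct]

theorem pairAct_lt {G : Type*} [Mul G] (s : Fin (n + 3) → G) {i : ℕ} (hi : i ≠ n + 2) (y : G × Bool) :
    pairAct s i y = (s (node n i y.2) * y.1, y.2) := by simp [pairAct, hi]

theorem cox_rep_aux {Λ : Type*} [LinearOrder Λ] {ψ : Flag α → Λ} {h : GP α rk (n + 3)} (H : h.Height ψ)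
    {col : Flag α → Bool} (T : h.Typed col) {Φt Φf : Flag α} (ht : col Φt = true)
    (hf : col Φf = false) {G : Type*} [Group G] (s : Fin (n + 3) → G)
    (hsq : ∀ a, s a * s a = 1)
    (hpw : ∀ a b : Fin (n + 3), a < b → (s a * s b) ^ h.lab Φt Φf a b = 1 ∧
      (s b * s a) ^ h.lab Φt Φf a b = 1) :
    ∃ W : Set G, W.Finite ∧ 1 ∈ W ∧ ∀ a, ∀ w ∈ W, s a * w ∈ W := by
  obtain ⟨D, hD0, hDok, hD⟩ := H.dev (pairAct s) (fun Φ y => col Φ = y.2)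
    (by
      intro i hi Φ y hy
      by_cases hn : i = n + 2
      · subst hn
        rw [pairAct_top, T.flip _ rfl, hy]
      · rw [pairAct_lt s hn, T.keep i (by omega), hy])
    (by
      intro i y
      by_cases hn : i = n + 2
      · subst hn
        simp [pairAct_top]
      · simp only [pairAct_lt s hn]
        rw [← mul_assoc, hsq, one_mul])
    (by
      rintro i j hij hj Φ ⟨w, c⟩ hc
      simp only at hc
      change (pairAct s i ∘ pairAct s j)^[h.per i j Φ] (w, c) = (w, c)
      by_cases hjn : j = n + 2
      · subst hjn
        by_cases hin : i = n + 1
        · subst hin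
          have e := T.even (i := n + 1) (by omega) Φ
          have e2 : h.per (n + 1) (n + 2) Φ = h.per (n + 1) (n + 2) Φt :=
            T.indep (by omega) (by omega) (by omega) _ _
          change Even (h.per (n + 1) (n + 2) Φ) at e
          have hlab : h.lab Φt Φf (node n (n + 1) true : Fin (n + 3)) (node n (n + 1) false : Fin (n + 3))
              = h.per (n + 1) (n + 2) Φt / 2 := by
            rw [node_val n (by omega), node_val n (by omega)]
            simp [lab]
          have hlt : node n (n + 1) true < node n (n + 1) false := by
            rw [Fin.lt_def, node_val n (by omega), node_val n (by omega)]
            simp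
          obtain ⟨p1, p2⟩ := hpw _ _ hlt
          rw [hlab] at p1 p2
          obtain ⟨k, hk⟩ := e
          rw [← e2, hk] at p1 p2
          rw [show (k + k) / 2 = k by omega] at p1 p2
          rw [hk, ← two_mul, Function.iterate_mul]
          have step : ∀ w, (pairAct s (n + 1) ∘ pairAct s (n + 2))^[2] (w, c) =
              ((s (node n (n + 1) c) * s (node n (n + 1) (!c))) * w, c) := by
            intro w
            simp only [Function.iterate_succ, Function.iterate_zero, Function.comp_apply, id_eq,
              pairAct_top, pairAct_lt s (show n + 1 ≠ n + 2 by omega), Bool.not_not, mul_assoc]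
          have it : ∀ m, ∀ w, ((pairAct s (n + 1) ∘ pairAct s (n + 2))^[2])^[m] (w, c) =
              ((s (node n (n + 1) c) * s (node n (n + 1) (!c))) ^ m * w, c) := by
            intro m
            induction m with
            | zero => intro w; simp
            | succ m ih =>
              intro w
              rw [Function.iterate_succ_apply, step, ih, pow_succ]
              simp only [mul_assoc]
          rw [it]
          cases c
          · rw [Bool.not_false, p2, one_mul]
          · rw [Bool.not_true, p1, one_mul]
        · rw [h.per_far (by omega) hj]
          have hnode : ∀ c, node n i c = node n i true := by
            intro c
            unfold node
            simp [hin]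
          simp only [Function.iterate_succ, Function.iterate_zero, Function.comp_apply, id_eq,
              pairAct_top, pairAct_lt s (show i ≠ n + 2 by omega), Bool.not_not]
          rw [hnode c, hnode (!c), ← mul_assoc, hsq, one_mul]
      · have hlab : h.lab Φt Φf (node n i c : Fin (n + 3)) (node n j c : Fin (n + 3)) = h.per i j Φ := by
          rw [node_val n (by omega), node_val n (by omega), if_neg (by omega)]
          cases c
          · by_cases hj1 : j = n + 1
            · subst hj1
              rw [if_pos ⟨rfl, rfl⟩, lab, if_pos rfl, if_neg (by omega)]
              exact T.same _ _ (by rw [hf, hc]) _ _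
            · rw [if_neg (by omega), lab, if_neg (by omega)]
              exact T.indep hij (by omega) (by omega) _ _
          · rw [if_neg (by simp), lab, if_neg (by omega)]
            exact T.same _ _ (by rw [ht, hc]) _ _
        have hlt : node n i c < node n j c := by
          rw [Fin.lt_def, node_val n (by omega), node_val n (by omega), if_neg (by omega)]
          split_ifs <;> omega
        obtain ⟨p1, p2⟩ := hpw _ _ hlt
        rw [hlab] at p1 p2
        have it : ∀ m, ∀ w, (pairAct s i ∘ pairAct s j)^[m] (w, c) =
              ((s (node n i c) * s (node n j c)) ^ m * w, c) := by
          intro m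
          induction m with
          | zero => intro w; simp
          | succ m ih =>
            intro w
            rw [Function.iterate_succ_apply, Function.comp_apply, pairAct_lt s (by omega),
              pairAct_lt s (by omega)]
            simp only
            rw [ih, pow_succ]
            simp only [mul_assoc]
        rw [it, p1, one_mul])
    Φt (1, true) ht
  have hfin := h.finite_flag
  refine ⟨Set.range fun Φ => (D Φ).1, Set.finite_range _, ⟨Φt, by simp [hD0]⟩, ?_⟩
  rintro a _ ⟨Φ, rfl⟩
  have hcol : ∀ c, ∃ Ψ, (D Ψ).1 = (D Φ).1 ∧ (D Ψ).2 = c := by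
    intro c
    by_cases hc : (D Φ).2 = c
    · exact ⟨Φ, rfl, hc⟩
    · refine ⟨h.r (n + 2) Φ, ?_, ?_⟩
      · rw [hD _ (by omega), pairAct_top]
      · rw [hD _ (by omega), pairAct_top]
        simp only
        revert hc
        cases (D Φ).2 <;> cases c <;> simp
  have hnode : ∃ i c, i < n + 2 ∧ node n i c = a := by
    by_cases ha : (a : ℕ) = n + 2
    · exact ⟨n + 1, false, by omega, by rw [Fin.ext_iff, node_val n (by omega)]; simp [ha]⟩
    · have := a.2
      exact ⟨a, true, by omega, by rw [Fin.ext_iff, node_val n (by omega)]; simp⟩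
  obtain ⟨i, c, hi, rfl⟩ := hnode
  obtain ⟨Ψ, e1, e2⟩ := hcol c
  refine ⟨h.r i Ψ, ?_⟩
  simp only
  rw [hD _ (by omega), pairAct_lt s (by omega), e1, e2]

theorem cox_rep {Λ : Type*} [LinearOrder Λ] {ψ : Flag α → Λ} {h : GP α rk (n + 3)} (H : h.Height ψ)
    {col : Flag α → Bool} (T : h.Typed col) {Φt Φf : Flag α} (ht : col Φt = true)
    (hf : col Φf = false) :
    ∃ W : Set ((Fin (n + 3) → ℝ) ≃ₗ[ℝ] (Fin (n + 3) → ℝ)), W.Finite ∧ 1 ∈ W ∧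
      ∀ a, ∀ w ∈ W, srefl (h.cmat Φt Φf) (h.cmat_self Φt Φf) a * w ∈ W :=
  cox_rep_aux H T ht hf _ (srefl_sq _ _) (fun _ _ hab => srefl_pow_lab T Φt Φf hab)

theorem cos_ge {m k : ℕ} (hk : 2 ≤ k) (hm : k ≤ m) : Real.cos (Real.pi / k) ≤ Real.cos (Real.pi / m) := by
  have hk' : (2 : ℝ) ≤ k := by exact_mod_cast hk
  have hm' : (k : ℝ) ≤ m := by exact_mod_cast hm
  have := Real.pi_pos
  apply Real.cos_le_cos_of_nonneg_of_le_pi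
  · positivity
  · rw [div_le_iff₀ (by linarith)]
    nlinarith
  · exact div_le_div_of_nonneg_left this.le (by linarith) hm'

theorem cmat3 (h : GP α rk (n + 3)) (Φt Φf : Flag α) {a b : Fin (n + 3)} (hab : a < b)
    (hl : 3 ≤ h.lab Φt Φf a b) : h.cmat Φt Φf a b ≤ -1 := by
  rw [cmat_lt h Φt Φf hab]
  have := cos_ge (by norm_num) hl
  simp only [Nat.cast_ofNat, Real.cos_pi_div_three] at this
  linarith

theorem cmat4 (h : GP α rk (n + 3)) (Φt Φf : Flag α) {a b : Fin (n + 3)} (hab : a < b)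
    (hl : 4 ≤ h.lab Φt Φf a b) : h.cmat Φt Φf a b ≤ -√2 := by
  rw [cmat_lt h Φt Φf hab]
  have := cos_ge (by norm_num) hl
  simp only [Nat.cast_ofNat, Real.cos_pi_div_four] at this
  linarith

theorem cmat6 (h : GP α rk (n + 3)) (Φt Φf : Flag α) {a b : Fin (n + 3)} (hab : a < b)
    (hl : 6 ≤ h.lab Φt Φf a b) : h.cmat Φt Φf a b ≤ -√3 := by
  rw [cmat_lt h Φt Φf hab]
  have := cos_ge (by norm_num) hl
  simp only [Nat.cast_ofNat, Real.cos_pi_div_six] at this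
  linarith

end cox
end GP

namespace GP
section classify
variable {rk : α → ℤ} {n : ℕ}

theorem no_test {Λ : Type*} [LinearOrder Λ] {ψ : Flag α → Λ} {h : GP α rk (n + 3)} (H : h.Height ψ)
    {col : Flag α → Bool} (T : h.Typed col) {Φt Φf : Flag α} (ht : col Φt = true)
    (hf : col Φf = false) (x : Fin (n + 3) → ℝ) (hx : ∀ a, 0 ≤ x a) (hne : x ≠ 0)
    (hneg : ∀ a, x a ≠ 0 → rowF (h.cmat Φt Φf) a x ≤ 0) : False := by
  obtain ⟨W, hW, h1, hcl⟩ := cox_rep H T ht hf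
  exact cox_finite _ (h.cmat_self Φt Φf) (h.cmat_symm Φt Φf) (fun a b hab => cmat_off T Φt Φf hab)
    W hW h1 hcl x hx hne hneg

theorem no_big {Λ : Type*} [LinearOrder Λ] {ψ : Flag α → Λ} {h : GP α rk (n + 3)} (H : h.Height ψ)
    {col : Flag α → Bool} (T : h.Typed col) {Φt Φf : Flag α} (ht : col Φt = true)
    (hf : col Φf = false) (hlt : h.per n (n + 1) Φt < h.per n (n + 1) Φf) : n = 0 := by
  by_contra hn
  obtain ⟨m, rfl⟩ := Nat.exists_eq_succ_of_ne_zero hn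
  have hp := h.per_adj (i := m + 1) (by omega) Φt
  have hq : 4 ≤ h.per (m + 1) (m + 2) Φf := by
    change h.per (m + 1) (m + 2) Φt < h.per (m + 1) (m + 2) Φf at hlt
    change 3 ≤ h.per (m + 1) (m + 2) Φt at hp
    omega
  have ha := h.per_adj (i := m) (by omega) Φt
  set B := h.cmat Φt Φf with hB
  let A : Fin (m.succ + 3) := ⟨m, by omega⟩
  let N : Fin (m.succ + 3) := ⟨m + 1, by omega⟩
  let F : Fin (m.succ + 3) := ⟨m + 2, by omega⟩
  let G : Fin (m.succ + 3) := ⟨m + 3, by omega⟩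
  have hAN : A ≠ N := by simp [A, N]
  have hAF : A ≠ F := by simp [A, F]
  have hAG : A ≠ G := by simp [A, G]
  have hNF : N ≠ F := by simp [N, F]
  have hNG : N ≠ G := by simp [N, G]
  have hFG : F ≠ G := by simp [F, G]
  have b1 : B A N ≤ -1 := h.cmat3 Φt Φf (by simp [A, N, Fin.lt_def]) (by simpa [lab, A, N] using ha)
  have b2 : B N F ≤ -1 := h.cmat3 Φt Φf (by simp [F, N, Fin.lt_def]) (by simpa [lab, F, N] using hp)
  have b3 : B N G ≤ -√2 := h.cmat4 Φt Φf (by simp [G, N, Fin.lt_def]) (by simpa [lab, G, N] using hq)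
  have b1' : B N A ≤ -1 := by rw [hB, h.cmat_symm]; exact b1
  have b2' : B F N ≤ -1 := by rw [hB, h.cmat_symm]; exact b2
  have b3' : B G N ≤ -√2 := by rw [hB, h.cmat_symm]; exact b3
  have hs2 : √2 * √2 = 2 := Real.mul_self_sqrt (by norm_num)
  have hs0 : 0 < √2 := by positivity
  have hself : ∀ a, B a a = 2 := h.cmat_self Φt Φf
  let x : Fin (m.succ + 3) → ℝ := fun a => if a = A then 1 else if a = N then 2 else if a = F then 1
    else if a = G then √2 else 0
  have xA : x A = 1 := by simp [x]
  have xN : x N = 2 := by simp [x, hAN.symm]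
  have xF : x F = 1 := by simp [x, hAF.symm, hNF.symm]
  have xG : x G = √2 := by simp [x, hAG.symm, hNG.symm, hFG.symm]
  have hx : ∀ a, 0 ≤ x a := by
    intro a
    simp only [x]
    split_ifs <;> first | norm_num | exact hs0.le
  have hoff : ∀ a b, a ≠ b → B a b ≤ 0 := fun a b hab => cmat_off T Φt Φf hab
  refine no_test H T ht hf x hx (fun e => ?_) ?_
  · rw [e] at xA
    simp at xA
  · intro a ha0
    have hcases : a = A ∨ a = N ∨ a = F ∨ a = G := by
      by_contra hc
      push Not at hc
      exact ha0 (by simp [x, hc])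
    rcases hcases with rfl | rfl | rfl | rfl
    · refine (rowF_le B hoff x hx A {A, N} (by simp)).trans ?_
      rw [Finset.sum_pair hAN, xA, xN, hself]
      linarith
    · refine (rowF_le B hoff x hx N {A, N, F, G} (by simp)).trans ?_
      rw [Finset.sum_insert (by simp [hAN, hAF, hAG]), Finset.sum_insert (by simp [hNF, hNG]),
        Finset.sum_pair hFG, xA, xN, xF, xG, hself]
      nlinarith
    · refine (rowF_le B hoff x hx F {F, N} (by simp)).trans ?_
      rw [Finset.sum_pair hNF.symm, xF, xN, hself]
      linarith
    · refine (rowF_le B hoff x hx G {G, N} (by simp)).trans ?_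
      rw [Finset.sum_pair hNG.symm, xG, xN, hself]
      linarith

theorem small_case {Λ : Type*} [LinearOrder Λ] {ψ : Flag α → Λ} {h : GP α rk (0 + 3)} (H : h.Height ψ)
    {col : Flag α → Bool} (T : h.Typed col) {Φt Φf : Flag α} (ht : col Φt = true)
    (hf : col Φf = false) (hlt : h.per 0 1 Φt < h.per 0 1 Φf) :
    h.per 0 1 Φt = 3 ∧ (h.per 0 1 Φf = 4 ∨ h.per 0 1 Φf = 5) ∧ h.per 1 2 Φt = 4 := by
  have hp : 3 ≤ h.per 0 1 Φt := h.per_adj (i := 0) (by omega) Φt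
  have hq : 3 ≤ h.per 0 1 Φf := h.per_adj (i := 0) (by omega) Φf
  have hk : 3 ≤ h.per 1 2 Φt := h.per_adj (i := 1) (by omega) Φt
  have hke : Even (h.per 1 2 Φt) := T.even (i := 1) (by omega) Φt
  have l01 : h.lab Φt Φf ((0 : Fin 3) : ℕ) ((1 : Fin 3) : ℕ) = h.per 0 1 Φt := by simp [lab]
  have l02 : h.lab Φt Φf ((0 : Fin 3) : ℕ) ((2 : Fin 3) : ℕ) = h.per 0 1 Φf := by simp [lab]
  have l12 : h.lab Φt Φf ((1 : Fin 3) : ℕ) ((2 : Fin 3) : ℕ) = h.per 1 2 Φt / 2 := by simp [lab]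
  set B : Fin 3 → Fin 3 → ℝ := h.cmat Φt Φf with hB
  have hself : ∀ a, B a a = 2 := h.cmat_self Φt Φf
  have hsym : ∀ a b, B a b = B b a := h.cmat_symm Φt Φf
  have hoff : ∀ a b, a ≠ b → B a b ≤ 0 := fun a b hab => cmat_off T Φt Φf hab
  have s10 := hsym 1 0
  have s20 := hsym 2 0
  have s21 := hsym 2 1
  have o12 := hoff 1 2 (by decide)
  have d0 := hself 0
  have d1 := hself 1
  have d2 := hself 2
  have p3 : B 0 1 ≤ -1 := h.cmat3 Φt Φf (a := (0 : Fin 3)) (b := (1 : Fin 3)) (by decide) (by rw [l01]; exact hp)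
  have q3 : B 0 2 ≤ -1 := h.cmat3 Φt Φf (a := (0 : Fin 3)) (b := (2 : Fin 3)) (by decide) (by rw [l02]; exact hq)
  have hs2 : √2 * √2 = 2 := Real.mul_self_sqrt (by norm_num)
  have hs20 : 0 < √2 := by positivity
  have hs3 : √3 * √3 = 3 := Real.mul_self_sqrt (by norm_num)
  have hs30 : 0 < √3 := by positivity
  have test : ∀ x0 x1 x2 : ℝ, 0 < x0 → 0 < x1 → 0 < x2 →
      2 * x0 + B 0 1 * x1 + B 0 2 * x2 ≤ 0 → B 0 1 * x0 + 2 * x1 + B 1 2 * x2 ≤ 0 →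
      B 0 2 * x0 + B 1 2 * x1 + 2 * x2 ≤ 0 → False := by
    intro x0 x1 x2 h0 h1 h2 e0 e1 e2
    refine no_test H T ht hf ![x0, x1, x2] ?_ ?_ ?_
    · intro a
      fin_cases a
      · exact h0.le
      · exact h1.le
      · exact h2.le
    · intro e
      have := congrFun e 0
      simp at this
      exact h0.ne' this
    · intro a _
      change rowF B a ![x0, x1, x2] ≤ 0
      rw [rowF_apply, Fin.sum_univ_three]
      fin_cases a
      · simpa [d0] using e0
      · simpa [d1, s10] using e1
      · simpa [d2, s20, s21] using e2
  have k4 : h.per 1 2 Φt = 4 := by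
    by_contra hne
    have k3 : B 1 2 ≤ -1 := h.cmat3 Φt Φf (a := (1 : Fin 3)) (b := (2 : Fin 3)) (by decide) (by
      rw [l12]
      obtain ⟨k, hk⟩ := hke
      omega)
    exact test 1 1 1 one_pos one_pos one_pos (by linarith) (by linarith) (by linarith)
  have hp3 : h.per 0 1 Φt = 3 := by
    by_contra hne
    have p4 : B 0 1 ≤ -√2 := h.cmat4 Φt Φf (a := (0 : Fin 3)) (b := (1 : Fin 3)) (by decide) (by rw [l01]; omega)
    have q4 : B 0 2 ≤ -√2 := h.cmat4 Φt Φf (a := (0 : Fin 3)) (b := (2 : Fin 3)) (by decide) (by rw [l02]; omega)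
    exact test (√2) 1 1 hs20 one_pos one_pos (by linarith) (by nlinarith) (by nlinarith)
  refine ⟨hp3, ?_, k4⟩
  by_contra hne
  have q6 : B 0 2 ≤ -√3 := h.cmat6 Φt Φf (a := (0 : Fin 3)) (b := (2 : Fin 3)) (by decide) (by rw [l02]; omega)
  exact test 2 1 (√3) (by norm_num) one_pos hs30 (by nlinarith) (by nlinarith) (by nlinarith)

/-- Rank three, vertex-transitive type with the given face sizes. -/
def IsType (h : GP α rk 3) (q : ℕ) : Prop :=
  ∃ col, h.Typed col ∧ ∃ Φ Ψ, col Φ = true ∧ col Ψ = false ∧ h.per 0 1 Φ = 3 ∧ h.per 0 1 Ψ = q ∧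
    h.per 1 2 Φ = 4

theorem class_type {d : ℕ} {Λ : Type*} [LinearOrder Λ] {ψ : Flag α → Λ} {h : GP α rk d} (H : h.Height ψ)
    (h2 : InClass rk d (Set.Iio (d - 1))) :
    ∃ e : d = 3, IsType (e ▸ h) 4 ∨ IsType (e ▸ h) 5 := by
  obtain ⟨n, rfl, col, T, Φ, Ψ, hΦ, hΨ, hlt⟩ := class_typed H h2
  obtain rfl := no_big H T hΦ hΨ hlt
  obtain ⟨e1, e2, e3⟩ := small_case H T hΦ hΨ hlt
  refine ⟨rfl, ?_⟩
  rcases e2 with e2 | e2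
  · exact Or.inl ⟨col, T, Φ, Ψ, hΦ, hΨ, e1, e2, e3⟩
  · exact Or.inr ⟨col, T, Φ, Ψ, hΦ, hΨ, e1, e2, e3⟩

theorem type_iso {β : Type*} [PartialOrder β] {rk' : β → ℤ} {Λ Λ' : Type*} [LinearOrder Λ]
    [LinearOrder Λ'] {ψ : Flag α → Λ} {ψ' : Flag β → Λ'} {h : GP α rk 3} (H : h.Height ψ)
    {h' : GP β rk' 3} (H' : h'.Height ψ') {q : ℕ} (t : h.IsType q) (t' : h'.IsType q) :
    Nonempty (α ≃o β) := by
  obtain ⟨col, T, Φ, Ψ, c1, c2, e1, e2, e3⟩ := t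
  obtain ⟨col', T', Φ', Ψ', c1', c2', e1', e2', e3'⟩ := t'
  obtain ⟨γ, -⟩ := exists_iso_of_ok H H' (fun Φ Ψ => col Φ = col' Ψ) (by
      intro i hi Ω Ω' e
      by_cases h3 : i + 1 = 3
      · rw [T.flip i h3, T'.flip i h3, e]
      · rw [T.keep i (by omega), T'.keep i (by omega), e]) (by
      intro i j hij hj Ω Ω' e
      obtain ⟨rfl, rfl⟩ | ⟨rfl, rfl⟩ | ⟨rfl, rfl⟩ : (i = 0 ∧ j = 1) ∨ (i = 1 ∧ j = 2) ∨ (i = 0 ∧ j = 2) := by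
        omega
      · cases hc : col Ω
        · rw [T.same Ω Ψ (by rw [hc, c2]), T'.same Ω' Ψ' (by rw [← e, hc, c2']), e2, e2']
        · rw [T.same Ω Φ (by rw [hc, c1]), T'.same Ω' Φ' (by rw [← e, hc, c1']), e1, e1']
      · rw [T.indep (by omega) (by omega) (by omega) Ω Φ, T'.indep (by omega) (by omega) (by omega) Ω' Φ',
          e3, e3']
      · rw [h.per_far (by omega) (by omega), h'.per_far (by omega) (by omega)]) Φ Φ' (by rw [c1, c1'])
  exact ⟨γ⟩

end classify
end GP

namespace GP
section sym
variable {rk : α → ℤ} {d : ℕ}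

theorem eq_r_of_fc (h : GP α rk d) {Φ Ψ : Flag α} {i : ℕ} (hi : i < d)
    (e : ∀ n, n ≠ i + 1 → n ≤ d → h.fc Ψ n = h.fc Φ n) (hne : h.fc Ψ (i + 1) ≠ h.fc Φ (i + 1)) :
    Ψ = h.r i Φ := by
  apply h.flag_ext
  intro j hj
  by_cases hji : j = i
  · subst hji
    refine (h.fc_r_eq Φ Ψ hj (e j (by omega) (by omega)) ?_ hne).symm
    by_cases hjd : j + 2 ≤ d
    · exact e (j + 2) (by omega) hjd
    · have : j + 2 = d + 1 := by omega
      rw [this]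
      exact h.fc_top _ _
  · rw [h.fc_r_ne _ (by omega), e (j + 1) (by omega) (by omega)]

theorem per_dvd_auto (h : GP α rk d) {i j k m : ℕ} {Φ : Flag α} (g : α ≃o α)
    (hg : (h.r i ∘ h.r j)^[k] Φ = Flag.map g Φ) (hm : ∀ x, g^[m] x = x) :
    h.per i j Φ ∣ k * m := by
  apply h.per_dvd
  rw [Function.iterate_mul]
  have hcomm : ∀ Ψ, (h.r i ∘ h.r j)^[k] (Flag.map g Ψ) = Flag.map g ((h.r i ∘ h.r j)^[k] Ψ) := by
    intro Ψ
    have : Function.Commute (Flag.map g) (h.r i ∘ h.r j) := by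
      intro x
      simp only [Function.comp_apply, h.map_r]
    exact ((this.iterate_right k) Ψ).symm
  have it : ∀ m, ((h.r i ∘ h.r j)^[k])^[m] Φ = (Flag.map g)^[m] Φ := by
    intro m
    induction m with
    | zero => rfl
    | succ m ih =>
      rw [Function.iterate_succ_apply', ih, Function.iterate_succ_apply]
      rw [← hg]
      clear ih
      induction m with
      | zero => rfl
      | succ m ih => rw [Function.iterate_succ_apply', hcomm, ih, Function.iterate_succ_apply']
  rw [it]
  have hfc : ∀ m n, n ≤ d + 1 → h.fc ((Flag.map g)^[m] Φ) n = g^[m] (h.fc Φ n) := by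
    intro m
    induction m with
    | zero => intro n _; rfl
    | succ m ih =>
      intro n hn
      rw [Function.iterate_succ_apply', h.fc_map g _ hn, ih n hn, Function.iterate_succ_apply']
  apply h.flag_ext
  intro l hl
  rw [hfc m _ (by omega), hm]

end sym

section sym3
variable {rk : α → ℤ}

/-- The faces of a flag in rank three. -/
def chain3 (b v e t T : α) : ℕ → α
  | 0 => b
  | 1 => v
  | 2 => e
  | 3 => t
  | _ => T

theorem exists_flag3 (h : GP α rk 3) {b v e t T : α} (h1 : b < v) (h2 : v < e) (h3 : e < t)
    (h4 : t < T) : ∃ Φ : Flag α, h.fc Φ 0 = b ∧ h.fc Φ 1 = v ∧ h.fc Φ 2 = e ∧ h.fc Φ 3 = t := by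
  have m1 := h.mono h1
  have m2 := h.mono h2
  have m3 := h.mono h3
  have m4 := h.mono h4
  have l := h.lo b
  have u := h.hi T
  have hf : ∀ n ≤ 3 + 1, rk (chain3 b v e t T n) = (n : ℤ) - 1 := by
    intro n hn
    interval_cases n <;> simp only [chain3] <;> push_cast at * <;> omega
  have hl : ∀ n ≤ 3, chain3 b v e t T n ≤ chain3 b v e t T (n + 1) := by
    intro n hn
    interval_cases n
    · exact h1.le
    · exact h2.le
    · exact h3.le
    · exact h4.le
  refine ⟨h.mkFlag (chain3 b v e t T) hf hl, ?_, ?_, ?_, ?_⟩ <;>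
    rw [h.fc_mkFlag _ _ _ (by omega)] <;> rfl

theorem isType_of_sym {Λ : Type*} [LinearOrder Λ] {ψ : Flag α → Λ} {h : GP α rk 3} (H : h.Height ψ)
    {b v e t s T : α} (h1 : b < v) (h2 : v < e) (h3 : e < t) (h4 : t < T) (h3' : e < s) (h4' : s < T)
    (hst : s ≠ t) (s0 s1 s2 : α ≃o α) (f0e : s0 e = e) (f0t : s0 t = t) (f0s : s0 s = s)
    (m0 : s0 v ≠ v) (f1v : s1 v = v) (f1t : s1 t = t) (m1 : s1 e ≠ e)
    (f2v : s2 v = v) (f2s : s2 s = s) (m2 : s2 e ≠ e) {q : ℕ} (hq : q = 4 ∨ q = 5)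
    (r3 : ∀ x, (s0.trans s1)^[3] x = x) (r2 : ∀ x, (s1.trans s2)^[2] x = x)
    (rq : ∀ x, (s0.trans s2)^[q] x = x) : h.IsType q := by
  obtain ⟨B0, b0, b1, b2, b3⟩ := h.exists_flag3 h1 h2 h3 h4
  obtain ⟨B1, c0, c1, c2, c3⟩ := h.exists_flag3 h1 h2 h3' h4'
  have q2 : B1 = h.r 2 B0 := by
    apply h.eq_r_of_fc (by omega)
    · intro n hn hn'
      interval_cases n
      · rw [b0, c0]
      · rw [b1, c1]
      · rw [b2, c2]
      · omega
    · rw [b3, c3]; exact hst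
  have zz : ∀ (g : α ≃o α) (Φ : Flag α), h.fc (Flag.map g Φ) 0 = h.fc Φ 0 := fun g Φ => h.fc_zero _ _
  have q00 : Flag.map s0 B0 = h.r 0 B0 := by
    apply h.eq_r_of_fc (by omega)
    · intro n hn hn'
      interval_cases n
      · exact zz _ _
      · omega
      · rw [h.fc_map _ _ (by omega), b2, f0e]
      · rw [h.fc_map _ _ (by omega), b3, f0t]
    · rw [h.fc_map _ _ (by omega), b1]; exact m0
  have q01 : Flag.map s0 B1 = h.r 0 B1 := by
    apply h.eq_r_of_fc (by omega)
    · intro n hn hn'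
      interval_cases n
      · exact zz _ _
      · omega
      · rw [h.fc_map _ _ (by omega), c2, f0e]
      · rw [h.fc_map _ _ (by omega), c3, f0s]
    · rw [h.fc_map _ _ (by omega), c1]; exact m0
  have q10 : Flag.map s1 B0 = h.r 1 B0 := by
    apply h.eq_r_of_fc (by omega)
    · intro n hn hn'
      interval_cases n
      · exact zz _ _
      · rw [h.fc_map _ _ (by omega), b1, f1v]
      · omega
      · rw [h.fc_map _ _ (by omega), b3, f1t]
    · rw [h.fc_map _ _ (by omega), b2]; exact m1
  have q11 : Flag.map s2 B1 = h.r 1 B1 := by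
    apply h.eq_r_of_fc (by omega)
    · intro n hn hn'
      interval_cases n
      · exact zz _ _
      · rw [h.fc_map _ _ (by omega), c1, f2v]
      · omega
      · rw [h.fc_map _ _ (by omega), c3, f2s]
    · rw [h.fc_map _ _ (by omega), c2]; exact m2
  have mapmap : ∀ (g g' : α ≃o α) (Φ : Flag α), Flag.map g' (Flag.map g Φ) = Flag.map (g.trans g') Φ := by
    intro g g' Φ
    apply h.flag_ext
    intro i hi
    rw [h.fc_map _ _ (by omega), h.fc_map _ _ (by omega), h.fc_map _ _ (by omega)]
    rfl
  have p0 : h.per 0 1 B0 = 3 := by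
    have hd : h.per 0 1 B0 ∣ 1 * 3 := by
      apply h.per_dvd_auto (s0.trans s1) _ r3
      rw [Function.iterate_one, Function.comp_apply, ← q10, ← h.map_r, ← q00, mapmap]
    have h3 : 3 ≤ h.per 0 1 B0 := h.per_adj (i := 0) (by omega) B0
    have := Nat.le_of_dvd (by omega) hd
    omega
  have p1 : h.per 0 1 B1 = q := by
    have hd : h.per 0 1 B1 ∣ 1 * q := by
      apply h.per_dvd_auto (s0.trans s2) _ rq
      rw [Function.iterate_one, Function.comp_apply, ← q11, ← h.map_r, ← q01, mapmap]
    have h3 : 3 ≤ h.per 0 1 B1 := h.per_adj (i := 0) (by omega) B1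
    have := Nat.le_of_dvd (by omega) hd
    rw [one_mul] at hd
    rcases hq with rfl | rfl
    · interval_cases h.per 0 1 B1 <;> omega
    · interval_cases h.per 0 1 B1 <;> omega
  have p2 : h.per 1 2 B0 = 4 := by
    have hd : h.per 1 2 B0 ∣ 2 * 2 := by
      apply h.per_dvd_auto (s1.trans s2) _ r2
      change h.r 1 (h.r 2 (h.r 1 (h.r 2 B0))) = _
      rw [← q2, ← q11, ← h.map_r, q2, h.r_r, ← h.map_r, ← q10, mapmap]
    have h3 : 3 ≤ h.per 1 2 B0 := h.per_adj (i := 1) (by omega) B0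
    have := Nat.le_of_dvd (by omega) hd
    interval_cases h.per 1 2 B0 <;> omega
  have hno : ¬ SameFlagOrbit B0 B1 := by
    intro hs
    have := h.per_orbit 0 1 hs
    omega
  have o00 : SameFlagOrbit B0 (h.r 0 B0) := orbit_iff.2 ⟨s0, q00⟩
  have o10 : SameFlagOrbit B0 (h.r 1 B0) := orbit_iff.2 ⟨s1, q10⟩
  have o01 : SameFlagOrbit B1 (h.r 0 B1) := orbit_iff.2 ⟨s0, q01⟩
  have o11 : SameFlagOrbit B1 (h.r 1 B1) := orbit_iff.2 ⟨s2, q11⟩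
  have q2' : h.r 2 B1 = B0 := by rw [q2, h.r_r]
  have k0 : ∀ i < 2, ∀ Φ, SameFlagOrbit Φ B0 → SameFlagOrbit (h.r i Φ) B0 := by
    intro i hi Φ hs
    refine orbit_trans (h.orbit_r i hs) (orbit_symm ?_)
    interval_cases i
    · exact o00
    · exact o10
  have k1 : ∀ i < 2, ∀ Φ, SameFlagOrbit Φ B1 → SameFlagOrbit (h.r i Φ) B1 := by
    intro i hi Φ hs
    refine orbit_trans (h.orbit_r i hs) (orbit_symm ?_)
    interval_cases i
    · exact o01
    · exact o11
  have k20 : ∀ Φ, SameFlagOrbit Φ B0 → SameFlagOrbit (h.r 2 Φ) B1 := fun Φ hs => q2 ▸ h.orbit_r 2 hs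
  have k21 : ∀ Φ, SameFlagOrbit Φ B1 → SameFlagOrbit (h.r 2 Φ) B0 := fun Φ hs => by
    have := h.orbit_r 2 hs
    rwa [q2'] at this
  have hall : ∀ Φ, SameFlagOrbit Φ B0 ∨ SameFlagOrbit Φ B1 := by
    intro Φ
    refine H.conn0 (fun Φ => SameFlagOrbit Φ B0 ∨ SameFlagOrbit Φ B1) ?_ B0 Φ (Or.inl (orbit_refl _))
    intro Φ i hi hs
    by_cases h2 : i < 2
    · exact hs.imp (k0 i h2 Φ) (k1 i h2 Φ)
    · obtain rfl : i = 2 := by omega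
      exact hs.symm.imp (k21 Φ) (k20 Φ)
  have hexcl : ∀ Φ, SameFlagOrbit Φ B0 → ¬ SameFlagOrbit Φ B1 := fun Φ a c =>
    hno (orbit_trans (orbit_symm a) c)
  refine ⟨fun Φ => decide (SameFlagOrbit Φ B0), ⟨?_, ?_, ?_⟩, B0, B1, ?_, ?_, p0, p1, p2⟩
  · intro i hi Φ
    simp only [decide_eq_decide]
    refine ⟨fun hs => ?_, k0 i (by omega) Φ⟩
    have := k0 i (by omega) _ hs
    rwa [h.r_r] at this
  · intro i hi Φ
    obtain rfl : i = 2 := by omega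
    rcases hall Φ with hs | hs
    · have : ¬ SameFlagOrbit (h.r 2 Φ) B0 := fun h' => hexcl _ h' (k20 Φ hs)
      simp [hs, this]
    · have : ¬ SameFlagOrbit Φ B0 := fun h' => hexcl _ h' hs
      simp [this, k21 Φ hs]
  · intro Φ Ψ e i j
    apply h.per_orbit
    simp only [decide_eq_decide] at e
    rcases hall Φ with hs | hs
    · exact orbit_trans hs (orbit_symm (e.1 hs))
    · have hn : ¬ SameFlagOrbit Ψ B0 := fun h' => hexcl _ (e.2 h') hs
      exact orbit_trans hs (orbit_symm ((hall Ψ).resolve_left hn))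
  · simpa using orbit_refl B0
  · simpa using fun h' => hno (orbit_symm h')

end sym3
end GP

section conc

theorem exp3 {P : Set (EucSp 3)} (a b c m : ℝ) (hle : ∀ x ∈ P, a * x 0 + b * x 1 + c * x 2 ≤ m) :
    IsExposed ℝ P {x | x ∈ P ∧ a * x 0 + b * x 1 + c * x 2 = m} := by
  rintro ⟨y, hyP, hy⟩
  let l : EucSp 3 →L[ℝ] ℝ := a • EuclideanSpace.proj 0 + b • EuclideanSpace.proj 1
    + c • EuclideanSpace.proj 2
  have hl : ∀ x, l x = a * x 0 + b * x 1 + c * x 2 := fun x => by simp [l]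
  refine ⟨l, ?_⟩
  ext x
  simp only [Set.mem_ofPred_eq, hl]
  constructor
  · rintro ⟨hx, e⟩
    exact ⟨hx, fun z hz => by rw [e]; exact hle z hz⟩
  · rintro ⟨hx, e⟩
    exact ⟨hx, le_antisymm (hle x hx) (by rw [← hy]; exact e y hyP)⟩

theorem exp_image {P : Set (EucSp 3)} (U : EucSp 3 →ₗ[ℝ] EucSp 3) (hU : ∀ x, U (U x) = x)
    (hP : ∀ x ∈ P, U x ∈ P) {F : Set (EucSp 3)} (hF : IsExposed ℝ P F) : IsExposed ℝ P (U '' F) := by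
  rintro ⟨_, y, hy, rfl⟩
  obtain ⟨l, hl⟩ := hF ⟨y, hy⟩
  refine ⟨l.comp (LinearMap.toContinuousLinearMap U), ?_⟩
  ext x
  simp only [Set.mem_image, Set.mem_ofPred_eq, ContinuousLinearMap.comp_apply,
    LinearMap.coe_toContinuousLinearMap']
  constructor
  · rintro ⟨z, hz, rfl⟩
    rw [hl] at hz
    refine ⟨hP _ hz.1, fun w hw => ?_⟩
    rw [hU]
    exact hz.2 _ (hP _ hw)
  · rintro ⟨hx, hm⟩
    refine ⟨U x, ?_, hU x⟩
    rw [hl]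
    refine ⟨hP _ hx, fun w hw => ?_⟩
    have := hm (U w) (hP _ hw)
    rwa [hU] at this

theorem image_invol {U : EucSp 3 →ₗ[ℝ] EucSp 3} (hU : ∀ x, U (U x) = x) (F : Set (EucSp 3)) :
    U '' (U '' F) = F := by
  rw [Set.image_image]
  simp [hU]

/-- The automorphism of the face lattice induced by a linear involution. -/
noncomputable def faceInv {P : Set (EucSp 3)} (U : EucSp 3 →ₗ[ℝ] EucSp 3) (hU : ∀ x, U (U x) = x)
    (hP : ∀ x ∈ P, U x ∈ P) : Faces P ≃o Faces P where
  toFun F := ⟨U '' F.1, exp_image U hU hP F.2⟩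
  invFun F := ⟨U '' F.1, exp_image U hU hP F.2⟩
  left_inv F := Subtype.ext (image_invol hU F.1)
  right_inv F := Subtype.ext (image_invol hU F.1)
  map_rel_iff' := by
    intro F G
    constructor
    · intro h
      have : U '' (U '' F.1) ⊆ U '' (U '' G.1) := Set.image_mono h
      rw [image_invol hU, image_invol hU] at this
      exact this
    · intro h
      exact Set.image_mono (f := U) h

theorem faceInv_val {P : Set (EucSp 3)} (U : EucSp 3 →ₗ[ℝ] EucSp 3) (hU : ∀ x, U (U x) = x)
    (hP : ∀ x ∈ P, U x ∈ P) (F : Faces P) : (faceInv U hU hP F).1 = U '' F.1 := rfl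

theorem faceInv_fix {P : Set (EucSp 3)} (U : EucSp 3 →ₗ[ℝ] EucSp 3) (hU : ∀ x, U (U x) = x)
    (hP : ∀ x ∈ P, U x ∈ P) (F : Faces P) (hF : ∀ x ∈ F.1, U x ∈ F.1) : faceInv U hU hP F = F := by
  apply Subtype.ext
  rw [faceInv_val]
  apply Set.Subset.antisymm
  · rintro _ ⟨x, hx, rfl⟩
    exact hF x hx
  · intro x hx
    exact ⟨U x, hF x hx, hU x⟩

theorem faceInv_move {P : Set (EucSp 3)} (U : EucSp 3 →ₗ[ℝ] EucSp 3) (hU : ∀ x, U (U x) = x)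
    (hP : ∀ x ∈ P, U x ∈ P) (F : Faces P) {x : EucSp 3} (hx : x ∈ F.1) (hF : U x ∉ F.1) :
    faceInv U hU hP F ≠ F := by
  intro h
  apply hF
  have : U x ∈ (faceInv U hU hP F).1 := ⟨x, hx, rfl⟩
  rwa [h] at this

theorem faceInv_iter {P : Set (EucSp 3)} (U W : EucSp 3 →ₗ[ℝ] EucSp 3) (hU : ∀ x, U (U x) = x)
    (hP : ∀ x ∈ P, U x ∈ P) (hW : ∀ x, W (W x) = x)
    (hP' : ∀ x ∈ P, W x ∈ P) {n : ℕ} (hn : ∀ x, (fun x => W (U x))^[n] x = x) (F : Faces P) :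
    ((faceInv U hU hP).trans (faceInv W hW hP'))^[n] F = F := by
  have key : ∀ n, (((faceInv U hU hP).trans (faceInv W hW hP'))^[n] F).1
      = ((fun x => W (U x))^[n]) '' F.1 := by
    intro n
    induction n with
    | zero => simp
    | succ n ih =>
      rw [Function.iterate_succ_apply', Function.iterate_succ', Set.image_comp, ← ih]
      simp only [OrderIso.trans_apply, faceInv_val, Set.image_image]
  apply Subtype.ext
  rw [key]
  have : (fun x => W (U x))^[n] = id := funext hn
  rw [this, Set.image_id]

theorem conc_type {P : Set (EucSp 3)} {ψ : Flag (Faces P) → Lex (Fin 3 → ℝ)}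
    {h : GP (Faces P) faceRank 3} (H : h.Height ψ)
    {v e t s : Set (EucSp 3)} (xv : IsExposed ℝ P v) (xe : IsExposed ℝ P e)
    (xt : IsExposed ℝ P t) (xs : IsExposed ℝ P s)
    {v0 w pt ps : EucSp 3} (hv0 : v0 ∈ v) (hwe : w ∈ e) (hwv : w ∉ v) (hpt : pt ∈ t) (hpte : pt ∉ e)
    (hpts : pt ∉ s) (hps : ps ∈ s) (hpse : ps ∉ e) (hpst : ps ∉ t)
    (hve : v ⊆ e) (het : e ⊆ t) (hes : e ⊆ s)
    (U0 U1 U2 : EucSp 3 →ₗ[ℝ] EucSp 3)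
    (i0 : ∀ x, U0 (U0 x) = x) (i1 : ∀ x, U1 (U1 x) = x) (i2 : ∀ x, U2 (U2 x) = x)
    (p0 : ∀ x ∈ P, U0 x ∈ P) (p1 : ∀ x ∈ P, U1 x ∈ P) (p2 : ∀ x ∈ P, U2 x ∈ P)
    (a0e : ∀ x ∈ e, U0 x ∈ e) (a0t : ∀ x ∈ t, U0 x ∈ t) (a0s : ∀ x ∈ s, U0 x ∈ s) (m0 : U0 v0 ∉ v)
    (a1v : ∀ x ∈ v, U1 x ∈ v) (a1t : ∀ x ∈ t, U1 x ∈ t) (m1 : U1 w ∉ e)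
    (a2v : ∀ x ∈ v, U2 x ∈ v) (a2s : ∀ x ∈ s, U2 x ∈ s) (m2 : U2 w ∉ e)
    {q : ℕ} (hq : q = 4 ∨ q = 5)
    (r3 : ∀ x, (fun x => U1 (U0 x))^[3] x = x)
    (r2 : ∀ x, (fun x => U2 (U1 x))^[2] x = x)
    (rq : ∀ x, (fun x => U2 (U0 x))^[q] x = x) : h.IsType q := by
  have lt_of : ∀ {F G : Faces P}, F.1 ⊆ G.1 → ∀ {x}, x ∈ G.1 → x ∉ F.1 → F < G := by
    intro F G hFG x hx hx'
    refine lt_of_le_of_ne hFG ?_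
    rintro rfl
    exact hx' hx
  let V : Faces P := ⟨v, xv⟩
  let E : Faces P := ⟨e, xe⟩
  let T : Faces P := ⟨t, xt⟩
  let S : Faces P := ⟨s, xs⟩
  let B : Faces P := ⟨∅, isExposed_empty⟩
  let A : Faces P := ⟨P, IsExposed.refl P⟩
  have hBV : B < V := lt_of (F := B) (G := V) (Set.empty_subset _) hv0 (Set.notMem_empty _)
  have hVE : V < E := lt_of (F := V) (G := E) hve hwe hwv
  have hET : E < T := lt_of (F := E) (G := T) het hpt hpte
  have hES : E < S := lt_of (F := E) (G := S) hes hps hpse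
  have hTA : T < A := lt_of (F := T) (G := A) xt.subset (xs.subset hps) hpst
  have hSA : S < A := lt_of (F := S) (G := A) xs.subset (xt.subset hpt) hpts
  have hST : S ≠ T := by
    intro hh
    have : pt ∈ S.1 := by rw [hh]; exact hpt
    exact hpts this
  exact GP.isType_of_sym H hBV hVE hET hTA hES hSA hST
    (faceInv U0 i0 p0) (faceInv U1 i1 p1) (faceInv U2 i2 p2)
    (faceInv_fix U0 i0 p0 E a0e) (faceInv_fix U0 i0 p0 T a0t) (faceInv_fix U0 i0 p0 S a0s)
    (faceInv_move U0 i0 p0 V hv0 m0)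
    (faceInv_fix U1 i1 p1 V a1v) (faceInv_fix U1 i1 p1 T a1t) (faceInv_move U1 i1 p1 E hwe m1)
    (faceInv_fix U2 i2 p2 V a2v) (faceInv_fix U2 i2 p2 S a2s) (faceInv_move U2 i2 p2 E hwe m2)
    hq (faceInv_iter U0 U1 i0 p0 i1 p1 r3) (faceInv_iter U1 U2 i1 p1 i2 p2 r2)
    (faceInv_iter U0 U2 i0 p0 i2 p2 rq)

@[simp] theorem pt3_0 (a b c : ℝ) : pt3 a b c 0 = a := rfl
@[simp] theorem pt3_1 (a b c : ℝ) : pt3 a b c 1 = b := rfl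
@[simp] theorem pt3_2 (a b c : ℝ) : pt3 a b c 2 = c := rfl

theorem ext3 {x y : EucSp 3} (h0 : x 0 = y 0) (h1 : x 1 = y 1) (h2 : x 2 = y 2) : x = y := by
  ext i
  fin_cases i
  · exact h0
  · exact h1
  · exact h2

/-- The linear map with the given matrix. -/
noncomputable def lin3 (a b c a' b' c' a'' b'' c'' : ℝ) : EucSp 3 →ₗ[ℝ] EucSp 3 where
  toFun x := pt3 (a * x 0 + b * x 1 + c * x 2) (a' * x 0 + b' * x 1 + c' * x 2)
    (a'' * x 0 + b'' * x 1 + c'' * x 2)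
  map_add' x y := by
    apply ext3 <;> simp <;> ring
  map_smul' m x := by
    apply ext3 <;> simp <;> ring

@[simp] theorem lin3_apply (a b c a' b' c' a'' b'' c'' : ℝ) (x : EucSp 3) :
    lin3 a b c a' b' c' a'' b'' c'' x = pt3 (a * x 0 + b * x 1 + c * x 2)
      (a' * x 0 + b' * x 1 + c' * x 2) (a'' * x 0 + b'' * x 1 + c'' * x 2) := rfl

theorem hull_map {V : Set (EucSp 3)} (U : EucSp 3 →ₗ[ℝ] EucSp 3) (h : ∀ x ∈ V, U x ∈ V) :
    ∀ x ∈ convexHull ℝ V, U x ∈ convexHull ℝ V := by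
  intro x hx
  have : U x ∈ U '' convexHull ℝ V := ⟨x, hx, rfl⟩
  rw [U.image_convexHull] at this
  refine convexHull_mono ?_ this
  rintro _ ⟨y, hy, rfl⟩
  exact h y hy

theorem hull_le {V : Set (EucSp 3)} (a b c m : ℝ) (h : ∀ x ∈ V, a * x 0 + b * x 1 + c * x 2 ≤ m) :
    ∀ x ∈ convexHull ℝ V, a * x 0 + b * x 1 + c * x 2 ≤ m := by
  have hc : Convex ℝ {x : EucSp 3 | a * x 0 + b * x 1 + c * x 2 ≤ m} := by
    intro x hx y hy p q hp hq hpq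
    simp only [Set.mem_ofPred_eq, PiLp.add_apply, PiLp.smul_apply, smul_eq_mul] at *
    have : m = p * m + q * m := by rw [← add_mul, hpq, one_mul]
    nlinarith [mul_le_mul_of_nonneg_left hx hp, mul_le_mul_of_nonneg_left hy hq]
  intro x hx
  exact convexHull_min (fun y hy => h y hy) hc hx

theorem hull_interior {V : Set (EucSp 3)}
    (h : ∀ ε : ℝ, (ε = 1 ∨ ε = -1) → pt3 ε 0 0 ∈ convexHull ℝ V ∧ pt3 0 ε 0 ∈ convexHull ℝ V ∧
      pt3 0 0 ε ∈ convexHull ℝ V) : (interior (convexHull ℝ V)).Nonempty := by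
  have hc := convex_convexHull ℝ V
  obtain ⟨a0, a1, a2⟩ := h 1 (Or.inl rfl)
  obtain ⟨b0, b1, b2⟩ := h (-1) (Or.inr rfl)
  have seg : ∀ {x y z : EucSp 3} (r : ℝ), x ∈ convexHull ℝ V → y ∈ convexHull ℝ V → |r| ≤ 1 →
      z = ((1 + r) / 2) • x + ((1 - r) / 2) • y → z ∈ convexHull ℝ V := by
    intro x y z r hx hy hr hz
    rw [abs_le] at hr
    rw [hz]
    exact hc hx hy (by linarith) (by linarith) (by ring)
  refine ⟨0, ?_⟩
  rw [mem_interior_iff_mem_nhds, Metric.mem_nhds_iff]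
  refine ⟨1 / 3, by norm_num, fun x hx => ?_⟩
  rw [mem_ball_zero_iff] at hx
  have hb : ∀ i, |3 * x i| ≤ 1 := by
    intro i
    have := PiLp.norm_apply_le x i
    rw [Real.norm_eq_abs] at this
    rw [abs_mul, abs_of_pos (by norm_num : (0 : ℝ) < 3)]
    linarith
  have c0 : pt3 (3 * x 0) 0 0 ∈ convexHull ℝ V := by
    refine seg (3 * x 0) a0 b0 (hb 0) (ext3 ?_ ?_ ?_) <;> simp <;> ring
  have c1 : pt3 0 (3 * x 1) 0 ∈ convexHull ℝ V := by
    refine seg (3 * x 1) a1 b1 (hb 1) (ext3 ?_ ?_ ?_) <;> simp <;> ring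
  have c2 : pt3 0 0 (3 * x 2) ∈ convexHull ℝ V := by
    refine seg (3 * x 2) a2 b2 (hb 2) (ext3 ?_ ?_ ?_) <;> simp <;> ring
  have c3 := hc c0 c1 (a := 1 / 2) (b := 1 / 2) (by norm_num) (by norm_num) (by norm_num)
  have c4 := hc c3 c2 (a := 2 / 3) (b := 1 / 3) (by norm_num) (by norm_num) (by norm_num)
  convert c4 using 1
  apply ext3 <;> simp <;> ring

theorem fin_verts {V : Set (EucSp 3)} (C : Set ℝ) (hC : C.Finite)
    (h : ∀ x ∈ V, x 0 ∈ C ∧ x 1 ∈ C ∧ x 2 ∈ C) : V.Finite := by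
  refine ((hC.prod (hC.prod hC)).image (fun p : ℝ × ℝ × ℝ => pt3 p.1 p.2.1 p.2.2)).subset ?_
  intro x hx
  exact ⟨(x 0, x 1, x 2), h x hx, ext3 rfl rfl rfl⟩

theorem conc_poly {V : Set (EucSp 3)} (C : Set ℝ) (hC : C.Finite)
    (hV : ∀ x ∈ V, x 0 ∈ C ∧ x 1 ∈ C ∧ x 2 ∈ C)
    (h : ∀ ε : ℝ, (ε = 1 ∨ ε = -1) → pt3 ε 0 0 ∈ convexHull ℝ V ∧ pt3 0 ε 0 ∈ convexHull ℝ V ∧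
      pt3 0 0 ε ∈ convexHull ℝ V) : IsConvexPolytope (convexHull ℝ V) :=
  ⟨⟨(fin_verts C hC hV).toFinset, by simp⟩, hull_interior h⟩

end conc

section cubo

theorem cubo_mem {ε δ : ℝ} (h : ε = 1 ∨ ε = -1) (h' : δ = 1 ∨ δ = -1) :
    pt3 ε δ 0 ∈ cuboctaVerts ∧ pt3 ε 0 δ ∈ cuboctaVerts ∧ pt3 0 ε δ ∈ cuboctaVerts :=
  ⟨⟨ε, δ, h, h', Or.inl rfl⟩, ⟨ε, δ, h, h', Or.inr (Or.inl rfl)⟩, ⟨ε, δ, h, h', Or.inr (Or.inr rfl)⟩⟩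

theorem cubo_poly : IsConvexPolytope Cuboctahedron := by
  refine conc_poly {0, 1, -1} (by simp) ?_ ?_
  · rintro x ⟨ε, δ, he, hd, rfl | rfl | rfl⟩ <;> simp [he, hd]
  · intro ε he
    have hc := convex_convexHull ℝ cuboctaVerts
    have mid : ∀ {x y z : EucSp 3}, x ∈ cuboctaVerts → y ∈ cuboctaVerts →
        z = (1 / 2 : ℝ) • x + (1 / 2 : ℝ) • y → z ∈ convexHull ℝ cuboctaVerts := by
      intro x y z hx hy hz
      rw [hz]
      exact hc (subset_convexHull ℝ _ hx) (subset_convexHull ℝ _ hy) (by norm_num) (by norm_num)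
        (by norm_num)
    have m1 := cubo_mem he (Or.inl rfl : (1 : ℝ) = 1 ∨ (1 : ℝ) = -1)
    have m2 := cubo_mem he (Or.inr rfl : (-1 : ℝ) = 1 ∨ (-1 : ℝ) = -1)
    have m3 := cubo_mem (Or.inl rfl : (1 : ℝ) = 1 ∨ (1 : ℝ) = -1) he
    have m4 := cubo_mem (Or.inr rfl : (-1 : ℝ) = 1 ∨ (-1 : ℝ) = -1) he
    refine ⟨mid m1.1 m2.1 (ext3 ?_ ?_ ?_), mid m3.1 m4.1 (ext3 ?_ ?_ ?_),
      mid m3.2.1 m4.2.1 (ext3 ?_ ?_ ?_)⟩ <;> simp <;> ring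

theorem cubo_le (a b c m : ℝ) (h1 : |a| + |b| ≤ m) (h2 : |a| + |c| ≤ m) (h3 : |b| + |c| ≤ m) :
    ∀ x ∈ Cuboctahedron, a * x 0 + b * x 1 + c * x 2 ≤ m := by
  apply hull_le
  have ha := le_abs_self a
  have ha' := neg_abs_le a
  have hb := le_abs_self b
  have hb' := neg_abs_le b
  have hc := le_abs_self c
  have hc' := neg_abs_le c
  rintro x ⟨ε, δ, rfl | rfl, rfl | rfl, rfl | rfl | rfl⟩ <;> simp <;> linarith

theorem cubo_type {ψ : Flag (Faces Cuboctahedron) → Lex (Fin 3 → ℝ)}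
    {h : GP (Faces Cuboctahedron) faceRank 3} (H : h.Height ψ) : h.IsType 4 := by
  have pone : (1 : ℝ) = 1 ∨ (1 : ℝ) = -1 := Or.inl rfl
  have mone : (-1 : ℝ) = 1 ∨ (-1 : ℝ) = -1 := Or.inr rfl
  have sub : ∀ {x}, x ∈ cuboctaVerts → x ∈ Cuboctahedron := fun hx => subset_convexHull ℝ _ hx
  have q1 := cubo_le 1 0 0 1 (by norm_num) (by norm_num) (by norm_num)
  have q2 := cubo_le 0 1 0 1 (by norm_num) (by norm_num) (by norm_num)
  have q3 := cubo_le 1 1 1 2 (by norm_num) (by norm_num) (by norm_num)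
  have q4 := cubo_le 1 1 (-1) 2 (by norm_num) (by norm_num) (by norm_num)
  have p0 : ∀ x ∈ Cuboctahedron, lin3 1 0 0 0 0 1 0 1 0 x ∈ Cuboctahedron := by
    apply hull_map
    rintro x ⟨ε, δ, he, hd, rfl | rfl | rfl⟩
    · simpa using (cubo_mem he hd).2.1
    · simpa using (cubo_mem he hd).1
    · simpa using (cubo_mem hd he).2.2
  have p1 : ∀ x ∈ Cuboctahedron, lin3 0 1 0 1 0 0 0 0 1 x ∈ Cuboctahedron := by
    apply hull_map
    rintro x ⟨ε, δ, he, hd, rfl | rfl | rfl⟩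
    · simpa using (cubo_mem hd he).1
    · simpa using (cubo_mem he hd).2.2
    · simpa using (cubo_mem he hd).2.1
  have p2 : ∀ x ∈ Cuboctahedron, lin3 1 0 0 0 1 0 0 0 (-1) x ∈ Cuboctahedron := by
    apply hull_map
    rintro x ⟨ε, δ, he, hd, rfl | rfl | rfl⟩
    · simpa using (cubo_mem he hd).1
    · have hd' : -δ = 1 ∨ -δ = -1 := by rcases hd with rfl | rfl <;> simp
      simpa using (cubo_mem he hd').2.1
    · have hd' : -δ = 1 ∨ -δ = -1 := by rcases hd with rfl | rfl <;> simp
      simpa using (cubo_mem he hd').2.2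
  refine conc_type H (exp3 1 1 0 2 (cubo_le _ _ _ _ ?_ ?_ ?_)) (exp3 2 1 1 3 (cubo_le _ _ _ _ ?_ ?_ ?_))
    (exp3 1 1 1 2 q3) (exp3 1 0 0 1 q1)
    (v0 := pt3 1 1 0) (w := pt3 1 0 1) (pt := pt3 0 1 1) (ps := pt3 1 0 (-1))
    ⟨sub (cubo_mem pone pone).1, ?_⟩ ⟨sub (cubo_mem pone pone).2.1, ?_⟩ ?_
    ⟨sub (cubo_mem pone pone).2.2, ?_⟩ ?_ ?_ ⟨sub (cubo_mem pone mone).2.1, ?_⟩ ?_ ?_ ?_ ?_ ?_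
    (lin3 1 0 0 0 0 1 0 1 0) (lin3 0 1 0 1 0 0 0 0 1) (lin3 1 0 0 0 1 0 0 0 (-1))
    ?_ ?_ ?_ p0 p1 p2
    (fun x hx => ⟨p0 x hx.1, ?_⟩) (fun x hx => ⟨p0 x hx.1, ?_⟩) (fun x hx => ⟨p0 x hx.1, ?_⟩) ?_
    (fun x hx => ⟨p1 x hx.1, ?_⟩) (fun x hx => ⟨p1 x hx.1, ?_⟩) ?_
    (fun x hx => ⟨p2 x hx.1, ?_⟩) (fun x hx => ⟨p2 x hx.1, ?_⟩) ?_ (Or.inl rfl) ?_ ?_ ?_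
  case refine_16 | refine_17 | refine_18 =>
    rintro x ⟨hx, e⟩
    have := q1 x hx
    have := q2 x hx
    have := q3 x hx
    have := q4 x hx
    exact ⟨hx, by linarith⟩
  case refine_19 | refine_20 | refine_21 | refine_32 | refine_33 | refine_34 =>
    intro x
    apply ext3 <;> simp [Function.iterate_succ_apply']
  case refine_22 | refine_23 | refine_24 | refine_26 | refine_27 | refine_29 | refine_30 =>
    have := hx.2
    simp at this ⊢
    linarith
  all_goals first | (simp; done) | (norm_num; done) | (rintro ⟨_, e⟩; norm_num at e)
end cubo

section ico

theorem golden_sq : goldenφ ^ 2 = goldenφ + 1 := by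
  have := Real.sq_sqrt (show (0 : ℝ) ≤ 5 by norm_num)
  unfold goldenφ
  linarith

theorem golden_gt : 1.6 < goldenφ := by
  have : (2.2 : ℝ) < Real.sqrt 5 := Real.lt_sqrt_of_sq_lt (by norm_num)
  unfold goldenφ
  linarith

theorem golden_lt : goldenφ < 1.7 := by
  have : Real.sqrt 5 < 2.4 := by
    rw [Real.sqrt_lt' (by norm_num)]
    norm_num
  unfold goldenφ
  linarith

theorem sp : (1 : ℝ) = 1 ∨ (1 : ℝ) = -1 := Or.inl rfl
theorem sm : (-1 : ℝ) = 1 ∨ (-1 : ℝ) = -1 := Or.inr rfl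
theorem sneg {ε : ℝ} (h : ε = 1 ∨ ε = -1) : -ε = 1 ∨ -ε = -1 := by rcases h with rfl | rfl <;> simp

theorem ico_a {ε : ℝ} (h : ε = 1 ∨ ε = -1) : pt3 0 0 (ε * goldenφ) ∈ icosidodecaVerts ∧
    pt3 (ε * goldenφ) 0 0 ∈ icosidodecaVerts ∧ pt3 0 (ε * goldenφ) 0 ∈ icosidodecaVerts :=
  ⟨Or.inl ⟨ε, h, Or.inl rfl⟩, Or.inl ⟨ε, h, Or.inr (Or.inl rfl)⟩, Or.inl ⟨ε, h, Or.inr (Or.inr rfl)⟩⟩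

theorem ico_b {a b c : ℝ} (ha : a = 1 ∨ a = -1) (hb : b = 1 ∨ b = -1) (hc : c = 1 ∨ c = -1) :
    pt3 (a / 2) (b * goldenφ / 2) (c * goldenφ ^ 2 / 2) ∈ icosidodecaVerts ∧
    pt3 (c * goldenφ ^ 2 / 2) (a / 2) (b * goldenφ / 2) ∈ icosidodecaVerts ∧
    pt3 (b * goldenφ / 2) (c * goldenφ ^ 2 / 2) (a / 2) ∈ icosidodecaVerts :=
  ⟨Or.inr ⟨a, b, c, ha, hb, hc, Or.inl rfl⟩, Or.inr ⟨a, b, c, ha, hb, hc, Or.inr (Or.inl rfl)⟩,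
    Or.inr ⟨a, b, c, ha, hb, hc, Or.inr (Or.inr rfl)⟩⟩

theorem mem3 {V : Set (EucSp 3)} {x y : EucSp 3} (hy : y ∈ V) (h0 : x 0 = y 0) (h1 : x 1 = y 1)
    (h2 : x 2 = y 2) : x ∈ V := by
  rw [ext3 h0 h1 h2]
  exact hy

theorem ico_poly : IsConvexPolytope Icosidodecahedron := by
  refine conc_poly {0, goldenφ, -goldenφ, 1 / 2, -1 / 2, goldenφ / 2, -goldenφ / 2, goldenφ ^ 2 / 2,
    -goldenφ ^ 2 / 2} (by simp) ?_ ?_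
  · rintro x (⟨ε, rfl | rfl, rfl | rfl | rfl⟩ |
      ⟨a, b, c, rfl | rfl, rfl | rfl, rfl | rfl, rfl | rfl | rfl⟩) <;> simp
  · intro ε he
    have hc := convex_convexHull ℝ icosidodecaVerts
    have g1 := golden_gt
    have hg := golden_sq
    have mid : ∀ {x y z : EucSp 3}, x ∈ icosidodecaVerts → y ∈ icosidodecaVerts →
        z = (goldenφ / 2 : ℝ) • x + (1 - goldenφ / 2 : ℝ) • y → z ∈ convexHull ℝ icosidodecaVerts := by
      intro x y z hx hy hz
      rw [hz]
      exact hc (subset_convexHull ℝ _ hx) (subset_convexHull ℝ _ hy) (by linarith)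
        (by linarith [golden_lt]) (by ring)
    have m1 := ico_a he
    have m2 := ico_a (sneg he)
    refine ⟨mid m1.2.1 m2.2.1 (ext3 ?_ ?_ ?_), mid m1.2.2 m2.2.2 (ext3 ?_ ?_ ?_),
      mid m1.1 m2.1 (ext3 ?_ ?_ ?_)⟩ <;> simp <;> linear_combination (-ε) * hg

theorem ico_le_s : ∀ x ∈ Icosidodecahedron, 1 * x 0 + 0 * x 1 + goldenφ * x 2 ≤ goldenφ + 1 := by
  apply hull_le
  have g1 := golden_gt
  have hg := golden_sq
  have hg3 : goldenφ ^ 3 = 2 * goldenφ + 1 := by linear_combination (goldenφ + 1) * hg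
  rintro x (⟨ε, rfl | rfl, rfl | rfl | rfl⟩ |
      ⟨a, b, c, rfl | rfl, rfl | rfl, rfl | rfl, rfl | rfl | rfl⟩) <;>
    simp only [pt3_0, pt3_1, pt3_2] <;> linarith

theorem ico_le_t : ∀ x ∈ Icosidodecahedron,
    0 * x 0 + 1 * x 1 + (goldenφ + 1) * x 2 ≤ 2 * goldenφ + 1 := by
  apply hull_le
  have g1 := golden_gt
  have hg := golden_sq
  have hg3 : goldenφ ^ 3 = 2 * goldenφ + 1 := by linear_combination (goldenφ + 1) * hg
  rintro x (⟨ε, rfl | rfl, rfl | rfl | rfl⟩ |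
      ⟨a, b, c, rfl | rfl, rfl | rfl, rfl | rfl, rfl | rfl | rfl⟩) <;>
    simp only [pt3_0, pt3_1, pt3_2] <;> linarith

theorem ico_le_v : ∀ x ∈ Icosidodecahedron, 0 * x 0 + 0 * x 1 + 1 * x 2 ≤ goldenφ := by
  apply hull_le
  have g1 := golden_gt
  have hg := golden_sq
  rintro x (⟨ε, rfl | rfl, rfl | rfl | rfl⟩ |
      ⟨a, b, c, rfl | rfl, rfl | rfl, rfl | rfl, rfl | rfl | rfl⟩) <;>
    simp only [pt3_0, pt3_1, pt3_2] <;> linarith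

/-- The reflection exchanging two adjacent vertices. -/
noncomputable def icoU : EucSp 3 →ₗ[ℝ] EucSp 3 :=
  lin3 (1 / 2) (-goldenφ / 2) ((goldenφ - 1) / 2) (-goldenφ / 2) ((1 - goldenφ) / 2) (1 / 2)
    ((goldenφ - 1) / 2) (1 / 2) (goldenφ / 2)

set_option maxHeartbeats 2000000 in
theorem ico_p0 : ∀ x ∈ Icosidodecahedron, icoU x ∈ Icosidodecahedron := by
  apply hull_map
  have hg := golden_sq
  have fin : ∀ {x y : EucSp 3}, y ∈ icosidodecaVerts →
      (icoU x 0 = y 0 ∧ icoU x 1 = y 1 ∧ icoU x 2 = y 2) → icoU x ∈ icosidodecaVerts :=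
    fun hy h => mem3 hy h.1 h.2.1 h.2.2
  rintro x (⟨ε, rfl | rfl, rfl | rfl | rfl⟩ |
      ⟨a, b, c, rfl | rfl, rfl | rfl, rfl | rfl, rfl | rfl | rfl⟩) <;>
    [
    refine fin (ico_b sp sp sp).1 ?_;
    refine fin (ico_b sp sp sm).2.2 ?_;
    refine fin (ico_b sm sp sm).2.1 ?_;
    refine fin (ico_b sm sm sm).1 ?_;
    refine fin (ico_b sm sm sp).2.2 ?_;
    refine fin (ico_b sp sm sp).2.1 ?_;
    refine fin (ico_a sp).1 ?_;
    refine fin (ico_b sp sm sp).1 ?_;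
    refine fin (ico_b sm sm sp).1 ?_;
    refine fin (ico_b sm sm sm).2.2 ?_;
    refine fin (ico_b sp sm sp).2.2 ?_;
    refine fin (ico_a sp).2.1 ?_;
    refine fin (ico_b sp sp sp).2.1 ?_;
    refine fin (ico_a sm).2.2 ?_;
    refine fin (ico_b sp sp sm).2.1 ?_;
    refine fin (ico_b sp sm sm).1 ?_;
    refine fin (ico_b sp sm sm).2.1 ?_;
    refine fin (ico_b sm sp sp).2.2 ?_;
    refine fin (ico_b sm sp sp).1 ?_;
    refine fin (ico_b sm sp sp).2.1 ?_;
    refine fin (ico_b sp sm sm).2.2 ?_;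
    refine fin (ico_b sm sm sm).2.1 ?_;
    refine fin (ico_a sp).2.2 ?_;
    refine fin (ico_b sm sm sp).2.1 ?_;
    refine fin (ico_b sp sp sp).2.2 ?_;
    refine fin (ico_b sm sp sm).2.2 ?_;
    refine fin (ico_a sm).2.1 ?_;
    refine fin (ico_a sm).1 ?_;
    refine fin (ico_b sm sp sm).1 ?_;
    refine fin (ico_b sp sp sm).1 ?_]
  all_goals
    simp only [icoU, lin3_apply, pt3_0, pt3_1, pt3_2]
    refine ⟨?_, ?_, ?_⟩ <;> grind

theorem ico_p1 : ∀ x ∈ Icosidodecahedron, lin3 (-1) 0 0 0 1 0 0 0 1 x ∈ Icosidodecahedron := by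
  apply hull_map
  rintro x (⟨ε, he, rfl | rfl | rfl⟩ | ⟨a, b, c, ha, hb, hc, rfl | rfl | rfl⟩)
  · exact mem3 (ico_a he).1 (by simp) (by simp) (by simp)
  · exact mem3 (ico_a (sneg he)).2.1 (by simp) (by simp) (by simp)
  · exact mem3 (ico_a he).2.2 (by simp) (by simp) (by simp)
  · exact mem3 (ico_b (sneg ha) hb hc).1 (by simp; ring) (by simp) (by simp)
  · exact mem3 (ico_b ha hb (sneg hc)).2.1 (by simp; ring) (by simp) (by simp)
  · exact mem3 (ico_b ha (sneg hb) hc).2.2 (by simp; ring) (by simp) (by simp)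

theorem ico_p2 : ∀ x ∈ Icosidodecahedron, lin3 1 0 0 0 (-1) 0 0 0 1 x ∈ Icosidodecahedron := by
  apply hull_map
  rintro x (⟨ε, he, rfl | rfl | rfl⟩ | ⟨a, b, c, ha, hb, hc, rfl | rfl | rfl⟩)
  · exact mem3 (ico_a he).1 (by simp) (by simp) (by simp)
  · exact mem3 (ico_a he).2.1 (by simp) (by simp) (by simp)
  · exact mem3 (ico_a (sneg he)).2.2 (by simp) (by simp) (by simp)
  · exact mem3 (ico_b ha (sneg hb) hc).1 (by simp) (by simp; ring) (by simp)
  · exact mem3 (ico_b (sneg ha) hb hc).2.1 (by simp) (by simp; ring) (by simp)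
  · exact mem3 (ico_b ha hb (sneg hc)).2.2 (by simp) (by simp; ring) (by simp)

theorem ico_i0 (x : EucSp 3) : icoU (icoU x) = x := by
  have hg := golden_sq
  simp only [icoU, lin3_apply]
  apply ext3 <;> simp only [pt3_0, pt3_1, pt3_2] <;> grind

theorem ico_r3 (x : EucSp 3) : (fun x => lin3 (-1) 0 0 0 1 0 0 0 1 (icoU x))^[3] x = x := by
  have hg := golden_sq
  have h2 : ∀ x, lin3 (-1) 0 0 0 1 0 0 0 1 (icoU (lin3 (-1) 0 0 0 1 0 0 0 1 (icoU x)))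
      = lin3 (-1 / 2) (-goldenφ / 2) ((goldenφ - 1) / 2) (goldenφ / 2) ((1 - goldenφ) / 2) (1 / 2)
        ((1 - goldenφ) / 2) (1 / 2) (goldenφ / 2) x := by
    intro x
    simp only [icoU, lin3_apply]
    apply ext3 <;> simp only [pt3_0, pt3_1, pt3_2] <;> grind
  simp only [Function.iterate_succ_apply', Function.iterate_zero, id]
  rw [h2]
  simp only [icoU, lin3_apply]
  apply ext3 <;> simp only [pt3_0, pt3_1, pt3_2] <;> grind

theorem ico_r5 (x : EucSp 3) : (fun x => lin3 1 0 0 0 (-1) 0 0 0 1 (icoU x))^[5] x = x := by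
  have hg := golden_sq
  have h2 : ∀ x, lin3 1 0 0 0 (-1) 0 0 0 1 (icoU (lin3 1 0 0 0 (-1) 0 0 0 1 (icoU x)))
      = lin3 ((1 - goldenφ) / 2) (-1 / 2) (goldenφ / 2) (1 / 2) (-goldenφ / 2) ((1 - goldenφ) / 2)
        (goldenφ / 2) ((goldenφ - 1) / 2) (1 / 2) x := by
    intro x
    simp only [icoU, lin3_apply]
    apply ext3 <;> simp only [pt3_0, pt3_1, pt3_2] <;> grind
  have h4 : ∀ x, lin3 ((1 - goldenφ) / 2) (-1 / 2) (goldenφ / 2) (1 / 2) (-goldenφ / 2)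
      ((1 - goldenφ) / 2) (goldenφ / 2) ((goldenφ - 1) / 2) (1 / 2)
      (lin3 ((1 - goldenφ) / 2) (-1 / 2) (goldenφ / 2) (1 / 2) (-goldenφ / 2)
      ((1 - goldenφ) / 2) (goldenφ / 2) ((goldenφ - 1) / 2) (1 / 2) x)
      = lin3 (1 / 2) (goldenφ / 2) ((goldenφ - 1) / 2) (-goldenφ / 2) ((goldenφ - 1) / 2) (1 / 2)
        ((goldenφ - 1) / 2) (-1 / 2) (goldenφ / 2) x := by
    intro x
    simp only [lin3_apply]
    apply ext3 <;> simp only [pt3_0, pt3_1, pt3_2] <;> grind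
  simp only [Function.iterate_succ_apply', Function.iterate_zero, id]
  rw [h2 x, h2 (lin3 ((1 - goldenφ) / 2) (-1 / 2) (goldenφ / 2) (1 / 2) (-goldenφ / 2)
      ((1 - goldenφ) / 2) (goldenφ / 2) ((goldenφ - 1) / 2) (1 / 2) x), h4]
  simp only [icoU, lin3_apply]
  apply ext3 <;> simp only [pt3_0, pt3_1, pt3_2] <;> grind

theorem ico_type {ψ : Flag (Faces Icosidodecahedron) → Lex (Fin 3 → ℝ)}
    {h : GP (Faces Icosidodecahedron) faceRank 3} (H : h.Height ψ) : h.IsType 5 := by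
  have hg := golden_sq
  have g1 := golden_gt
  have sub : ∀ {x}, x ∈ icosidodecaVerts → x ∈ Icosidodecahedron := fun hx => subset_convexHull ℝ _ hx
  refine conc_type H (exp3 0 0 1 goldenφ ico_le_v)
    (exp3 1 1 (2 * goldenφ + 1) (3 * goldenφ + 2) ?qe)
    (exp3 0 1 (goldenφ + 1) (2 * goldenφ + 1) ico_le_t) (exp3 1 0 goldenφ (goldenφ + 1) ico_le_s)
    ⟨sub (ico_a sp).1, ?_⟩ ⟨sub (ico_b sp sp sp).1, ?_⟩ ?_
    ⟨sub (ico_b sm sp sp).1, ?_⟩ ?_ ?_ ⟨sub (ico_b sp sm sp).1, ?_⟩ ?_ ?_ ?ve ?et ?es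
    icoU (lin3 (-1) 0 0 0 1 0 0 0 1) (lin3 1 0 0 0 (-1) 0 0 0 1)
    ico_i0 ?i1 ?i2 ico_p0 ico_p1 ico_p2
    (fun x hx => ⟨ico_p0 x hx.1, ?_⟩) (fun x hx => ⟨ico_p0 x hx.1, ?_⟩)
    (fun x hx => ⟨ico_p0 x hx.1, ?_⟩) ?_
    (fun x hx => ⟨ico_p1 x hx.1, ?_⟩) (fun x hx => ⟨ico_p1 x hx.1, ?_⟩) ?_
    (fun x hx => ⟨ico_p2 x hx.1, ?_⟩) (fun x hx => ⟨ico_p2 x hx.1, ?_⟩) ?_ (Or.inr rfl)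
    ico_r3 ?i3 ico_r5
  case qe =>
    intro x hx
    linarith [ico_le_s x hx, ico_le_t x hx]
  case ve =>
    rintro x ⟨hx, e⟩
    have e' : x 2 = goldenφ := by linarith
    have a1 := ico_le_s x hx
    have a2 := ico_le_t x hx
    have a3 := ico_le_s _ (ico_p1 x hx)
    have a4 := ico_le_t _ (ico_p2 x hx)
    simp only [lin3_apply, pt3_0, pt3_1, pt3_2] at a3 a4
    rw [e'] at a1 a2 a3 a4
    refine ⟨hx, ?_⟩
    rw [e']
    linarith
  case et | es =>
    rintro x ⟨hx, e⟩
    have := ico_le_s x hx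
    have := ico_le_t x hx
    exact ⟨hx, by linarith⟩
  case i1 | i2 | i3 =>
    intro x
    apply ext3 <;> simp [Function.iterate_succ_apply']
  all_goals
    first
    | (simp only [pt3_0, pt3_1, pt3_2]; grind)
    | (have e := hx.2
       simp only [icoU, lin3_apply, pt3_0, pt3_1, pt3_2] at e ⊢
       grind)
    | (rintro ⟨_, e⟩
       simp only [icoU, lin3_apply, pt3_0, pt3_1, pt3_2] at e
       have hg3 : goldenφ ^ 3 = 2 * goldenφ + 1 := by linear_combination (goldenφ + 1) * hg
       linarith)
end ico

/-- A combinatorially two-orbit facet-intransitive convex `d`-polytope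
(class `2_{{0,…,d-2}}`) satisfies `d = 3` and is isomorphic to the cuboctahedron or to the
icosidodecahedron. -/
theorem facet_intransitive_classification {d : ℕ} (P : Set (EucSp d))
    (hP : IsConvexPolytope P)
    (h2 : InClass (faceRank (P := P)) d (Set.Iio (d - 1))) :
    d = 3 ∧
    (Nonempty (Faces P ≃o Faces Cuboctahedron) ∨
     Nonempty (Faces P ≃o Faces Icosidodecahedron)) := by
  obtain ⟨h, ψ, H⟩ := polytope_gp hP
  obtain ⟨e, ht⟩ := GP.class_type H h2
  subst e
  refine ⟨rfl, ?_⟩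
  rcases ht with ht | ht
  · obtain ⟨h', ψ', H'⟩ := polytope_gp cubo_poly
    exact Or.inl (GP.type_iso H H' ht (cubo_type H'))
  · obtain ⟨h', ψ', H'⟩ := polytope_gp ico_poly
    exact Or.inr (GP.type_iso H H' ht (ico_type H'))
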